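/- Let Γ be a geometrically finite Kleinian group and let ρ : Γ → G be a weakly type preserving isomorphism onto a non-elementary Kleinian group G for which a Cannon–Thurston map î : Λ_Γ → Λ_G exists. Then there exists a function f₁ : ℕ → ℕ such that for every L ∈ ℕ, whenever λ is a d_Γ-geodesic segment in the Cayley graph of Γ lying outside the ball B_Γ(1; f₁(L)), the ℍ³-geodesic segment [j(λ)] lies outside the hyperbolic ball B(O; L). -/

import Mathlib

/- Background framework: hyperbolic 3-space (upper half-space model), `PSL(2,ℂ)` and its
actions on `ℍ³` and on the Riemann sphere `Ĉ = ℂ ∪ {∞}`, limit sets, Kleinian groups,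
Cannon–Thurston maps, and the various convergence notions. -/

noncomputable section

open scoped Topology
open OnePoint

/-- `SL(2,ℂ)`. -/
abbrev SL2C := Matrix.SpecialLinearGroup (Fin 2) ℂ

instance : TopologicalSpace SL2C :=
  TopologicalSpace.induced (fun g => (g : Matrix (Fin 2) (Fin 2) ℂ)) inferInstance

/-- `PSL(2,ℂ)`, the quotient of `SL(2,ℂ)` by its center `{±I}`. -/
abbrev PSL2C := SL2C ⧸ Subgroup.center SL2C

/-- Hyperbolic 3-space, in the upper half-space model `{(z,t) : z ∈ ℂ, t > 0}`. -/
abbrev H3 := {p : ℂ × ℝ // 0 < p.2}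

/-- Inverse hyperbolic cosine. -/
def arcosh (x : ℝ) : ℝ := Real.log (x + Real.sqrt (x ^ 2 - 1))

/-- The hyperbolic distance on the upper half-space model:
`cosh (d3 p q) = 1 + (|z₁-z₂|² + (t₁-t₂)²)/(2 t₁ t₂)`. -/
def d3 (p q : H3) : ℝ :=
  arcosh (1 + (‖p.1.1 - q.1.1‖ ^ 2 + (p.1.2 - q.1.2) ^ 2) / (2 * p.1.2 * q.1.2))

lemma denom_pos (g : SL2C) (z : ℂ) (t : ℝ) (ht : 0 < t) :
    0 < Complex.normSq (g.1 1 0 * z + g.1 1 1) + Complex.normSq (g.1 1 0) * t ^ 2 := by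
  rcases eq_or_ne (g.1 1 0) 0 with hc | hc
  · have hd : g.1 1 1 ≠ 0 := by
      intro hd
      have h := g.2
      rw [Matrix.det_fin_two] at h
      rw [hc, hd] at h
      simp at h
    have h1 : 0 < Complex.normSq (g.1 1 0 * z + g.1 1 1) := by
      rw [hc]
      simpa using Complex.normSq_pos.mpr hd
    nlinarith [Complex.normSq_nonneg (g.1 1 0), sq_nonneg t]
  · have h2 : 0 < Complex.normSq (g.1 1 0) * t ^ 2 := by
      have := Complex.normSq_pos.mpr hc
      positivity
    nlinarith [Complex.normSq_nonneg (g.1 1 0 * z + g.1 1 1)]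

/-- The isometric action of `SL(2,ℂ)` on the upper half-space (the Poincaré extension of
the Möbius action, given by the standard quaternionic formula). -/
def act3SL (g : SL2C) (p : H3) : H3 :=
  ⟨((((g.1 0 0) * p.1.1 + g.1 0 1) * (starRingEnd ℂ) ((g.1 1 0) * p.1.1 + g.1 1 1) +
      (g.1 0 0) * (starRingEnd ℂ) (g.1 1 0) * (p.1.2 : ℂ) ^ 2) /
      ((Complex.normSq ((g.1 1 0) * p.1.1 + g.1 1 1) + Complex.normSq (g.1 1 0) * p.1.2 ^ 2 : ℝ) : ℂ),
    p.1.2 / (Complex.normSq ((g.1 1 0) * p.1.1 + g.1 1 1) + Complex.normSq (g.1 1 0) * p.1.2 ^ 2)),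
    div_pos p.2 (denom_pos g p.1.1 p.1.2 p.2)⟩

/-- The action of `PSL(2,ℂ)` on hyperbolic 3-space.  (The `SL(2,ℂ)`-action is invariant
under the center, so the value does not depend on the choice of representative.) -/
def act3 (q : PSL2C) : H3 → H3 := act3SL q.out

/-- The Möbius action of `SL(2,ℂ)` on the Riemann sphere `Ĉ = ℂ ∪ {∞}`. -/
def mobiusSL (g : SL2C) : OnePoint ℂ → OnePoint ℂ := fun x =>
  Option.elim x
    (if g.1 1 0 = 0 then (∞ : OnePoint ℂ) else ((g.1 0 0 / g.1 1 0 : ℂ) : OnePoint ℂ))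
    (fun z => if g.1 1 0 * z + g.1 1 1 = 0 then (∞ : OnePoint ℂ)
      else (((g.1 0 0 * z + g.1 0 1) / (g.1 1 0 * z + g.1 1 1) : ℂ) : OnePoint ℂ))

/-- The Möbius action of `PSL(2,ℂ)` on the Riemann sphere. -/
def actS (q : PSL2C) : OnePoint ℂ → OnePoint ℂ := mobiusSL q.out

/-- The inclusion of the upper half-space into the one-point compactification of `ℂ × ℝ`;
together with `iBd` this realizes the compactification `ℍ³ ∪ Ĉ`. -/
def iH3 : H3 → OnePoint (ℂ × ℝ) := fun p => (p.1 : OnePoint (ℂ × ℝ))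

/-- The inclusion of the Riemann sphere `Ĉ` as the boundary `{t = 0} ∪ {∞}` of the closure
of the upper half-space in the one-point compactification of `ℂ × ℝ`. -/
def iBd : OnePoint ℂ → OnePoint (ℂ × ℝ) := fun ξ =>
  Option.elim ξ (∞ : OnePoint (ℂ × ℝ)) (fun z => (((z, (0 : ℝ)) : ℂ × ℝ) : OnePoint (ℂ × ℝ)))

/-- The limit set of a subgroup `Γ ≤ PSL(2,ℂ)` with respect to a base point `O ∈ ℍ³`:
the set of accumulation points in `Ĉ` of the orbit `Γ·O`. -/
def limitSet (Γ : Subgroup PSL2C) (O : H3) : Set (OnePoint ℂ) :=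
  {ξ | iBd ξ ∈ closure (iH3 '' ((fun g => act3 g O) '' (Γ : Set PSL2C)))}

/-- The chordal (spherical) metric on the Riemann sphere `Ĉ = ℂ ∪ {∞}`. -/
def chordalDist : OnePoint ℂ → OnePoint ℂ → ℝ := fun x y =>
  Option.elim x
    (Option.elim y 0 (fun w => 2 / Real.sqrt (1 + ‖w‖ ^ 2)))
    (fun z => Option.elim y (2 / Real.sqrt (1 + ‖z‖ ^ 2))
      (fun w => 2 * ‖z - w‖ /
        (Real.sqrt (1 + ‖z‖ ^ 2) * Real.sqrt (1 + ‖w‖ ^ 2))))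

/-- A nontrivial element of `PSL(2,ℂ)` is parabolic if it has exactly one fixed point on `Ĉ`. -/
def IsParabolic (g : PSL2C) : Prop := g ≠ 1 ∧ ∃! ξ : OnePoint ℂ, actS g ξ = ξ

/-- A nontrivial element of `PSL(2,ℂ)` is loxodromic if it has exactly two fixed points
on `Ĉ` and generates an unbounded cyclic group. -/
def IsLoxodromic (g : PSL2C) : Prop :=
  g ≠ 1 ∧ (∃ ξ η : OnePoint ℂ, ξ ≠ η ∧ {ζ | actS g ζ = ζ} = {ξ, η}) ∧
    ¬ IsCompact (closure (Set.range fun n : ℤ => g ^ n))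

/-- A subgroup of `PSL(2,ℂ)` is discrete if each of its elements is isolated. -/
def IsDiscreteSubgroup (Γ : Subgroup PSL2C) : Prop :=
  ∀ g ∈ Γ, ∃ U : Set PSL2C, IsOpen U ∧ g ∈ U ∧ ∀ h ∈ Γ, h ∈ U → h = g

def IsTorsionFreeSubgroup (Γ : Subgroup PSL2C) : Prop :=
  ∀ g ∈ Γ, ∀ n : ℕ, 0 < n → g ^ n = 1 → g = 1

/-- A Kleinian group: a discrete torsion-free subgroup of `PSL(2,ℂ)`. -/
def IsKleinian (Γ : Subgroup PSL2C) : Prop :=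
  IsDiscreteSubgroup Γ ∧ IsTorsionFreeSubgroup Γ

/-- The Dirichlet fundamental polyhedron of `Γ` centered at `O`. -/
def DirichletDomain (Γ : Subgroup PSL2C) (O : H3) : Set H3 :=
  {x | ∀ g ∈ Γ, d3 x O ≤ d3 x (act3 g O)}

/-- A Kleinian group is geometrically finite if it has a finite-sided fundamental
polyhedron in `ℍ³` (concretely: some Dirichlet polyhedron has finitely many faces). -/
def IsGeometricallyFinite (Γ : Subgroup PSL2C) : Prop :=
  ∃ O : H3, (∀ g ∈ Γ, g ≠ 1 → act3 g O ≠ O) ∧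
    Set.Finite {g : PSL2C | g ∈ Γ ∧ g ≠ 1 ∧
      ∃ x ∈ DirichletDomain Γ O, d3 x O = d3 x (act3 g O)}

/-- The geodesic segment in `ℍ³` between two points, via the betweenness relation. -/
def geoSeg (X Y : H3) : Set H3 := {p | d3 X p + d3 p Y = d3 X Y}

/-- `f` is a Cannon–Thurston map for the isomorphism `ρ` of `Γ` onto its image:
a continuous map from `Λ_Γ` to `Λ_{ρ(Γ)}` satisfying `f(γ·ξ) = ρ(γ)·f(ξ)`. -/
def IsCTMap (Γ : Subgroup PSL2C) (ρ : ↥Γ →* PSL2C) (O : H3)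
    (f : OnePoint ℂ → OnePoint ℂ) : Prop :=
  ContinuousOn f (limitSet Γ O) ∧
  Set.MapsTo f (limitSet Γ O) (limitSet ρ.range O) ∧
  ∀ γ : ↥Γ, ∀ ξ ∈ limitSet Γ O, f (actS (↑γ) ξ) = actS (ρ γ) (f ξ)

/-- `ρ` is weakly type preserving: images of parabolic elements are parabolic. -/
def WeaklyTypePreserving (Γ : Subgroup PSL2C) (ρ : ↥Γ →* PSL2C) : Prop :=
  ∀ γ : ↥Γ, IsParabolic (↑γ) → IsParabolic (ρ γ)

/-- `ρ` is strictly type preserving: `γ` is parabolic iff `ρ(γ)` is parabolic. -/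
def StrictlyTypePreserving (Γ : Subgroup PSL2C) (ρ : ↥Γ →* PSL2C) : Prop :=
  ∀ γ : ↥Γ, IsParabolic (↑γ) ↔ IsParabolic (ρ γ)

/-- Algebraic convergence of a sequence of representations. -/
def ConvergesAlgebraically (Γ : Subgroup PSL2C) (ρ : ℕ → (↥Γ →* PSL2C))
    (ρlim : ↥Γ →* PSL2C) : Prop :=
  ∀ γ : ↥Γ, Filter.Tendsto (fun n => ρ n γ) Filter.atTop (𝓝 (ρlim γ))

/-- Geometric (Chabauty) convergence of a sequence of subgroups of `PSL(2,ℂ)`: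
every element of `H` is a limit of elements `gₙ ∈ Gₙ`, and every accumulation point of
any sequence `gₙ ∈ Gₙ` lies in `H`. -/
def ConvergesGeometrically (G : ℕ → Subgroup PSL2C) (H : Subgroup PSL2C) : Prop :=
  (∀ h ∈ H, ∃ g : ℕ → PSL2C, (∀ n, g n ∈ G n) ∧ Filter.Tendsto g Filter.atTop (𝓝 h)) ∧
  (∀ g : ℕ → PSL2C, (∀ n, g n ∈ G n) →
    ∀ x : PSL2C, MapClusterPt x Filter.atTop g → x ∈ H)

/-- Strong convergence: algebraic convergence together with geometric convergence of the
image groups to the image of the limit representation. -/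
def ConvergesStrongly (Γ : Subgroup PSL2C) (ρ : ℕ → (↥Γ →* PSL2C))
    (ρlim : ↥Γ →* PSL2C) : Prop :=
  ConvergesAlgebraically Γ ρ ρlim ∧
  ConvergesGeometrically (fun n => (ρ n).range) ρlim.range

/-- Word length of `g` with respect to a generating set `S`: the least length of a word
in the generators representing `g`. -/
def wordLength (S : Set PSL2C) (g : PSL2C) : ℕ :=
  sInf {n | ∃ l : List PSL2C, l.length = n ∧ (∀ x ∈ l, x ∈ S) ∧ l.prod = g}

/-- The word metric `d_Γ` on the Cayley graph. -/
def wordDist (S : Set PSL2C) (g h : PSL2C) : ℕ := wordLength S (g⁻¹ * h)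

/-- `w 0, w 1, …, w m` is a geodesic segment in the Cayley graph with respect to the
(symmetric) generating set `S`: consecutive vertices differ by a generator, and the
word distance between the endpoints equals the number of edges. -/
def IsWordGeodesic (S : Set PSL2C) (m : ℕ) (w : ℕ → PSL2C) : Prop :=
  (∀ i < m, (w i)⁻¹ * w (i + 1) ∈ S) ∧ wordDist S (w 0) (w m) = m

/-- A Kleinian group is non-elementary if its limit set has more than two points. -/
def IsNonElementary (G : Subgroup PSL2C) (O : H3) : Prop :=
  ¬ ∃ a b : OnePoint ℂ, limitSet G O ⊆ {a, b}

/-! ### The Lorentz form on `ℝ × ℝ³` -/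

/-- Minkowski space `ℝ × ℝ³`. -/
abbrev Mink := ℝ × EuclideanSpace ℝ (Fin 3)

namespace Mink

/-- The Lorentz form of signature `(1,3)`. -/
def form (x y : Mink) : ℝ := x.1 * y.1 - inner ℝ x.2 y.2

/-- The closed forward cone. -/
def cone : Set Mink := {x | ‖x.2‖ ≤ x.1}

/-- The base point of the hyperboloid. -/
def base : Mink := (1, 0)

lemma form_comm (x y : Mink) : form x y = form y x := by
  simp only [form, real_inner_comm, mul_comm]

lemma form_add_left (x y z : Mink) : form (x + y) z = form x z + form y z := by
  simp only [form, Prod.fst_add, Prod.snd_add, inner_add_left]; ring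

lemma form_smul_left (r : ℝ) (x y : Mink) : form (r • x) y = r * form x y := by
  simp only [form, Prod.smul_fst, Prod.smul_snd, real_inner_smul_left, smul_eq_mul]; ring

lemma form_add_right (x y z : Mink) : form x (y + z) = form x y + form x z := by
  rw [form_comm, form_add_left, form_comm y, form_comm z]

lemma form_smul_right (r : ℝ) (x y : Mink) : form x (r • y) = r * form x y := by
  rw [form_comm, form_smul_left, form_comm y]

lemma form_base (x : Mink) : form x base = x.1 := by simp [form, base]

lemma base_form (x : Mink) : form base x = x.1 := by simp [form, base]

lemma form_self (x : Mink) : form x x = x.1 ^ 2 - ‖x.2‖ ^ 2 := by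
  simp only [form, real_inner_self_eq_norm_sq]; ring

lemma base_mem_cone : base ∈ cone := by simp [cone, base]

lemma continuous_form : Continuous fun p : Mink × Mink => form p.1 p.2 := by
  unfold form; fun_prop

lemma isClosed_cone : IsClosed cone := by
  apply isClosed_le <;> fun_prop

lemma fst_nonneg {x : Mink} (hx : x ∈ cone) : 0 ≤ x.1 := (norm_nonneg _).trans hx

lemma eq_zero_of_fst {x : Mink} (hx : x ∈ cone) (h : x.1 = 0) : x = 0 := by
  have h2 : ‖x.2‖ ≤ 0 := h ▸ (show ‖x.2‖ ≤ x.1 from hx)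
  exact Prod.ext h (norm_le_zero_iff.1 h2)

lemma fst_pos {x : Mink} (hx : x ∈ cone) (h : x ≠ 0) : 0 < x.1 :=
  (fst_nonneg hx).lt_of_ne fun h' => h (eq_zero_of_fst hx h'.symm)

lemma add_mem_cone {x y : Mink} (hx : x ∈ cone) (hy : y ∈ cone) : x + y ∈ cone :=
  (norm_add_le _ _).trans (add_le_add (show ‖x.2‖ ≤ x.1 from hx) (show ‖y.2‖ ≤ y.1 from hy))

lemma smul_mem_cone {r : ℝ} (hr : 0 ≤ r) {x : Mink} (hx : x ∈ cone) : r • x ∈ cone := by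
  change ‖r • x.2‖ ≤ r • x.1
  rw [norm_smul, Real.norm_of_nonneg hr]
  exact mul_le_mul_of_nonneg_left hx hr

/-- Pairing with a vector of the cone is bounded below by the height. -/
lemma mul_fst_le_form {x y : Mink} (hy : y ∈ cone) : (x.1 - ‖x.2‖) * y.1 ≤ form x y := by
  have h1 := real_inner_le_norm x.2 y.2
  have h2 : ‖x.2‖ * ‖y.2‖ ≤ ‖x.2‖ * y.1 := mul_le_mul_of_nonneg_left hy (norm_nonneg _)
  unfold form; nlinarith

lemma form_nonneg {x y : Mink} (hx : x ∈ cone) (hy : y ∈ cone) : 0 ≤ form x y :=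
  (mul_nonneg (sub_nonneg.2 hx) (fst_nonneg hy)).trans (mul_fst_le_form hy)

lemma form_le {x y : Mink} (hx : x ∈ cone) (hy : y ∈ cone) : form x y ≤ 2 * (x.1 * y.1) := by
  have h1 := neg_le_of_abs_le (abs_real_inner_le_norm x.2 y.2)
  have h2 : ‖x.2‖ * ‖y.2‖ ≤ x.1 * y.1 := mul_le_mul hx hy (norm_nonneg _) (fst_nonneg hx)
  unfold form; linarith

lemma norm_sub_sq_le {x y : EuclideanSpace ℝ (Fin 3)} (hx : ‖x‖ ≤ 1) (hy : ‖y‖ ≤ 1) :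
    ‖x - y‖ ^ 2 ≤ 2 * (1 - inner ℝ x y) := by
  rw [norm_sub_sq_real]
  nlinarith [norm_nonneg x, norm_nonneg y]

/-- A weak triangle inequality for `1 - ⟪x, y⟫` on the closed unit ball. -/
lemma one_sub_inner_le {x y z : EuclideanSpace ℝ (Fin 3)} (hx : ‖x‖ ≤ 1) (hy : ‖y‖ ≤ 1)
    (hz : ‖z‖ ≤ 1) :
    1 - inner ℝ x z ≤ 3 * ((1 - inner ℝ x y) + (1 - inner ℝ y z)) := by
  have h1 := norm_sub_sq_le hx hy
  have h2 := norm_sub_sq_le hy hz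
  have h3 : ‖x - z‖ ≤ ‖x - y‖ + ‖y - z‖ := norm_sub_le_norm_sub_add_norm_sub x y z
  have h4 : ‖x - z‖ ^ 2 ≤ 2 * ‖x - y‖ ^ 2 + 2 * ‖y - z‖ ^ 2 := by
    nlinarith [norm_nonneg (x - z), sq_nonneg (‖x - y‖ - ‖y - z‖)]
  have h5 : inner ℝ x y ≤ ‖x‖ := (real_inner_le_norm x y).trans
    (mul_le_of_le_one_right (norm_nonneg _) hy)
  have h6 : inner ℝ y z ≤ ‖z‖ := (real_inner_le_norm y z).trans
    (mul_le_of_le_one_left (norm_nonneg _) hy)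
  have h7 := norm_sub_sq_real x z
  nlinarith [norm_nonneg x, norm_nonneg z]

/-- The point of the projective (Klein) model represented by a vector. -/
def klein (x : Mink) : EuclideanSpace ℝ (Fin 3) := x.1⁻¹ • x.2

lemma norm_klein_le {x : Mink} (hx : x ∈ cone) : ‖klein x‖ ≤ 1 := by
  rw [klein, norm_smul, norm_inv, Real.norm_of_nonneg (fst_nonneg hx)]
  exact inv_mul_le_one_of_le₀ hx (fst_nonneg hx)

lemma form_eq_klein {x y : Mink} (hx : x.1 ≠ 0) (hy : y.1 ≠ 0) :
    form x y = x.1 * y.1 * (1 - inner ℝ (klein x) (klein y)) := by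
  simp only [form, klein, real_inner_smul_left, real_inner_smul_right]
  field_simp

lemma form_triangle {x y z : Mink} (hx : x ∈ cone) (hy : y ∈ cone) (hz : z ∈ cone) :
    form x z * y.1 ≤ 3 * (form x y * z.1 + form y z * x.1) := by
  rcases eq_or_ne x 0 with rfl | hx0
  · simp [form]
  rcases eq_or_ne z 0 with rfl | hz0
  · simp [form]
  rcases eq_or_ne y 0 with rfl | hy0
  · simp [form]
  have px := fst_pos hx hx0
  have py := fst_pos hy hy0
  have pz := fst_pos hz hz0
  rw [form_eq_klein px.ne' pz.ne', form_eq_klein px.ne' py.ne', form_eq_klein py.ne' pz.ne']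
  have h := mul_le_mul_of_nonneg_left
    (one_sub_inner_le (norm_klein_le hx) (norm_klein_le hy) (norm_klein_le hz))
    (mul_pos (mul_pos px py) pz).le
  nlinarith

/-- Null vectors of the cone with vanishing pairing have the same direction. -/
lemma klein_eq_of_form_eq_zero {x y : Mink} (hx : x ∈ cone) (hy : y ∈ cone) (hx0 : x ≠ 0)
    (hy0 : y ≠ 0) (h : form x y = 0) : klein x = klein y := by
  rw [form_eq_klein (fst_pos hx hx0).ne' (fst_pos hy hy0).ne'] at h
  have h1 : 1 - inner ℝ (klein x) (klein y) = 0 := by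
    rcases mul_eq_zero.1 h with h | h
    · exact absurd h (mul_pos (fst_pos hx hx0) (fst_pos hy hy0)).ne'
    · exact h
  have h2 := norm_sub_sq_le (norm_klein_le hx) (norm_klein_le hy)
  rw [h1] at h2
  have h3 : ‖klein x - klein y‖ = 0 := by nlinarith [norm_nonneg (klein x - klein y)]
  exact sub_eq_zero.1 (norm_eq_zero.1 h3)

/-- A vector of the cone is timelike iff it is interior. -/
lemma norm_lt_fst {x : Mink} (hx : x ∈ cone) (h : 0 < form x x) : ‖x.2‖ < x.1 := by
  rw [form_self] at h
  exact lt_of_pow_lt_pow_left₀ 2 (fst_nonneg hx) (by linarith)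

/-- Two distinct planes `⟪·, p⟫ = s - 1` bisecting the base point and points of the hyperboloid
share at most two points of the sphere. -/
lemma eq_of_three_common_ideal_points {p q : Mink} (hp : form p p = 1) (hq : form q q = 1)
    (hp1 : 1 < p.1) (hq1 : 1 < q.1) {e : Fin 3 → EuclideanSpace ℝ (Fin 3)}
    (he : Function.Injective e) (hn : ∀ i, ‖e i‖ = 1)
    (hep : ∀ i, form (1, e i) p = 1) (heq : ∀ i, form (1, e i) q = 1) : p = q := by
  have hp' : ∀ i, inner ℝ (e i) p.2 = p.1 - 1 := fun i => by
    have := hep i; simp only [form] at this; linarith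
  have hq' : ∀ i, inner ℝ (e i) q.2 = q.1 - 1 := fun i => by
    have := heq i; simp only [form] at this; linarith
  set a := e 1 - e 0 with ha
  set b := e 2 - e 0 with hb
  have ha0 : a ≠ 0 := sub_ne_zero.2 (he.ne (by decide))
  have hb0 : b ≠ 0 := sub_ne_zero.2 (he.ne (by decide))
  have hsq : ∀ i, e i ≠ e 0 → inner ℝ (e 0) (e i - e 0) = -‖e i - e 0‖ ^ 2 / 2 := fun i _ => by
    have := norm_add_sq_real (e 0) (e i - e 0)
    rw [add_sub_cancel, hn, hn] at this
    linarith
  have hli : LinearIndependent ℝ ![a, b] := by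
    rw [LinearIndependent.pair_iff' ha0]
    intro c hc
    have h1 := hsq 1 (he.ne (by decide))
    have h2 := hsq 2 (he.ne (by decide))
    rw [← ha] at h1
    rw [← hb, ← hc, real_inner_smul_right, h1, norm_smul, mul_pow, Real.norm_eq_abs, sq_abs] at h2
    have hapos : 0 < ‖a‖ ^ 2 := by positivity
    have hc01 : c * (c - 1) * ‖a‖ ^ 2 = 0 := by linarith
    rcases mul_eq_zero.1 (mul_eq_zero.1 hc01 |>.resolve_right hapos.ne') with h | h
    · rw [h, zero_smul] at hc; exact hb0 hc.symm
    · have hab : a = b := by rw [← hc, sub_eq_zero.1 h, one_smul]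
      have : e 1 = e 2 := by simpa [ha, hb] using hab
      exact absurd (he this) (by decide)
  have hrank : Module.finrank ℝ (Submodule.span ℝ (Set.range ![a, b]))ᗮ = 1 := by
    have h := Submodule.finrank_add_finrank_orthogonal (Submodule.span ℝ (Set.range ![a, b]))
    rw [finrank_span_eq_card hli] at h
    simp at h
    omega
  have hmem : ∀ x : EuclideanSpace ℝ (Fin 3), inner ℝ a x = 0 → inner ℝ b x = 0 →
      x ∈ (Submodule.span ℝ (Set.range ![a, b]))ᗮ := fun x h1 h2 => by
    rw [Submodule.mem_orthogonal]
    intro u hu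
    induction hu using Submodule.span_induction with
    | mem u hu =>
      obtain ⟨i, rfl⟩ := hu
      fin_cases i
      · simpa using h1
      · simpa using h2
    | zero => simp
    | add u v _ _ hu hv => rw [inner_add_left, hu, hv, add_zero]
    | smul r u _ hu => rw [real_inner_smul_left, hu, mul_zero]
  have hpm := hmem p.2 (by rw [ha, inner_sub_left, hp', hp', sub_self])
    (by rw [hb, inner_sub_left, hp', hp', sub_self])
  have hqm := hmem q.2 (by rw [ha, inner_sub_left, hq', hq', sub_self])
    (by rw [hb, inner_sub_left, hq', hq', sub_self])
  have hp0 : p.2 ≠ 0 := fun h => by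
    have := hp' 0; rw [h, inner_zero_right] at this; linarith
  obtain ⟨c, hc⟩ := (finrank_eq_one_iff_of_nonzero' ⟨p.2, hpm⟩
    (by simpa [Subtype.ext_iff] using hp0)).1 hrank ⟨q.2, hqm⟩
  have hc : c • p.2 = q.2 := congrArg Subtype.val hc
  have h1 : q.1 - 1 = c * (p.1 - 1) := by
    rw [← hq' 0, ← hp' 0, ← hc, real_inner_smul_right]
  rw [form_self] at hp hq
  rw [← hc, norm_smul, mul_pow, Real.norm_eq_abs, sq_abs] at hq
  have h2 : c * (c - 1) * (p.1 - 1) = 0 := by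
    have : q.1 = 1 + c * (p.1 - 1) := by linarith
    rw [this] at hq
    have : ‖p.2‖ ^ 2 = p.1 ^ 2 - 1 := by linarith
    rw [this] at hq
    linarith
  rcases mul_eq_zero.1 (mul_eq_zero.1 h2 |>.resolve_right (by linarith)) with h | h
  · rw [h] at h1; linarith
  · have : c = 1 := by linarith
    subst this
    rw [one_smul] at hc
    exact Prod.ext (by linarith) hc

end Mink

/-! ### Discrete groups of Lorentz transformations -/

lemma exists_pos_forall_of_finite {ι : Type*} {s : Set ι} (hs : s.Finite) {P : ι → ℝ → Prop}
    (hP : ∀ i ∈ s, ∃ δ : ℝ, 0 < δ ∧ P i δ)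
    (hmono : ∀ i (δ δ' : ℝ), 0 < δ' → δ' ≤ δ → P i δ → P i δ') :
    ∃ δ : ℝ, 0 < δ ∧ ∀ i ∈ s, P i δ := by
  have h : ∀ i ∈ s, ∀ᶠ δ : ℝ in 𝓝[>] 0, P i δ := fun i hi => by
    obtain ⟨δ, hδ, hPδ⟩ := hP i hi
    filter_upwards [Ioc_mem_nhdsGT hδ] with δ' h'
    exact hmono i δ δ' h'.1 h'.2 hPδ
  obtain ⟨δ, h1, h2⟩ := (((Filter.eventually_all_finite hs).2 h).and self_mem_nhdsWithin).exists
  exact ⟨δ, h2, h1⟩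

open Mink in
/-- A free and proper action of a group on the hyperboloid by linear Lorentz transformations. -/
structure LorentzAction (G : Type*) [Group G] where
  rep : G →* Module.End ℝ Mink
  form_rep : ∀ g x y, form (rep g x) (rep g y) = form x y
  rep_mem_cone : ∀ g, ∀ x ∈ cone, rep g x ∈ cone
  proper : ∀ C : ℝ, {g | (rep g base).1 ≤ C}.Finite
  free : ∀ g, rep g base = base → g = 1

namespace LorentzAction

open Mink

variable {G : Type*} [Group G] (π : LorentzAction G)

/-- The orbit of the base point. -/
def orb (g : G) : Mink := π.rep g base

/-- The group elements whose Dirichlet cell meets the Dirichlet cell of the base point. -/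
def nbrs : Set G := {g | g ≠ 1 ∧ ∃ x ∈ cone, 0 < form x x ∧
  (∀ h, form x base ≤ form x (π.orb h)) ∧ form x base = form x (π.orb g)}

lemma rep_mul_apply (g h : G) (x : Mink) : π.rep (g * h) x = π.rep g (π.rep h x) := by
  rw [map_mul]; rfl

lemma rep_one_apply (x : Mink) : π.rep 1 x = x := by rw [map_one]; rfl

lemma rep_inv_rep (g : G) (x : Mink) : π.rep g⁻¹ (π.rep g x) = x := by
  rw [← rep_mul_apply, inv_mul_cancel, rep_one_apply]

lemma orb_one : π.orb 1 = base := π.rep_one_apply base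

lemma rep_orb (g h : G) : π.rep g (π.orb h) = π.orb (g * h) := (π.rep_mul_apply g h base).symm

lemma form_rep_orb (g h : G) (x : Mink) :
    form (π.rep g x) (π.orb h) = form x (π.orb (g⁻¹ * h)) := by
  rw [← π.form_rep g x, rep_orb, mul_inv_cancel_left]

lemma form_orb_orb (g h k : G) :
    form (π.orb (g * h)) (π.orb (g * k)) = form (π.orb h) (π.orb k) := by
  rw [← rep_orb, ← rep_orb, π.form_rep]

lemma orb_mem_cone (g : G) : π.orb g ∈ cone := π.rep_mem_cone g _ base_mem_cone

lemma form_orb_self (g : G) : form (π.orb g) (π.orb g) = 1 := by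
  rw [orb, π.form_rep, form_base]; rfl

lemma one_le_fst_orb (g : G) : 1 ≤ (π.orb g).1 := by
  have h := π.form_orb_self g
  rw [form_self] at h
  nlinarith [sq_nonneg ‖(π.orb g).2‖, fst_nonneg (π.orb_mem_cone g)]

lemma one_lt_fst_orb {g : G} (hg : g ≠ 1) : 1 < (π.orb g).1 := by
  refine (π.one_le_fst_orb g).lt_of_ne fun h => hg (π.free g ?_)
  have h2 := π.form_orb_self g
  rw [form_self, ← h] at h2
  have h3 : ‖(π.orb g).2‖ = 0 := by nlinarith
  exact Prod.ext h.symm (norm_eq_zero.1 h3)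

lemma eq_of_orb_eq {g h : G} (hgh : π.orb g = π.orb h) : g = h := by
  have : h⁻¹ * g = 1 := π.free _ (by
    change π.orb _ = _
    rw [← rep_orb, hgh, rep_orb, inv_mul_cancel, orb_one])
  exact (inv_mul_eq_one.1 this).symm

lemma one_le_form_orb (g h : G) : 1 ≤ form (π.orb g) (π.orb h) := by
  have h1 := π.form_orb_orb g 1 (g⁻¹ * h)
  rw [mul_one, mul_inv_cancel_left, orb_one, base_form] at h1
  rw [h1]
  exact π.one_le_fst_orb _

lemma continuous_rep (g : G) : Continuous (π.rep g) :=
  LinearMap.continuous_of_finiteDimensional _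

lemma finite_form_le {x : Mink} (hx : ‖x.2‖ < x.1) (C : ℝ) :
    {g | form x (π.orb g) ≤ C}.Finite := by
  refine (π.proper (C / (x.1 - ‖x.2‖))).subset fun g hg => ?_
  have hpos : 0 < x.1 - ‖x.2‖ := sub_pos.2 hx
  have h := mul_fst_le_form (x := x) (π.orb_mem_cone g)
  change (π.orb g).1 ≤ _
  rw [le_div_iff₀ hpos]
  have hg : form x (π.orb g) ≤ C := hg
  linarith

lemma exists_form_min {x : Mink} (hx : ‖x.2‖ < x.1) {T : Set G} {t : G} (ht : t ∈ T) :
    ∃ h ∈ T, ∀ k ∈ T, form x (π.orb h) ≤ form x (π.orb k) := by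
  obtain ⟨h, hh, hmin⟩ := Set.exists_min_image {g | g ∈ T ∧ form x (π.orb g) ≤ form x (π.orb t)}
    (fun g => form x (π.orb g)) ((π.finite_form_le hx _).subset fun g hg => hg.2) ⟨t, ht, le_rfl⟩
  refine ⟨h, hh.1, fun k hk => ?_⟩
  rcases le_total (form x (π.orb k)) (form x (π.orb t)) with h1 | h1
  · exact hmin k ⟨hk, h1⟩
  · exact hh.2.trans h1

lemma form_triangle_orb {x y z : Mink} (hx : x ∈ cone) (hy : y ∈ cone) (hz : z ∈ cone) (g : G) :
    form x z * form y (π.orb g) ≤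
      3 * (form x y * form z (π.orb g) + form y z * form x (π.orb g)) := by
  have h := form_triangle (π.rep_mem_cone g⁻¹ x hx) (π.rep_mem_cone g⁻¹ y hy)
    (π.rep_mem_cone g⁻¹ z hz)
  simpa only [π.form_rep, ← form_base, ← π.orb_one, form_rep_orb, inv_inv, mul_one] using h

lemma form_orb_pos {x : Mink} (hx : x ∈ cone) (hx0 : x ≠ 0) (g : G) : 0 < form x (π.orb g) := by
  have h : 0 < (π.rep g⁻¹ x).1 := fst_pos (π.rep_mem_cone _ _ hx) fun h => hx0 (by
    rw [← π.rep_inv_rep g⁻¹ x, h, map_zero])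
  rwa [← form_base, ← π.orb_one, form_rep_orb, inv_inv, mul_one] at h

lemma norm_snd_orb_lt (g : G) : ‖(π.orb g).2‖ < (π.orb g).1 :=
  norm_lt_fst (π.orb_mem_cone g) (by rw [form_orb_self]; norm_num)

/-- The Dirichlet domain is cut out by the neighbours. -/
lemma form_base_le_of_nbrs {x : Mink} (hx : x ∈ cone) (hx1 : 0 < form x x)
    (h : ∀ g ∈ π.nbrs, form x base ≤ form x (π.orb g)) (k : G) :
    form x base ≤ form x (π.orb k) := by
  by_contra! hk
  set Z : Set G := {g | form x (π.orb g) < form x base} with hZ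
  have hZfin : Z.Finite := (π.finite_form_le (norm_lt_fst hx hx1) (form x base)).subset
    fun g hg => (show form x (π.orb g) < form x base from hg).le
  have hne : ∀ g ∈ Z, 0 < (π.orb g).1 - 1 := fun g hg => by
    refine sub_pos.2 (π.one_lt_fst_orb ?_)
    rintro rfl
    change form x (π.orb 1) < form x base at hg
    rw [orb_one] at hg
    exact lt_irrefl _ hg
  set d : G → ℝ := fun g => form x base - form x (π.orb g)
  have hd : ∀ g ∈ Z, 0 < d g := fun g hg => sub_pos.2 hg
  obtain ⟨g, hg, hmin⟩ := Set.exists_min_image Z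
    (fun g => ((π.orb g).1 - 1) / d g) hZfin ⟨k, hk⟩
  set t := ((π.orb g).1 - 1) / d g with ht
  have htpos : 0 < t := div_pos (hne g hg) (hd g hg)
  have hy : ∀ k, form (base + t • x) (π.orb k) - form (base + t • x) base
      = ((π.orb k).1 - 1) - t * d k := fun k => by
    have hb : form base base = 1 := form_base base
    simp only [form_add_left, form_smul_left, base_form (π.orb k), hb, d]
    ring
  have htg : t * d g = (π.orb g).1 - 1 := div_mul_cancel₀ _ (hd g hg).ne'
  have hgn : g ∈ π.nbrs := by
    refine ⟨fun h1 => ?_, base + t • x, add_mem_cone base_mem_cone (smul_mem_cone htpos.le hx),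
      ?_, fun k => ?_, ?_⟩
    · have := hne g hg
      rw [h1, orb_one] at this
      simp [base] at this
    · simp only [form_add_left, form_add_right, form_smul_left, form_smul_right, base_form,
        form_base, Prod.fst_add, Prod.smul_fst, smul_eq_mul]
      have : 0 ≤ x.1 := fst_nonneg hx
      have hb : base.1 = 1 := rfl
      rw [hb]
      positivity
    · have h1 := hy k
      by_cases hkZ : k ∈ Z
      · have h2 : t ≤ ((π.orb k).1 - 1) / d k := hmin k hkZ
        rw [le_div_iff₀ (hd k hkZ)] at h2
        linarith
      · have h3 : d k ≤ 0 := sub_nonpos.2 (not_lt.1 hkZ)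
        have h4 := π.one_le_fst_orb k
        nlinarith
    · have h1 := hy g
      linarith
  exact absurd (h g hgn) (not_le.2 hg)

lemma inv_mem_nbrs {g : G} (hg : g ∈ π.nbrs) : g⁻¹ ∈ π.nbrs := by
  obtain ⟨h1, x, hx, hx1, hD, heq⟩ := hg
  refine ⟨inv_ne_one.2 h1, π.rep g⁻¹ x, π.rep_mem_cone _ _ hx, by rwa [π.form_rep],
    fun h => ?_, ?_⟩
  · rw [← π.orb_one, form_rep_orb, form_rep_orb, inv_inv, mul_one, ← heq]
    exact hD _
  · rw [← π.orb_one, form_rep_orb, form_rep_orb, inv_inv, mul_one, mul_inv_cancel, ← heq, orb_one]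

/-! ### Ideal points of the Dirichlet domain -/

/-- The ideal points of the Dirichlet domain, as null vectors of height one. -/
def idealPts : Set Mink := {ξ | ξ.1 = 1 ∧ ‖ξ.2‖ = 1 ∧ ∀ g, 1 ≤ form ξ (π.orb g)}

/-- The orbit points on the horosphere through the base point centred at `ξ`. -/
def horo (ξ : Mink) : Set G := {g | form ξ (π.orb g) = 1}

variable {π}

lemma idealPts.mem_cone {ξ : Mink} (hξ : ξ ∈ π.idealPts) : ξ ∈ cone :=
  (hξ.2.1.trans hξ.1.symm).le

lemma idealPts.form_self_eq {ξ : Mink} (hξ : ξ ∈ π.idealPts) : form ξ ξ = 0 := by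
  rw [Mink.form_self, hξ.1, hξ.2.1]; ring

lemma idealPts.one_mem_horo {ξ : Mink} (hξ : ξ ∈ π.idealPts) : (1 : G) ∈ π.horo ξ := by
  change form _ _ = _
  rw [orb_one, form_base, hξ.1]

lemma mul_mem_horo_iff {ξ : Mink} {h g : G} :
    g ∈ π.horo (π.rep h⁻¹ ξ) ↔ h * g ∈ π.horo ξ := by
  simp only [horo, Set.mem_ofPred_eq, form_rep_orb, inv_inv]

lemma idealPts.rep_inv_mem {ξ : Mink} (hξ : ξ ∈ π.idealPts) {h : G} (hh : h ∈ π.horo ξ) :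
    π.rep h⁻¹ ξ ∈ π.idealPts := by
  have h1 : (π.rep h⁻¹ ξ).1 = 1 := by
    rw [← form_base, ← π.orb_one, form_rep_orb, inv_inv, mul_one]
    exact hh
  refine ⟨h1, ?_, fun g => ?_⟩
  · have h2 : form (π.rep h⁻¹ ξ) (π.rep h⁻¹ ξ) = 0 := by
      rw [π.form_rep]; exact idealPts.form_self_eq hξ
    rw [form_self, h1] at h2
    nlinarith [norm_nonneg (π.rep h⁻¹ ξ).2]
  · rw [form_rep_orb]
    exact hξ.2.2 _

/-- If an orbit point on the horosphere is on the right side of all walls through the ideal point,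
then it is the base point. -/
lemma eq_one_of_mem_horo (hfin : π.nbrs.Finite) {η : Mink} (hη : η ∈ π.idealPts) {k : G}
    (hk : k ∈ π.horo η)
    (h : ∀ g ∈ π.nbrs ∩ π.horo η, (π.orb k).1 ≤ form (π.orb k) (π.orb g)) : k = 1 := by
  have hlarge : ∀ g ∈ π.nbrs, ∀ᶠ s : ℝ in Filter.atTop,
      form (π.orb k + s • η) base ≤ form (π.orb k + s • η) (π.orb g) := fun g hg => by
    simp only [form_add_left, form_smul_left, form_base, Prod.fst_add, Prod.smul_fst, smul_eq_mul,
      hη.1]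
    by_cases hgη : g ∈ π.horo η
    · rw [show form η (π.orb g) = 1 from hgη]
      filter_upwards with s
      linarith [h g ⟨hg, hgη⟩]
    · have h1 : 0 < form η (π.orb g) - 1 :=
        sub_pos.2 ((hη.2.2 g).lt_of_ne fun h => hgη h.symm)
      filter_upwards [Filter.eventually_ge_atTop
        (((π.orb k).1 - form (π.orb k) (π.orb g)) / (form η (π.orb g) - 1))] with s hs
      rw [div_le_iff₀ h1] at hs
      linarith
  obtain ⟨s, hs, hs0⟩ := (((Filter.eventually_all_finite hfin).2 hlarge).and
    (Filter.eventually_ge_atTop (0 : ℝ))).exists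
  have hηc := idealPts.mem_cone hη
  have hkη : form η (π.orb k) = 1 := hk
  have h2 := π.form_base_le_of_nbrs (add_mem_cone (π.orb_mem_cone k) (smul_mem_cone hs0 hηc))
    (by
      simp only [form_add_left, form_add_right, form_smul_left, form_smul_right,
        idealPts.form_self_eq hη, form_orb_self, form_comm (π.orb k) η, hkη]
      linarith) hs k
  simp only [form_add_left, form_smul_left, form_base, Prod.fst_add, Prod.smul_fst, smul_eq_mul,
    hη.1, form_orb_self, hkη] at h2
  by_contra hk1
  linarith [π.one_lt_fst_orb hk1]

/-- Only finitely many ideal points of the Dirichlet domain lie on two walls. -/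
lemma finite_corners (hfin : π.nbrs.Finite) :
    {η ∈ π.idealPts | ∃ g ∈ π.nbrs ∩ π.horo η, ∃ g' ∈ π.nbrs ∩ π.horo η, g ≠ g'}.Finite := by
  have hsub : {η ∈ π.idealPts | ∃ g ∈ π.nbrs ∩ π.horo η, ∃ g' ∈ π.nbrs ∩ π.horo η, g ≠ g'} ⊆
      ⋃ g ∈ π.nbrs, ⋃ g' ∈ π.nbrs, {η ∈ π.idealPts | g ≠ g' ∧ g ∈ π.horo η ∧ g' ∈ π.horo η} := by
    rintro η ⟨hη, g, hg, g', hg', hne⟩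
    simp only [Set.mem_iUnion]
    exact ⟨g, hg.1, g', hg'.1, hη, hne, hg.2, hg'.2⟩
  refine Set.Finite.subset (hfin.biUnion fun g hg => hfin.biUnion fun g' hg' => ?_) hsub
  by_contra hinf
  have hinf : Set.Infinite _ := hinf
  set f := hinf.natEmbedding
  have hmem : ∀ i, (f i).1 ∈ π.idealPts ∧ g ≠ g' ∧ g ∈ π.horo (f i).1 ∧ g' ∈ π.horo (f i).1 :=
    fun i => (f i).2
  have heta : ∀ i, ((1, (f i).1.2) : Mink) = (f i).1 := fun i => Prod.ext (hmem i).1.1.symm rfl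
  refine (hmem 0).2.1 (π.eq_of_orb_eq (eq_of_three_common_ideal_points (π.form_orb_self g)
    (π.form_orb_self g') (π.one_lt_fst_orb hg.1) (π.one_lt_fst_orb hg'.1)
    (e := fun i : Fin 3 => (f i).1.2) (fun i j hij => ?_) (fun i => (hmem i).1.2.1)
    (fun i => ?_) (fun i => ?_)))
  · have h1 : (f i).1 = (f j).1 := by
      rw [← heta i, ← heta j]; exact congrArg (Prod.mk 1) hij
    exact Fin.val_injective (f.injective (Subtype.ext h1))
  · rw [heta]; exact (hmem i).2.2.1
  · rw [heta]; exact (hmem i).2.2.2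

/-- The translates of an ideal point to the Dirichlet domain form a finite set. -/
lemma finite_rep_inv_horo (hfin : π.nbrs.Finite) {ξ : Mink} (hξ : ξ ∈ π.idealPts) :
    ((fun h => π.rep h⁻¹ ξ) '' π.horo ξ).Finite := by
  by_cases hF : (π.horo ξ).Finite
  · exact hF.image _
  set E' := {η ∈ π.idealPts | ∃ g ∈ π.nbrs ∩ π.horo η, ∃ g' ∈ π.nbrs ∩ π.horo η, g ≠ g'} with hE'
  have hE'fin : E'.Finite := finite_corners hfin
  refine (hE'fin.union (Set.Finite.image2 (fun g η => π.rep g η) hfin hE'fin)).subset ?_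
  rintro η ⟨h, hh, rfl⟩
  dsimp only
  set η := π.rep h⁻¹ ξ with hηdef
  have hη : η ∈ π.idealPts := idealPts.rep_inv_mem hξ hh
  by_contra hnot
  rw [Set.mem_union, not_or] at hnot
  obtain ⟨hn1, hn2⟩ := hnot
  have huniq : ∀ {η : Mink}, η ∈ π.idealPts → η ∉ E' → ∀ g ∈ π.nbrs ∩ π.horo η,
      ∀ g' ∈ π.nbrs ∩ π.horo η, g = g' := fun {η} hη hn g hg g' hg' => by
    by_contra hne
    exact hn ⟨hη, g, hg, g', hg', hne⟩
  have hinf : (π.horo η).Infinite := fun hfinη => hF <| by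
    refine (hfinη.image (h * ·)).subset fun k hk => ⟨h⁻¹ * k, ?_, mul_inv_cancel_left h k⟩
    rw [hηdef, mul_mem_horo_iff, mul_inv_cancel_left]
    exact hk
  rcases (π.nbrs ∩ π.horo η).eq_empty_or_nonempty with hA | ⟨g, hg⟩
  · refine hinf ((Set.finite_singleton 1).subset fun k hk => ?_)
    exact eq_one_of_mem_horo hfin hη hk (by simp [hA])
  · set η' := π.rep g⁻¹ η with hη'def
    have hη' : η' ∈ π.idealPts := idealPts.rep_inv_mem hη hg.2
    have hη'n : η' ∉ E' := fun hmem => hn2 ⟨g, hg.1, η', hmem, by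
      change π.rep g η' = η
      rw [hη'def]
      simp⟩
    have hginv : g⁻¹ ∈ π.nbrs ∩ π.horo η' := by
      refine ⟨π.inv_mem_nbrs hg.1, ?_⟩
      rw [hη'def, mul_mem_horo_iff, mul_inv_cancel]
      exact idealPts.one_mem_horo hη
    refine hinf ((Set.toFinite {1, g}).subset fun k hk => ?_)
    rcases le_total (π.orb k).1 (form (π.orb k) (π.orb g)) with hle | hle
    · left
      refine eq_one_of_mem_horo hfin hη hk fun g' hg' => ?_
      rwa [huniq hη hn1 g' hg' g hg]
    · right
      have hk' : g⁻¹ * k ∈ π.horo η' := by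
        rw [hη'def, mul_mem_horo_iff, mul_inv_cancel_left]; exact hk
      have h1 : g⁻¹ * k = 1 := by
        refine eq_one_of_mem_horo hfin hη' hk' fun g' hg' => ?_
        rw [huniq hη' hη'n g' hg' g⁻¹ hginv, ← form_base, ← π.orb_one, ← rep_orb, form_rep_orb,
          form_rep_orb, inv_inv, mul_one, mul_inv_cancel, orb_one, form_base]
        exact hle
      exact (inv_mul_eq_one.1 h1).symm

/-- Ideal points of the Dirichlet domain are bounded: the horosphere stabiliser moves every orbit
point a definite distance away. -/
lemma exists_bounded_ideal (hfin : π.nbrs.Finite) {ξ : Mink} (hξ : ξ ∈ π.idealPts) :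
    ∃ δ > 0, ∀ k : G, ∃ h ∈ π.horo ξ, δ * form (π.orb k) (π.orb h) ≤ form (π.orb k) ξ := by
  have hgap : ∀ η ∈ π.idealPts, ∃ δ : ℝ, 0 < δ ∧ ∀ k : G,
      (∀ g ∈ π.horo η, (π.orb k).1 ≤ form (π.orb k) (π.orb g)) →
      δ * (π.orb k).1 ≤ form (π.orb k) η := fun η hη => by
    have hg : ∀ g ∈ π.nbrs, ∃ δ : ℝ, 0 < δ ∧ (g ∉ π.horo η → ∀ k,
        form (π.orb k) (π.orb g) < (π.orb k).1 → δ * (π.orb k).1 ≤ form (π.orb k) η) :=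
      fun g hg => by
      by_cases hgη : g ∈ π.horo η
      · exact ⟨1, one_pos, fun h => absurd hgη h⟩
      set p := (π.orb g).2
      have hp : 0 < ‖p‖ ^ 2 := by
        have := π.form_orb_self g
        rw [form_self] at this
        have h2 := π.one_lt_fst_orb hg.1
        nlinarith
      set m := form η (π.orb g) - 1 with hm
      have hmpos : 0 < m := sub_pos.2 ((hη.2.2 g).lt_of_ne fun h => hgη h.symm)
      refine ⟨m ^ 2 / (2 * ‖p‖ ^ 2), by positivity, fun _ k hk => ?_⟩
      have hs : 0 < (π.orb k).1 := by linarith [π.one_le_fst_orb k]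
      have hη1 : (η.1 : ℝ) ≠ 0 := by rw [hη.1]; norm_num
      have hη2 : klein η = η.2 := by rw [klein, hη.1, inv_one, one_smul]
      set x := klein (π.orb k) with hx
      have hx1 : ‖x‖ ≤ 1 := norm_klein_le (π.orb_mem_cone k)
      rw [form_eq_klein hs.ne' hη1, hη.1, hη2, mul_one, ← hx, mul_comm]
      refine mul_le_mul_of_nonneg_left ?_ hs.le
      have h1 := norm_sub_sq_le hx1 hη.2.1.le
      have h2 : m < inner ℝ (x - η.2) p := by
        have h3 : form (π.orb k) (π.orb g) = (π.orb k).1 * ((π.orb g).1 - inner ℝ x p) := by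
          simp only [form, hx, klein, real_inner_smul_left, p]
          field_simp
        rw [h3] at hk
        have h4 : (π.orb g).1 - inner ℝ x p < 1 := by
          by_contra! h5
          nlinarith
        rw [inner_sub_left]
        have h5 : form η (π.orb g) = (π.orb g).1 - inner ℝ η.2 p := by
          rw [form, hη.1, one_mul]
        linarith
      have h3 : m ≤ ‖x - η.2‖ * ‖p‖ := h2.le.trans (real_inner_le_norm _ _)
      have h4 : m ^ 2 ≤ ‖x - η.2‖ ^ 2 * ‖p‖ ^ 2 := by
        rw [← mul_pow]; exact pow_le_pow_left₀ hmpos.le h3 2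
      rw [div_le_iff₀ (by positivity)]
      nlinarith
    obtain ⟨δ, hδ, hδg⟩ := exists_pos_forall_of_finite hfin hg
      fun g δ δ' _ hle hP hgη k hk =>
        (mul_le_mul_of_nonneg_right hle (fst_nonneg (π.orb_mem_cone k))).trans (hP hgη k hk)
    refine ⟨min δ 1, lt_min hδ one_pos, fun k hk => ?_⟩
    rcases eq_or_ne k 1 with rfl | hk1
    · rw [orb_one, base_form, hη.1]
      exact (mul_one _).trans_le (min_le_right _ _)
    · have hex : ∃ g ∈ π.nbrs, form (π.orb k) (π.orb g) < (π.orb k).1 := by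
        by_contra! hno
        have := π.form_base_le_of_nbrs (π.orb_mem_cone k)
          (by rw [form_orb_self]; exact one_pos) (by simpa only [form_base] using hno) k
        rw [form_base, form_orb_self] at this
        exact absurd (π.one_lt_fst_orb hk1) (not_lt.2 this)
      obtain ⟨g, hgn, hgk⟩ := hex
      exact (mul_le_mul_of_nonneg_right (min_le_left _ _) (fst_nonneg (π.orb_mem_cone k))).trans
        (hδg g hgn (fun hgη => absurd hgk (not_lt.2 (hk g hgη))) k hgk)
  obtain ⟨δ, hδ, hδη⟩ := exists_pos_forall_of_finite (finite_rep_inv_horo hfin hξ)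
    (P := fun η δ => ∀ k : G,
      (∀ g ∈ π.horo η, (π.orb k).1 ≤ form (π.orb k) (π.orb g)) →
      δ * (π.orb k).1 ≤ form (π.orb k) η)
    (by
      rintro η ⟨h, hh, rfl⟩
      exact hgap _ (idealPts.rep_inv_mem hξ hh))
    (fun η δ δ' _ hle hP k hk =>
        (mul_le_mul_of_nonneg_right hle (fst_nonneg (π.orb_mem_cone k))).trans (hP k hk))
  refine ⟨δ, hδ, fun k => ?_⟩
  obtain ⟨h, hh, hmin⟩ := π.exists_form_min (π.norm_snd_orb_lt k) (idealPts.one_mem_horo hξ)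
  have key : ∀ g, form (π.orb (h⁻¹ * k)) (π.orb g) = form (π.orb k) (π.orb (h * g)) := fun g => by
    rw [← rep_orb, form_rep_orb, inv_inv]
  have h1 : (π.orb (h⁻¹ * k)).1 = form (π.orb k) (π.orb h) := by
    rw [← form_base, ← π.orb_one, key, mul_one]
  refine ⟨h, hh, ?_⟩
  have h2 := hδη _ ⟨h, hh, rfl⟩ (h⁻¹ * k) fun g hg => by
    rw [h1, key]
    exact hmin _ (mul_mem_horo_iff.1 hg)
  rwa [h1, ← rep_orb, π.form_rep] at h2

end LorentzAction

namespace LorentzAction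

open Mink Filter

variable {G : Type*} [Group G] (π : LorentzAction G)

/-! ### The limit cone and expansivity -/

/-- The closed cone spanned by the orbit of the base point (without its interior convex hull). -/
def limCone : Set Mink := closure {x | ∃ r : ℝ, 0 < r ∧ ∃ k, x = r • π.orb k}

lemma limCone_subset_cone : π.limCone ⊆ cone :=
  closure_minimal (fun _ ⟨_, hr, k, hx⟩ => hx ▸ smul_mem_cone hr.le (π.orb_mem_cone k))
    isClosed_cone

lemma orb_mem_limCone (g : G) : π.orb g ∈ π.limCone :=
  subset_closure ⟨1, one_pos, g, (one_smul _ _).symm⟩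

lemma rep_mem_limCone (g : G) {x : Mink} (hx : x ∈ π.limCone) : π.rep g x ∈ π.limCone :=
  map_mem_closure (π.continuous_rep g) hx fun x ⟨r, hr, k, hx⟩ =>
    ⟨r, hr, g * k, by rw [hx, LinearMap.map_smul, rep_orb]⟩

lemma smul_mem_limCone {r : ℝ} (hr : 0 < r) {x : Mink} (hx : x ∈ π.limCone) :
    r • x ∈ π.limCone :=
  map_mem_closure (continuous_const_smul r) hx fun x ⟨s, hs, k, hx⟩ =>
    ⟨r * s, mul_pos hr hs, k, by rw [hx, smul_smul]⟩

lemma _root_.Mink.continuous_form_left (y : Mink) : Continuous fun x => form x y :=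
  continuous_form.comp (continuous_id.prodMk continuous_const)

variable {π}

/-- A bound valid for the orbit holds on the whole limit cone. -/
lemma exists_horo_of_mem_limCone {ξ : Mink} (hξ : ξ ∈ π.idealPts) {δ : ℝ} (hδ : 0 < δ)
    (h : ∀ k : G, ∃ h ∈ π.horo ξ, δ * form (π.orb k) (π.orb h) ≤ form (π.orb k) ξ)
    {α : Mink} (hα : α ∈ π.limCone) (hαξ : 0 < form α ξ) :
    ∃ h ∈ π.horo ξ, δ * form α (π.orb h) ≤ form α ξ := by
  have hξc := idealPts.mem_cone hξ
  have hαc := π.limCone_subset_cone hα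
  have htime : ‖(α + ξ).2‖ < (α + ξ).1 := norm_lt_fst (add_mem_cone hαc hξc) (by
    simp only [form_add_left, form_add_right, idealPts.form_self_eq hξ, form_comm ξ α]
    linarith [form_nonneg hαc hαc])
  set c := ((α + ξ).1 - ‖(α + ξ).2‖) / 2 with hc
  have hcpos : 0 < c := by rw [hc]; linarith
  set C := form α ξ + 1
  set T := {g ∈ π.horo ξ | (π.orb g).1 ≤ (C / δ + 1) / c} with hT
  have hTfin : T.Finite := (π.proper ((C / δ + 1) / c)).subset fun g hg => hg.2
  have hclosed : IsClosed (⋃ g ∈ T, {x | δ * form x (π.orb g) ≤ form x ξ}) :=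
    hTfin.isClosed_biUnion fun g _ => isClosed_le
      (continuous_const.mul (continuous_form_left _)) (continuous_form_left _)
  have hev1 : ∀ᶠ x in 𝓝 α, form x ξ < C :=
    (continuous_form_left ξ).continuousAt.eventually_lt continuousAt_const (lt_add_one _)
  have hev2 : ∀ᶠ x : Mink in 𝓝 α, c < (x + ξ).1 - ‖(x + ξ).2‖ := by
    refine continuousAt_const.eventually_lt (Continuous.continuousAt (by fun_prop)) ?_
    rw [hc]; linarith
  have hfreq : ∃ᶠ x in 𝓝 α, x ∈ ⋃ g ∈ T, {x | δ * form x (π.orb g) ≤ form x ξ} := by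
    refine ((mem_closure_iff_frequently.1 hα).and_eventually (hev1.and hev2)).mono ?_
    rintro x ⟨⟨r, hr, k, rfl⟩, hx1, hx2⟩
    obtain ⟨g, hg, hgk⟩ := h k
    have hle : δ * form (r • π.orb k) (π.orb g) ≤ form (r • π.orb k) ξ := by
      rw [form_smul_left, form_smul_left]
      nlinarith
    simp only [Set.mem_iUnion]
    refine ⟨g, ⟨hg, ?_⟩, hle⟩
    have h1 := mul_fst_le_form (x := r • π.orb k + ξ) (π.orb_mem_cone g)
    rw [form_add_left, show form ξ (π.orb g) = 1 from hg] at h1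
    have h2 : form (r • π.orb k) (π.orb g) ≤ C / δ := by
      rw [le_div_iff₀ hδ]; linarith
    rw [le_div_iff₀ hcpos]
    nlinarith [π.one_le_fst_orb g]
  have hmem := hclosed.mem_of_frequently_of_tendsto hfreq tendsto_id
  simp only [Set.mem_iUnion] at hmem
  obtain ⟨g, hg, hgα⟩ := hmem
  exact ⟨g, hg.1, hgα⟩

lemma exists_normalized_pair {α β : Mink} (hα : α ∈ π.limCone) (hβ : β ∈ π.limCone)
    (hαβ : 0 < form α β) {ε : ℝ}
    (h : ∀ g, form α β ≤ ε * (form α (π.orb g) * form β (π.orb g))) :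
    ∃ α' ∈ π.limCone, ∃ β' ∈ π.limCone, ∃ t ∈ Set.Icc (0 : ℝ) 1, α'.1 = 1 ∧ β'.1 = 1 ∧
      0 < form α' β' ∧ (∀ g, form α' β' ≤ ε * (form α' (π.orb g) * form β' (π.orb g))) ∧
      ∀ g, 1 ≤ form (t • α' + (1 - t) • β') (π.orb g) := by
  have hαc := π.limCone_subset_cone hα
  have hβc := π.limCone_subset_cone hβ
  obtain ⟨h0, -, hmin⟩ := π.exists_form_min (x := α + β) (norm_lt_fst (add_mem_cone hαc hβc) (by
    simp only [form_add_left, form_add_right, form_comm β α]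
    linarith [form_nonneg hαc hαc, form_nonneg hβc hβc])) (Set.mem_univ (1 : G))
  have hα0 : α ≠ 0 := by rintro rfl; simp [form] at hαβ
  have hβ0 : β ≠ 0 := by rintro rfl; simp [form] at hαβ
  set a := form α (π.orb h0) with ha
  set b := form β (π.orb h0) with hb
  have hapos : 0 < a := π.form_orb_pos hαc hα0 h0
  have hbpos : 0 < b := π.form_orb_pos hβc hβ0 h0
  have key : ∀ (x : Mink), (π.rep h0⁻¹ x).1 = form x (π.orb h0) := fun x => by
    rw [← form_base, ← π.orb_one, form_rep_orb, inv_inv, mul_one]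
  refine ⟨a⁻¹ • π.rep h0⁻¹ α, π.smul_mem_limCone (inv_pos.2 hapos) (π.rep_mem_limCone _ hα),
    b⁻¹ • π.rep h0⁻¹ β, π.smul_mem_limCone (inv_pos.2 hbpos) (π.rep_mem_limCone _ hβ),
    a / (a + b), ⟨by positivity, div_le_one_of_le₀ (by linarith) (by positivity)⟩, ?_, ?_, ?_,
    fun g => ?_, fun g => ?_⟩
  · rw [Prod.smul_fst, key, smul_eq_mul, inv_mul_cancel₀ hapos.ne']
  · rw [Prod.smul_fst, key, smul_eq_mul, inv_mul_cancel₀ hbpos.ne']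
  · rw [form_smul_left, form_smul_right, π.form_rep]
    positivity
  · simp only [form_smul_left, form_smul_right, π.form_rep, form_rep_orb, inv_inv]
    have h1 := mul_le_mul_of_nonneg_left (h (h0 * g)) (by positivity : 0 ≤ a⁻¹ * b⁻¹)
    linarith
  · have h1 := hmin (h0 * g) (Set.mem_univ _)
    simp only [form_add_left, ← ha, ← hb] at h1
    simp only [form_add_left, form_smul_left, form_rep_orb, inv_inv]
    have h2 : a / (a + b) * (a⁻¹ * form α (π.orb (h0 * g))) +
        (1 - a / (a + b)) * (b⁻¹ * form β (π.orb (h0 * g))) =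
        (form α (π.orb (h0 * g)) + form β (π.orb (h0 * g))) / (a + b) := by
      field_simp
      ring
    rw [h2, le_div_iff₀ (by positivity)]
    linarith

lemma _root_.Mink.isCompact_height_one : IsCompact {x : Mink | x ∈ cone ∧ x.1 = 1} := by
  refine ((isCompact_singleton (x := (1 : ℝ))).prod
    (isCompact_closedBall (0 : EuclideanSpace ℝ (Fin 3)) 1)).of_isClosed_subset
    (isClosed_cone.inter (isClosed_eq continuous_fst continuous_const)) ?_
  rintro x ⟨h1, h2⟩
  refine ⟨h2, mem_closedBall_zero_iff.2 ?_⟩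
  rw [← h2]
  exact h1

lemma _root_.Mink.eq_of_form_eq_zero {x y : Mink} (hx : x ∈ cone) (hy : y ∈ cone)
    (hx1 : x.1 = 1) (hy1 : y.1 = 1) (h : form x y = 0) : x = y := by
  have h1 := klein_eq_of_form_eq_zero hx hy (by rintro rfl; norm_num at hx1)
    (by rintro rfl; norm_num at hy1) h
  refine Prod.ext (hx1.trans hy1.symm) ?_
  simpa [klein, hx1, hy1] using h1

/-- The action on the limit cone is expansive. -/
theorem exists_expansive (hfin : π.nbrs.Finite) :
    ∃ ε : ℝ, 0 < ε ∧ ∀ α ∈ π.limCone, ∀ β ∈ π.limCone, 0 < form α β →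
      ∃ g, ε * (form α (π.orb g) * form β (π.orb g)) < form α β := by
  by_contra! hcon
  have hn : ∀ n : ℕ, ∃ v : Mink × Mink × ℝ, v.1 ∈ π.limCone ∧ v.2.1 ∈ π.limCone ∧
      v.2.2 ∈ Set.Icc (0 : ℝ) 1 ∧ v.1.1 = 1 ∧ v.2.1.1 = 1 ∧ 0 < form v.1 v.2.1 ∧
      (∀ g, form v.1 v.2.1 ≤ (1 / ((n : ℝ) + 1)) * (form v.1 (π.orb g) * form v.2.1 (π.orb g))) ∧
      ∀ g, 1 ≤ form (v.2.2 • v.1 + (1 - v.2.2) • v.2.1) (π.orb g) := fun n => by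
    obtain ⟨α, hα, β, hβ, hαβ, hg⟩ := hcon (1 / ((n : ℝ) + 1)) (by positivity)
    obtain ⟨α', h1, β', h2, t, h3, h4⟩ := exists_normalized_pair hα hβ hαβ hg
    exact ⟨(α', β', t), h1, h2, h3, h4⟩
  choose v hα hβ ht hα1 hβ1 hpos hsmall hD using hn
  obtain ⟨⟨ξ, ξ', t⟩, ⟨⟨hξc, hξ1⟩, ⟨hξ'c, hξ'1⟩, -⟩, φ, hφ, hlim⟩ :=
    (isCompact_height_one.prod (isCompact_height_one.prod
      (isCompact_Icc (a := (0 : ℝ)) (b := 1)))).tendsto_subseq (x := v)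
      fun n => ⟨⟨π.limCone_subset_cone (hα n), hα1 n⟩,
        ⟨π.limCone_subset_cone (hβ n), hβ1 n⟩, ht n⟩
  have hl1 : Tendsto (fun n => (v (φ n)).1) atTop (𝓝 ξ) := (continuous_fst.tendsto _).comp hlim
  have hl2 : Tendsto (fun n => (v (φ n)).2.1) atTop (𝓝 ξ') :=
    (continuous_snd.fst.tendsto _).comp hlim
  have hl3 : Tendsto (fun n => (v (φ n)).2.2) atTop (𝓝 t) :=
    (continuous_snd.snd.tendsto _).comp hlim
  have hinv : Tendsto (fun n => 1 / ((φ n : ℝ) + 1)) atTop (𝓝 0) :=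
    tendsto_one_div_add_atTop_nhds_zero_nat.comp hφ.tendsto_atTop
  have hzero : form ξ ξ' = 0 := by
    refine le_antisymm ?_ (form_nonneg hξc hξ'c)
    have h1 : Tendsto (fun n => form (v (φ n)).1 (v (φ n)).2.1) atTop (𝓝 (form ξ ξ')) :=
      (continuous_form.tendsto (ξ, ξ')).comp (hl1.prodMk_nhds hl2)
    refine le_of_tendsto_of_tendsto' h1 hinv fun n => ?_
    have := hsmall (φ n) 1
    rwa [orb_one, form_base, form_base, hα1, hβ1, mul_one, mul_one] at this
  obtain rfl : ξ = ξ' := eq_of_form_eq_zero hξc hξ'c hξ1 hξ'1 hzero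
  set y : ℕ → Mink := fun n => (v (φ n)).2.2 • (v (φ n)).1 + (1 - (v (φ n)).2.2) • (v (φ n)).2.1
    with hy
  have hly : Tendsto y atTop (𝓝 ξ) := by
    have := (hl3.smul hl1).add ((tendsto_const_nhds (x := (1 : ℝ)).sub hl3).smul hl2)
    rwa [← add_smul, add_sub_cancel, one_smul] at this
  have hξ : ξ ∈ π.idealPts := by
    refine ⟨hξ1, ?_, fun g => ?_⟩
    · rw [form_self, hξ1] at hzero
      nlinarith [norm_nonneg ξ.2]
    · exact ge_of_tendsto' (((continuous_form_left (π.orb g)).tendsto ξ).comp hly)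
        fun n => hD (φ n) g
  obtain ⟨δ, hδ, hδk⟩ := exists_bounded_ideal hfin hξ
  have hly0 : Tendsto (fun n => form (y n) ξ) atTop (𝓝 0) := by
    have := ((continuous_form_left ξ).tendsto ξ).comp hly
    rwa [hzero] at this
  obtain ⟨n, hn1, hn2⟩ := ((hly0.eventually_lt_const (by positivity : 0 < δ / 6)).and
    (hinv.eventually_lt_const (by positivity : 0 < δ / 6))).exists
  set α := (v (φ n)).1 with hαd
  set β := (v (φ n)).2.1 with hβd
  set s := (v (φ n)).2.2 with hsd
  have hαc : α ∈ cone := π.limCone_subset_cone (hα _)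
  have hβc : β ∈ cone := π.limCone_subset_cone (hβ _)
  have main : ∀ α β : Mink, α ∈ π.limCone → β ∈ cone → α.1 = 1 → β.1 = 1 → 0 < form α ξ →
      (∀ g, form α β ≤ (1 / ((φ n : ℝ) + 1)) * (form α (π.orb g) * form β (π.orb g))) →
      ∃ g, δ / 6 * form α (π.orb g) ≤ form α ξ ∧ δ / 6 * form β (π.orb g) ≤ form β ξ := by
    intro α β hα hβc hα1 hβ1 hαξ hsm
    have hαc := π.limCone_subset_cone hα
    obtain ⟨g, hg, hgα⟩ := exists_horo_of_mem_limCone hξ hδ hδk hα hαξ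
    have hα0 : α ≠ 0 := by rintro rfl; norm_num at hα1
    have hβ0 : β ≠ 0 := by rintro rfl; norm_num at hβ1
    have hpα := π.form_orb_pos hαc hα0 g
    have hpβ := π.form_orb_pos hβc hβ0 g
    refine ⟨g, by nlinarith, ?_⟩
    have h1 := π.form_triangle_orb hαc hβc hξc g
    rw [show form ξ (π.orb g) = 1 from hg, mul_one] at h1
    have h2 := hsm g
    have h3 : form α β ≤ δ / 6 * (form α (π.orb g) * form β (π.orb g)) :=
      h2.trans (mul_le_mul_of_nonneg_right hn2.le (by positivity))
    have h4 := mul_le_mul_of_nonneg_right hgα hpβ.le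
    have h5 : form α (π.orb g) * (δ / 6 * form β (π.orb g)) ≤ form α (π.orb g) * form β ξ := by
      linarith
    exact le_of_mul_le_mul_left h5 hpα
  have hex : ∃ g, δ / 6 * form α (π.orb g) ≤ form α ξ ∧ δ / 6 * form β (π.orb g) ≤ form β ξ := by
    rcases (form_nonneg hαc hξc).lt_or_eq with h0 | h0
    · exact main α β (hα _) hβc (hα1 _) (hβ1 _) h0 (hsmall _)
    · have h1 : 0 < form β ξ := by
        have := form_triangle hαc hξc hβc
        rw [← h0, hξ1, hα1, hβ1, form_comm ξ β] at this
        have h2 : 0 < form α β := hpos (φ n)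
        linarith
      obtain ⟨g, h2, h3⟩ := main β α (hβ _) hαc (hβ1 _) (hα1 _) h1 fun g => by
        rw [form_comm β α, mul_comm (form β _)]; exact hsmall (φ n) g
      exact ⟨g, h3, h2⟩
  obtain ⟨g, h1, h2⟩ := hex
  have h3 : 1 ≤ form (y n) (π.orb g) := hD (φ n) g
  have hs : s ∈ Set.Icc (0 : ℝ) 1 := ht (φ n)
  simp only [hy, ← hαd, ← hβd, ← hsd, form_add_left, form_smul_left] at hn1 h3
  have h4 := mul_le_mul_of_nonneg_left h1 hs.1
  have h5 := mul_le_mul_of_nonneg_left h2 (sub_nonneg.2 hs.2)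
  nlinarith

/-- Uniform version of expansivity for pairs of orbit points that are far apart. -/
lemma exists_finite_expansive {ε₀ : ℝ}
    (hexp : ∀ α ∈ π.limCone, ∀ β ∈ π.limCone, 0 < form α β →
      ∃ g, ε₀ * (form α (π.orb g) * form β (π.orb g)) < form α β) {ε : ℝ} (hε : 0 < ε) :
    ∃ K : Set G, K.Finite ∧ ∀ a b, ε * ((π.orb a).1 * (π.orb b).1) ≤ form (π.orb a) (π.orb b) →
      ∃ g ∈ K, ε₀ * (form (π.orb a) (π.orb g) * form (π.orb b) (π.orb g)) <
        form (π.orb a) (π.orb b) := by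
  set Q : Set (Mink × Mink) := {v | (v.1 ∈ cone ∧ v.1.1 = 1) ∧ (v.2 ∈ cone ∧ v.2.1 = 1)} ∩
    ({v | v.1 ∈ π.limCone ∧ v.2 ∈ π.limCone} ∩ {v | ε ≤ form v.1 v.2}) with hQ
  have hQc : IsCompact Q := (isCompact_height_one.prod isCompact_height_one).inter_right
    (((isClosed_closure.preimage continuous_fst).inter
      (isClosed_closure.preimage continuous_snd)).inter
      (isClosed_le continuous_const continuous_form))
  set U : G → Set (Mink × Mink) := fun g =>
    {v | ε₀ * (form v.1 (π.orb g) * form v.2 (π.orb g)) < form v.1 v.2}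
  have hU : ∀ g, IsOpen (U g) := fun g => isOpen_lt
    (continuous_const.mul (((continuous_form_left _).comp continuous_fst).mul
      ((continuous_form_left _).comp continuous_snd))) continuous_form
  obtain ⟨t, ht⟩ := hQc.elim_finite_subcover U hU fun v hv =>
    Set.mem_iUnion.2 (hexp v.1 hv.2.1.1 v.2 hv.2.1.2 (hε.trans_le hv.2.2))
  refine ⟨t, t.finite_toSet, fun a b hab => ?_⟩
  set r := (π.orb a).1
  set s := (π.orb b).1
  have hr : 0 < r := one_pos.trans_le (π.one_le_fst_orb a)
  have hs : 0 < s := one_pos.trans_le (π.one_le_fst_orb b)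
  have hmem : ((r⁻¹ • π.orb a, s⁻¹ • π.orb b) : Mink × Mink) ∈ Q := by
    have h1 := π.smul_mem_limCone (inv_pos.2 hr) (π.orb_mem_limCone a)
    have h2 := π.smul_mem_limCone (inv_pos.2 hs) (π.orb_mem_limCone b)
    refine ⟨⟨⟨π.limCone_subset_cone h1, inv_mul_cancel₀ hr.ne'⟩,
      ⟨π.limCone_subset_cone h2, inv_mul_cancel₀ hs.ne'⟩⟩, ⟨h1, h2⟩, ?_⟩
    change ε ≤ form (r⁻¹ • π.orb a) (s⁻¹ • π.orb b)
    rw [form_smul_left, form_smul_right, ← mul_assoc, ← mul_inv, inv_mul_eq_div,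
      le_div_iff₀ (by positivity)]
    exact hab
  have h1 := ht hmem
  simp only [Set.mem_iUnion] at h1
  obtain ⟨g, hg, h2⟩ := h1
  refine ⟨g, hg, ?_⟩
  change ε₀ * (form (r⁻¹ • π.orb a) (π.orb g) * form (s⁻¹ • π.orb b) (π.orb g)) <
    form (r⁻¹ • π.orb a) (s⁻¹ • π.orb b) at h2
  simp only [form_smul_left, form_smul_right] at h2
  have h3 := mul_lt_mul_of_pos_left h2 (mul_pos hr hs)
  field_simp at h3
  linarith

end LorentzAction

open scoped NNReal in
/-- A metrization argument: a chain whose links are close in a geometric sense has close endpoints,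
for a sequence of relations with `U (n + 1) ∘ U (n + 1) ∘ U (n + 1) ⊆ U n`. -/
lemma rel_of_sum_lt {X : Type*} {U : ℕ → X → X → Prop} (hrefl : ∀ n x, U n x x)
    (hsymm : ∀ n x y, U n x y → U n y x)
    (hcomp : ∀ n x y z w, U (n + 1) x y → U (n + 1) y z → U (n + 1) z w → U n x w)
    {m : ℕ} {w : ℕ → X} {e : ℕ → ℕ} (hw : ∀ i < m, U (e i) (w i) (w (i + 1))) {n : ℕ}
    (hsum : ∑ i ∈ Finset.range m, (1 / 2 : ℝ) ^ e i < (1 / 2) ^ (n + 1)) : U n (w 0) (w m) := by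
  classical
  have hanti : ∀ x y, Antitone fun n => U n x y := fun x y =>
    antitone_nat_of_succ_le fun n h => hcomp n x x x y (hrefl _ _) (hrefl _ _) h
  let d : X → X → ℝ≥0 := fun x y => if h : ∃ n, ¬ U n x y then (1 / 2) ^ Nat.find h else 0
  have hd0 : ∀ x, d x x = 0 := fun x => dif_neg (by simp [hrefl])
  have hdsymm : ∀ x y, d x y = d y x := fun x y => by
    have : ∀ n, U n x y ↔ U n y x := fun n => ⟨hsymm n x y, hsymm n y x⟩
    simp only [d, this]
  have hr : (1 / 2 : ℝ≥0) ∈ Set.Ioo (0 : ℝ≥0) 1 := ⟨by norm_num, NNReal.half_lt_self one_ne_zero⟩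
  have hle : ∀ x y n, (1 / 2) ^ n ≤ d x y ↔ ¬ U n x y := fun x y n => by
    dsimp only [d]
    split_ifs with h
    · rw [(pow_right_strictAnti₀ hr.1 hr.2).le_iff_ge, Nat.find_le_iff]
      exact ⟨fun ⟨m, hmn, hm⟩ hn => hm (hanti x y hmn hn), fun h => ⟨n, le_rfl, h⟩⟩
    · push Not at h
      simp only [h, not_true_eq_false, iff_false, not_le]
      exact pow_pos hr.1 _
  have hd : ∀ x y z w, d x w ≤ 2 * max (d x y) (max (d y z) (d z w)) := fun x y z w => by
    by_cases h : ∃ n, ¬ U n x w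
    · have hdw : d x w = (1 / 2) ^ Nat.find h := dif_pos h
      have h1 : (1 / 2 : ℝ≥0) ^ (Nat.find h + 1) ≤ max (d x y) (max (d y z) (d z w)) := by
        simp only [le_max_iff, hle]
        by_contra! hcon
        exact Nat.find_spec h (hcomp _ _ _ _ _ hcon.1 hcon.2.1 hcon.2.2)
      calc d x w = 2 * (1 / 2) ^ (Nat.find h + 1) := by
            rw [hdw, pow_succ, mul_comm, mul_assoc]
            norm_num
        _ ≤ _ := by gcongr
    · rw [show d x w = 0 from dif_neg h]
      exact zero_le
  let I := PseudoMetricSpace.ofPreNNDist d hd0 hdsymm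
  by_contra hcon
  have h1 : ((1 / 2 : ℝ)) ^ n ≤ d (w 0) (w m) := by
    have := NNReal.coe_le_coe.2 ((hle _ _ n).2 hcon)
    simpa using this
  have h2 : (d (w 0) (w m) : ℝ) ≤ 2 * dist (w 0) (w m) :=
    PseudoMetricSpace.le_two_mul_dist_ofPreNNDist d hd0 hdsymm hd _ _
  have h3 : dist (w 0) (w m) ≤ ∑ i ∈ Finset.range m, (1 / 2 : ℝ) ^ e i := by
    refine dist_le_range_sum_of_dist_le m fun {k} hk => ?_
    have h4 : dist (w k) (w (k + 1)) ≤ d (w k) (w (k + 1)) :=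
      PseudoMetricSpace.dist_ofPreNNDist_le d hd0 hdsymm _ _
    have h5 : d (w k) (w (k + 1)) < (1 / 2) ^ e k := by
      by_contra! h6
      exact (hle _ _ _).1 h6 (hw k hk)
    have h7 := NNReal.coe_lt_coe.2 h5
    refine h4.trans (h7.le.trans_eq ?_)
    simp
  rw [pow_succ] at hsum
  linarith

lemma sum_pow_injOn_le {φ : ℝ} (h0 : 0 ≤ φ) (h1 : φ < 1) {s : Finset ℕ} {f : ℕ → ℕ}
    (hf : Set.InjOn f s) : ∑ i ∈ s, φ ^ f i ≤ (1 - φ)⁻¹ := by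
  rw [← Finset.sum_image (f := fun j => φ ^ j) hf, ← tsum_geometric_of_lt_one h0 h1]
  exact (summable_geometric_of_lt_one h0 h1).sum_le_tsum _ fun i _ => pow_nonneg h0 i

lemma sum_pow_dist_le {φ : ℝ} (h0 : 0 ≤ φ) (h1 : φ < 1) (m j : ℕ) :
    ∑ i ∈ Finset.range m, φ ^ Nat.dist i j ≤ 2 * (1 - φ)⁻¹ := by
  rw [← Finset.sum_filter_add_sum_filter_not (Finset.range m) (· < j), two_mul]
  refine add_le_add (sum_pow_injOn_le h0 h1 fun a ha b hb hab => ?_)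
    (sum_pow_injOn_le h0 h1 fun a ha b hb hab => ?_)
  all_goals
    simp only [Finset.coe_filter, Set.mem_ofPred_eq, Nat.dist] at ha hb hab
    omega

namespace LorentzAction

open Mink Filter

variable {G : Type*} [Group G] {π : LorentzAction G}

variable (π) in
/-- The inner product of orbit points, set to zero on the diagonal. -/
def offDiag [DecidableEq G] (a b : G) : ℝ := if a = b then 0 else form (π.orb a) (π.orb b)

section
variable [DecidableEq G]

lemma offDiag_comm (a b : G) : π.offDiag a b = π.offDiag b a := by
  simp only [offDiag, eq_comm, form_comm (π.orb a)]

lemma offDiag_nonneg (a b : G) : 0 ≤ π.offDiag a b := by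
  unfold offDiag
  split_ifs
  · exact le_rfl
  · linarith [π.one_le_form_orb a b]

lemma offDiag_le (a b : G) : π.offDiag a b ≤ form (π.orb a) (π.orb b) := by
  unfold offDiag
  split_ifs
  · linarith [π.one_le_form_orb a b]
  · exact le_rfl

lemma offDiag_triangle (a b c g : G) :
    π.offDiag a c * form (π.orb b) (π.orb g) ≤
      3 * (π.offDiag a b * form (π.orb c) (π.orb g) +
        π.offDiag b c * form (π.orb a) (π.orb g)) := by
  have hp : ∀ x : G, 0 ≤ form (π.orb x) (π.orb g) := fun x => by linarith [π.one_le_form_orb x g]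
  have h1 := mul_nonneg (π.offDiag_nonneg a b) (hp c)
  have h2 := mul_nonneg (π.offDiag_nonneg b c) (hp a)
  rcases eq_or_ne a c with rfl | hac
  · rw [show π.offDiag a a = 0 from if_pos rfl, zero_mul]
    linarith
  rcases eq_or_ne a b with rfl | hab
  · linarith
  rcases eq_or_ne b c with rfl | hbc
  · linarith
  simp only [offDiag, if_neg hac, if_neg hab, if_neg hbc]
  exact π.form_triangle_orb (π.orb_mem_cone a) (π.orb_mem_cone b) (π.orb_mem_cone c) g

end

/-- Word geodesics far away from the identity have endpoints that are visually close. -/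
theorem exists_form_lt_of_far_geodesic (hfin : π.nbrs.Finite) {S : Set G} (hS : S.Finite)
    {len : G → ℕ} (hmul : ∀ g h, len (g * h) ≤ len g + len h)
    (hinv : ∀ g, len g⁻¹ = len g) {ε : ℝ} (hε : 0 < ε) :
    ∃ R : ℕ, ∀ (m : ℕ) (w : ℕ → G), (∀ i < m, (w i)⁻¹ * w (i + 1) ∈ S) →
      (∀ i ≤ m, ∀ j ≤ m, i ≤ j → j - i ≤ len ((w i)⁻¹ * w j)) → (∀ i ≤ m, R ≤ len (w i)) →
      form (π.orb (w 0)) (π.orb (w m)) < ε * ((π.orb (w 0)).1 * (π.orb (w m)).1) := by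
  classical
  obtain ⟨ε₀, hε₀, hexp⟩ := exists_expansive hfin
  have hball : ∀ K : Set G, K.Finite → ∃ r, 0 < r ∧ ∀ g ∈ K, len g ≤ r := fun K hK => by
    obtain ⟨r, hr⟩ := (hK.image len).bddAbove
    exact ⟨r + 1, r.succ_pos, fun g hg => (hr ⟨g, hg, rfl⟩).trans r.le_succ⟩
  have hpos : ∀ a b : G, 0 < form (π.orb a) (π.orb b) := fun a b => by
    linarith [π.one_le_form_orb a b]
  have htrans : ∀ g a b : G,
      form (π.orb (g⁻¹ * a)) (π.orb b) = form (π.orb a) (π.orb (g * b)) := fun g a b => by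
    rw [← rep_orb, form_rep_orb, inv_inv]
  have hfst : ∀ g a : G, (π.orb (g⁻¹ * a)).1 = form (π.orb a) (π.orb g) := fun g a => by
    rw [← form_base, ← π.orb_one, htrans, mul_one]
  obtain ⟨K, hK, hKexp⟩ := exists_finite_expansive hexp (by positivity : 0 < ε₀ / 21)
  obtain ⟨k, hk0, hk⟩ := hball K hK
  set U : ℕ → G → G → Prop := fun n a b => ∀ g, len g ≤ n * k →
    π.offDiag a b ≤ ε₀ * (form (π.orb a) (π.orb g) * form (π.orb b) (π.orb g)) with hU
  have hUrefl : ∀ n a, U n a a := fun n a g _ => by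
    rw [show π.offDiag a a = 0 from if_pos rfl]
    have := hpos a g
    positivity
  have hUsymm : ∀ n a b, U n a b → U n b a := fun n a b h g hg => by
    rw [offDiag_comm, mul_comm (form (π.orb b) _)]
    exact h g hg
  have hUcomp : ∀ n x y z w, U (n + 1) x y → U (n + 1) y z → U (n + 1) z w → U n x w := by
    intro n x y z w hxy hyz hzw g hg
    have hstep : ∀ a b, U (n + 1) a b →
        π.offDiag a b ≤ ε₀ / 21 * (form (π.orb a) (π.orb g) * form (π.orb b) (π.orb g)) := by
      intro a b hab
      by_contra! hlt
      obtain ⟨h, hhK, hh⟩ := hKexp (g⁻¹ * a) (g⁻¹ * b) (by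
        rw [hfst, hfst, form_orb_orb]
        exact (hlt.trans_le (π.offDiag_le a b)).le)
      have hne : a ≠ b := by
        rintro rfl
        rw [show π.offDiag a a = 0 from if_pos rfl] at hlt
        have := hpos a g
        have : 0 ≤ ε₀ / 21 * (form (π.orb a) (π.orb g) * form (π.orb a) (π.orb g)) := by positivity
        linarith
      rw [htrans, htrans, form_orb_orb] at hh
      have h2 := hab (g * h) (by
        have := hmul g h
        have := hk h hhK
        rw [add_mul]
        omega)
      rw [show π.offDiag a b = _ from if_neg hne] at h2
      exact absurd hh (not_lt.2 h2)
    have h1 := hstep x y hxy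
    have h2 := hstep y z hyz
    have h3 := hstep z w hzw
    have t1 := π.offDiag_triangle x y w g
    have t2 := π.offDiag_triangle y z w g
    have px := hpos x g
    have py := hpos y g
    have pz := hpos z g
    have pw := hpos w g
    set X := form (π.orb x) (π.orb g)
    set Y := form (π.orb y) (π.orb g)
    set Z := form (π.orb z) (π.orb g)
    set W := form (π.orb w) (π.orb g)
    have h4 : π.offDiag y w ≤ 6 * (ε₀ / 21) * (Y * W) := by
      refine le_of_mul_le_mul_right ?_ pz
      nlinarith [mul_le_mul_of_nonneg_right h2 pw.le, mul_le_mul_of_nonneg_right h3 py.le]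
    refine le_of_mul_le_mul_right ?_ py
    nlinarith [mul_le_mul_of_nonneg_right h1 pw.le, mul_le_mul_of_nonneg_right h4 px.le]
  obtain ⟨M, hM⟩ := (hS.image fun s => (π.orb s).1).bddAbove
  obtain ⟨c, hc0, hc⟩ := hball _ (π.proper (M / ε₀))
  have hedge : ∀ a b n, a⁻¹ * b ∈ S → n * k + c < len a → U n a b := by
    intro a b n hab hlen g hg
    by_contra! hlt
    have h1 : form (π.orb a) (π.orb b) ≤ M := by
      rw [form_comm, ← hfst]
      exact hM ⟨_, hab, rfl⟩
    have h2 := π.offDiag_le a b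
    have h3 := π.one_le_form_orb b g
    have h4 := hpos a g
    have h5 : len (a⁻¹ * g) ≤ c := hc _ (by
      change (π.orb (a⁻¹ * g)).1 ≤ _
      rw [hfst, le_div_iff₀ hε₀, form_comm]
      have h5 : ε₀ * (form (π.orb a) (π.orb g) * 1) ≤
        ε₀ * (form (π.orb a) (π.orb g) * form (π.orb b) (π.orb g)) := by gcongr
      linarith)
    have h6 := hmul (a⁻¹ * g) g⁻¹
    rw [mul_inv_cancel_right, hinv, hinv] at h6
    omega
  obtain ⟨K', hK', hKexp'⟩ := exists_finite_expansive hexp hε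
  obtain ⟨n, hn0, hn⟩ := hball K' hK'
  obtain ⟨c', hc'0, hc'⟩ := hball _ (π.proper (1 / ε))
  set φ : ℝ := (1 / 2) ^ ((4 * k : ℕ) : ℝ)⁻¹ with hφ
  have h4k : 4 * k ≠ 0 := by omega
  have hφpow : φ ^ (4 * k) = 1 / 2 := Real.rpow_inv_natCast_pow (by norm_num) h4k
  have hφ0 : 0 < φ := Real.rpow_pos_of_pos (by norm_num) _
  have hφ1 : φ < 1 := Real.rpow_lt_one (by norm_num) (by norm_num) (by positivity)
  have hlimR : Tendsto (fun R : ℕ => φ ^ R * (2 * (1 - φ)⁻¹ / φ ^ (4 * (c + k)))) atTop (𝓝 0) := by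
    simpa using (tendsto_pow_atTop_nhds_zero_of_lt_one hφ0.le hφ1).mul_const
      (2 * (1 - φ)⁻¹ / φ ^ (4 * (c + k)))
  obtain ⟨R, hR1, hR2⟩ := ((hlimR.eventually_lt_const
    (by positivity : (0 : ℝ) < (1 / 2) ^ (n + 1))).and (eventually_gt_atTop (c + c'))).exists
  refine ⟨R, fun m w hw hgeo hfar => ?_⟩
  by_contra! hcon
  rcases eq_or_ne (w 0) (w m) with heq | hne
  · rw [← heq, form_orb_self] at hcon
    have h1 := π.one_le_fst_orb (w 0)
    have h2 : len (w 0) ≤ c' := hc' _ (by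
      change (π.orb (w 0)).1 ≤ _
      rw [le_div_iff₀ hε]
      nlinarith)
    have := hfar 0 (Nat.zero_le _)
    omega
  obtain ⟨g, hg, hlt⟩ := hKexp' _ _ hcon
  have hUn : U n (w 0) (w m) := by
    obtain ⟨j, hj, hjmin⟩ := Finset.exists_min_image (Finset.range (m + 1)) (fun i => len (w i))
      ⟨0, by simp⟩
    have hjm : j ≤ m := by
      have := Finset.mem_range.1 hj
      omega
    have hdist : ∀ i < m, R + Nat.dist i j ≤ 4 * len (w i) := fun i hi => by
      have h1 := hjmin i (Finset.mem_range.2 (by omega))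
      have h2 := hfar i hi.le
      have h3 : Nat.dist i j ≤ len (w i) + len (w j) := by
        rcases le_total i j with hij | hij
        · have h4 := hgeo i hi.le j hjm hij
          have h5 := hmul (w i)⁻¹ (w j)
          rw [hinv] at h5
          rw [Nat.dist_eq_sub_of_le hij]
          omega
        · have h4 := hgeo j hjm i hi.le hij
          have h5 := hmul (w j)⁻¹ (w i)
          rw [hinv] at h5
          rw [Nat.dist_eq_sub_of_le_right hij]
          omega
      omega
    refine rel_of_sum_lt hUrefl hUsymm hUcomp (e := fun i => (len (w i) - c - 1) / k)
      (fun i hi => hedge _ _ _ (hw i hi) ?_) (lt_of_le_of_lt ?_ hR1)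
    · have h1 := hfar i hi.le
      have h2 := Nat.div_mul_le_self (len (w i) - c - 1) k
      omega
    · have hterm : ∀ i ∈ Finset.range m, (1 / 2 : ℝ) ^ ((len (w i) - c - 1) / k) ≤
          φ ^ R / φ ^ (4 * (c + k)) * φ ^ Nat.dist i j := fun i hi => by
        have hi := Finset.mem_range.1 hi
        rw [← hφpow, ← pow_mul, div_mul_eq_mul_div, le_div_iff₀ (by positivity), ← pow_add,
          ← pow_add]
        refine pow_le_pow_of_le_one hφ0.le hφ1.le ?_
        have h1 := hdist i hi
        have h2 := Nat.div_add_mod (len (w i) - c - 1) k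
        have h3 := Nat.mod_lt (len (w i) - c - 1) hk0
        have h4 := hfar i hi.le
        rw [mul_assoc]
        omega
      refine (Finset.sum_le_sum hterm).trans ?_
      rw [← Finset.mul_sum]
      calc φ ^ R / φ ^ (4 * (c + k)) * ∑ i ∈ Finset.range m, φ ^ Nat.dist i j
          ≤ φ ^ R / φ ^ (4 * (c + k)) * (2 * (1 - φ)⁻¹) := by
            gcongr
            exact sum_pow_dist_le hφ0.le hφ1 m j
        _ = _ := by ring
  have h1 := hUn g ((hn g hg).trans (Nat.le_mul_of_pos_right n hk0))
  rw [show π.offDiag _ _ = _ from if_neg hne] at h1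
  exact absurd hlt (not_lt.2 h1)

end LorentzAction

/-! ### The Lorentz model of `PSL(2,ℂ)` acting on `ℍ³` -/

namespace Mink

open Matrix

/-- Minkowski space as the space of Hermitian matrices. -/
def herm : Mink →ₗ[ℝ] Matrix (Fin 2) (Fin 2) ℂ where
  toFun v := !![((v.1 + v.2 2 : ℝ) : ℂ), ⟨v.2 0, v.2 1⟩; ⟨v.2 0, -v.2 1⟩, ((v.1 - v.2 2 : ℝ) : ℂ)]
  map_add' v w := by
    ext i j
    fin_cases i <;> fin_cases j <;> apply Complex.ext <;> simp <;> ring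
  map_smul' r v := by
    ext i j
    fin_cases i <;> fin_cases j <;> apply Complex.ext <;> simp <;> ring

/-- The inverse of `herm`, extended to all matrices. -/
def unherm : Matrix (Fin 2) (Fin 2) ℂ →ₗ[ℝ] Mink where
  toFun X := (((X 0 0).re + (X 1 1).re) / 2,
    !₂[(X 0 1).re, (X 0 1).im, ((X 0 0).re - (X 1 1).re) / 2])
  map_add' X Y := by
    refine Prod.ext (by simp; ring) ?_
    ext i
    fin_cases i <;> simp; ring
  map_smul' r X := by
    refine Prod.ext (by simp; ring) ?_
    ext i
    fin_cases i <;> simp; ring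

lemma unherm_herm (v : Mink) : unherm (herm v) = v := by
  refine Prod.ext (by simp [unherm, herm]) ?_
  ext i
  fin_cases i <;> simp [unherm, herm]

lemma herm_conjTranspose (v : Mink) : (herm v)ᴴ = herm v := by
  ext i j
  fin_cases i <;> fin_cases j <;> apply Complex.ext <;> simp [herm]

lemma herm_unherm {X : Matrix (Fin 2) (Fin 2) ℂ} (hX : Xᴴ = X) : herm (unherm X) = X := by
  have h : ∀ i j, star (X j i) = X i j := fun i j => congrFun (congrFun hX i) j
  have h00 := congrArg Complex.im (h 0 0)
  have h11 := congrArg Complex.im (h 1 1)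
  have h10 := h 1 0
  have h10r := congrArg Complex.re h10
  have h10i := congrArg Complex.im h10
  simp only [RCLike.star_def, Complex.conj_im, Complex.conj_re] at h00 h11 h10r h10i
  ext i j
  fin_cases i <;> fin_cases j <;> apply Complex.ext <;> simp [herm, unherm] <;> linarith

lemma det_herm (v : Mink) : (herm v).det = (form v v : ℝ) := by
  rw [det_fin_two, form_self, EuclideanSpace.norm_sq_eq, Fin.sum_univ_three]
  apply Complex.ext <;> simp [herm, sq] <;> ring

lemma herm_base : herm base = 1 := by
  ext i j
  fin_cases i <;> fin_cases j <;> apply Complex.ext <;> simp [herm, base]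

/-- The linear action of complex matrices on Minkowski space. -/
def lorentz (A : Matrix (Fin 2) (Fin 2) ℂ) : Module.End ℝ Mink where
  toFun v := unherm (A * herm v * Aᴴ)
  map_add' v w := by simp only [map_add, mul_add, add_mul]
  map_smul' r v := by
    simp only [_root_.map_smul, Matrix.mul_smul, Matrix.smul_mul, RingHom.id_apply]

lemma lorentz_apply (A : Matrix (Fin 2) (Fin 2) ℂ) (v : Mink) :
    lorentz A v = unherm (A * herm v * Aᴴ) := rfl

lemma herm_lorentz (A : Matrix (Fin 2) (Fin 2) ℂ) (v : Mink) :
    herm (lorentz A v) = A * herm v * Aᴴ :=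
  herm_unherm (by simp only [conjTranspose_mul, conjTranspose_conjTranspose, herm_conjTranspose,
    mul_assoc])

lemma lorentz_mul (A B : Matrix (Fin 2) (Fin 2) ℂ) (v : Mink) :
    lorentz (A * B) v = lorentz A (lorentz B v) := by
  rw [lorentz_apply A, herm_lorentz, lorentz_apply]
  simp only [conjTranspose_mul, mul_assoc]

lemma lorentz_one (v : Mink) : lorentz 1 v = v := by
  rw [lorentz_apply, conjTranspose_one, one_mul, mul_one, unherm_herm]

lemma form_lorentz_self {A : Matrix (Fin 2) (Fin 2) ℂ} (hA : A.det = 1) (v : Mink) :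
    form (lorentz A v) (lorentz A v) = form v v := by
  have h := det_herm (lorentz A v)
  rw [herm_lorentz, det_mul, det_mul, det_conjTranspose, hA, star_one, one_mul, mul_one,
    det_herm] at h
  exact_mod_cast h.symm

lemma form_lorentz {A : Matrix (Fin 2) (Fin 2) ℂ} (hA : A.det = 1) (v w : Mink) :
    form (lorentz A v) (lorentz A w) = form v w := by
  have h1 := form_lorentz_self hA (v + w)
  have h2 := form_lorentz_self hA v
  have h3 := form_lorentz_self hA w
  simp only [map_add, form_add_left, form_add_right] at h1
  rw [form_comm (lorentz A w), form_comm w v] at h1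
  linarith

lemma fst_lorentz_base (A : Matrix (Fin 2) (Fin 2) ℂ) :
    (lorentz A base).1 = (‖A 0 0‖ ^ 2 + ‖A 0 1‖ ^ 2 + ‖A 1 0‖ ^ 2 + ‖A 1 1‖ ^ 2) / 2 := by
  rw [lorentz_apply, herm_base, mul_one]
  simp only [unherm, LinearMap.coe_mk, AddHom.coe_mk, mul_apply, Fin.sum_univ_two,
    conjTranspose_apply, RCLike.star_def, Complex.mul_conj, Complex.normSq_eq_norm_sq,
    Complex.add_re, Complex.ofReal_re]
  ring

lemma mem_cone_of_form_self {v : Mink} (h1 : 0 ≤ v.1) (h2 : 0 ≤ form v v) : v ∈ cone := by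
  rw [form_self] at h2
  exact abs_le_of_sq_le_sq' (by linarith) h1 |>.2

lemma lorentz_mem_cone (A : SL2C) {v : Mink} (hv : v ∈ cone) : lorentz A.1 v ∈ cone := by
  have hbase : ∀ B : SL2C, lorentz B.1 base ∈ cone := fun B => by
    refine mem_cone_of_form_self ?_ ?_
    · rw [fst_lorentz_base]; positivity
    · rw [form_lorentz_self B.2]; exact form_nonneg base_mem_cone base_mem_cone
  refine mem_cone_of_form_self ?_ ?_
  · rw [← form_base, ← form_lorentz (A⁻¹).2, ← lorentz_mul, ← Matrix.SpecialLinearGroup.coe_mul,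
      inv_mul_cancel, Matrix.SpecialLinearGroup.coe_one, lorentz_one]
    exact form_nonneg hv (hbase _)
  · rw [form_lorentz_self A.2]
    exact form_nonneg hv hv

/-- The action of `SL(2,ℂ)` on Minkowski space. -/
def lorentzSL : SL2C →* Module.End ℝ Mink where
  toFun A := lorentz A.1
  map_one' := LinearMap.ext lorentz_one
  map_mul' A B := LinearMap.ext (lorentz_mul A.1 B.1)

/-- The action of `PSL(2,ℂ)` on Minkowski space. -/
def lorentzPSL : PSL2C →* Module.End ℝ Mink :=
  QuotientGroup.lift (Subgroup.center SL2C) lorentzSL fun A hA => by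
    obtain ⟨r, hr, hrA⟩ := Matrix.SpecialLinearGroup.mem_center_iff.1 hA
    refine LinearMap.ext fun v => ?_
    change lorentz A.1 v = v
    have hr1 : r * star r = 1 := by
      rw [RCLike.star_def, Complex.mul_conj, Complex.normSq_eq_norm_sq]
      have := congrArg norm hr
      rw [norm_pow, norm_one, Fintype.card_fin] at this
      rw [this, Complex.ofReal_one]
    rw [lorentz_apply, ← hrA, scalar_apply, ← smul_one_eq_diagonal, conjTranspose_smul,
      conjTranspose_one, smul_mul, one_mul, Matrix.mul_smul, mul_one, smul_smul,
      mul_comm (star r), hr1, one_smul, unherm_herm]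

lemma lorentzPSL_mk (A : SL2C) : lorentzPSL (A : PSL2C) = lorentzSL A := rfl

lemma lorentzPSL_out (q : PSL2C) : lorentzPSL q = lorentzSL q.out := by
  conv_lhs => rw [← QuotientGroup.out_eq' q]
  rfl

lemma lorentzPSL_mul_apply (q r : PSL2C) (v : Mink) :
    lorentzPSL (q * r) v = lorentzPSL q (lorentzPSL r v) := by rw [map_mul]; rfl

lemma lorentzPSL_inv_apply (q : PSL2C) (v : Mink) : lorentzPSL q⁻¹ (lorentzPSL q v) = v := by
  rw [← lorentzPSL_mul_apply, inv_mul_cancel, map_one]; rfl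

lemma form_lorentzPSL (q : PSL2C) (v w : Mink) :
    form (lorentzPSL q v) (lorentzPSL q w) = form v w := by
  rw [lorentzPSL_out]
  exact form_lorentz q.out.2 v w

lemma form_lorentzPSL_left (q : PSL2C) (v w : Mink) :
    form (lorentzPSL q v) w = form v (lorentzPSL q⁻¹ w) := by
  rw [← form_lorentzPSL q⁻¹, lorentzPSL_inv_apply]

lemma lorentzPSL_mem_cone (q : PSL2C) {v : Mink} (hv : v ∈ cone) : lorentzPSL q v ∈ cone := by
  rw [lorentzPSL_out]
  exact lorentz_mem_cone q.out hv

/-- The hyperboloid model: `ℍ³` inside Minkowski space. -/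
def hyp (p : H3) : Mink :=
  ((‖p.1.1‖ ^ 2 + p.1.2 ^ 2 + 1) / (2 * p.1.2),
    !₂[p.1.1.re / p.1.2, p.1.1.im / p.1.2, (‖p.1.1‖ ^ 2 + p.1.2 ^ 2 - 1) / (2 * p.1.2)])

lemma form_eq_coord (v w : Mink) :
    form v w = v.1 * w.1 - (v.2 0 * w.2 0 + v.2 1 * w.2 1 + v.2 2 * w.2 2) := by
  rw [form, EuclideanSpace.inner_eq_star_dotProduct]
  simp [dotProduct, Fin.sum_univ_three]
  ring

lemma form_hyp (p q : H3) : form (hyp p) (hyp q) =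
    1 + (‖p.1.1 - q.1.1‖ ^ 2 + (p.1.2 - q.1.2) ^ 2) / (2 * p.1.2 * q.1.2) := by
  obtain ⟨⟨z, t⟩, ht⟩ := p
  obtain ⟨⟨w, s⟩, hs⟩ := q
  simp only at ht hs
  rw [form_eq_coord]
  simp only [hyp, ← Complex.normSq_eq_norm_sq, Complex.normSq_apply, Complex.sub_re,
    Complex.sub_im, PiLp.toLp_apply, cons_val]
  field_simp
  ring

lemma form_hyp_self (p : H3) : form (hyp p) (hyp p) = 1 := by
  rw [form_hyp]; simp

lemma fst_hyp_pos (p : H3) : 0 < (hyp p).1 := by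
  have := p.2
  unfold hyp
  positivity

lemma hyp_mem_cone (p : H3) : hyp p ∈ cone :=
  mem_cone_of_form_self (fst_hyp_pos p).le (by rw [form_hyp_self]; norm_num)

lemma one_le_form_hyp (p q : H3) : 1 ≤ form (hyp p) (hyp q) := by
  rw [form_hyp]
  have := p.2
  have := q.2
  have : 0 ≤ (‖p.1.1 - q.1.1‖ ^ 2 + (p.1.2 - q.1.2) ^ 2) / (2 * p.1.2 * q.1.2) := by positivity
  linarith

/-- A vector is determined by its norm and three of its light-cone coordinates. -/
lemma ext_of_form_self {v w : Mink} (h : form v v = form w w) (h0 : v.2 0 = w.2 0)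
    (h1 : v.2 1 = w.2 1) (h2 : v.1 - v.2 2 = w.1 - w.2 2) (hne : w.1 - w.2 2 ≠ 0) : v = w := by
  rw [form_eq_coord, form_eq_coord, h0, h1] at h
  have h3 : v.1 + v.2 2 = w.1 + w.2 2 := by
    refine mul_left_cancel₀ hne ?_
    nth_rw 1 [← h2]
    linarith
  refine Prod.ext (by linarith) ?_
  ext i
  fin_cases i
  · exact h0
  · exact h1
  · change v.2 2 = w.2 2
    linarith

lemma hyp_injective : Function.Injective hyp := fun p q h => by
  have h1 : (‖p.1.1 - q.1.1‖ ^ 2 + (p.1.2 - q.1.2) ^ 2) / (2 * p.1.2 * q.1.2) = 0 := by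
    have := form_hyp p q
    rw [h, form_hyp_self] at this
    linarith
  have hp := p.2
  have hq := q.2
  rw [div_eq_zero_iff, or_iff_left (by positivity)] at h1
  have h2 : ‖p.1.1 - q.1.1‖ = 0 := by nlinarith [sq_nonneg ‖p.1.1 - q.1.1‖, sq_nonneg (p.1.2 - q.1.2)]
  have h3 : p.1.2 - q.1.2 = 0 := by nlinarith [sq_nonneg ‖p.1.1 - q.1.1‖, sq_nonneg (p.1.2 - q.1.2)]
  exact Subtype.ext (Prod.ext (sub_eq_zero.1 (norm_eq_zero.1 h2)) (sub_eq_zero.1 h3))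

lemma exists_hyp_eq {v : Mink} (hv : v ∈ cone) (h1 : form v v = 1) : ∃ p, hyp p = v := by
  have h2 : 0 < v.1 - v.2 2 := by
    have h3 : ‖v.2‖ < v.1 := norm_lt_fst hv (by rw [h1]; norm_num)
    have h4 : v.2 2 ≤ ‖v.2‖ := (le_abs_self _).trans (PiLp.norm_apply_le v.2 2)
    linarith
  refine ⟨⟨(⟨v.2 0 / (v.1 - v.2 2), v.2 1 / (v.1 - v.2 2)⟩, 1 / (v.1 - v.2 2)), by positivity⟩, ?_⟩
  refine ext_of_form_self (by rw [form_hyp_self, h1]) ?_ ?_ ?_ h2.ne'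
  · simp [hyp]
    field_simp
  · simp [hyp]
    field_simp
  · simp [hyp]
    field_simp
    ring

lemma hyp_act3SL (A : SL2C) (p : H3) : hyp (act3SL A p) = lorentz A.1 (hyp p) := by
  have hD := denom_pos A p.1.1 p.1.2 p.2
  have hdet := A.2
  obtain ⟨⟨z, t⟩, ht⟩ := p
  simp only at ht hD
  set a := A.1 0 0 with ha
  set b := A.1 0 1 with hb
  set c := A.1 1 0 with hc
  set d := A.1 1 1 with hd
  set D := Complex.normSq (c * z + d) + Complex.normSq c * t ^ 2 with hDdef
  have hentry : ∀ i j, (A.1 * herm (hyp ⟨(z, t), ht⟩) * (A.1)ᴴ) i j =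
      (A.1 i 0 * ((‖z‖ ^ 2 + t ^ 2 : ℝ) / t) + A.1 i 1 * (star z / t)) * star (A.1 j 0) +
      (A.1 i 0 * (z / t) + A.1 i 1 * (1 / t)) * star (A.1 j 1) := fun i j => by
    have ht' : (t : ℂ) ≠ 0 := by exact_mod_cast ht.ne'
    have h00 : herm (hyp ⟨(z, t), ht⟩) 0 0 = (‖z‖ ^ 2 + t ^ 2 : ℝ) / t := by
      rw [← Complex.ofReal_div]
      simp only [herm, hyp, LinearMap.coe_mk, AddHom.coe_mk, of_apply, cons_val', cons_val_zero]
      congr 1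
      simp only [cons_val]
      field_simp
      ring
    have h01 : herm (hyp ⟨(z, t), ht⟩) 0 1 = z / t := by
      apply Complex.ext <;> simp [herm, hyp, Complex.div_ofReal_re, Complex.div_ofReal_im]
    have h10 : herm (hyp ⟨(z, t), ht⟩) 1 0 = star z / t := by
      apply Complex.ext <;> simp [herm, hyp, Complex.div_ofReal_re, Complex.div_ofReal_im, neg_div]
    have h11 : herm (hyp ⟨(z, t), ht⟩) 1 1 = 1 / t := by
      rw [← Complex.ofReal_one, ← Complex.ofReal_div]
      simp only [herm, hyp, LinearMap.coe_mk, AddHom.coe_mk, of_apply, cons_val', cons_val_one,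
        cons_val_zero]
      congr 1
      simp only [cons_val]
      field_simp
      ring
    simp only [mul_apply, Fin.sum_univ_two, conjTranspose_apply, h00, h01, h10, h11]
  have h11 : (A.1 * herm (hyp ⟨(z, t), ht⟩) * (A.1)ᴴ) 1 1 = ((D / t : ℝ) : ℂ) := by
    rw [hentry, hDdef, ← hc, ← hd]
    apply Complex.ext <;> simp [← Complex.normSq_eq_norm_sq, Complex.normSq_apply,
      Complex.div_ofReal_re, Complex.div_ofReal_im] <;> field_simp <;> ring
  have h01 : (A.1 * herm (hyp ⟨(z, t), ht⟩) * (A.1)ᴴ) 0 1 =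
      ((a * z + b) * (starRingEnd ℂ) (c * z + d) + a * (starRingEnd ℂ) c * (t : ℂ) ^ 2) / t := by
    have hz : ((‖z‖ ^ 2 + t ^ 2 : ℝ) : ℂ) = z * (starRingEnd ℂ) z + t ^ 2 := by
      rw [Complex.mul_conj, Complex.normSq_eq_norm_sq]; push_cast; ring
    rw [hentry, ← ha, ← hb, ← hc, ← hd, hz]
    simp only [RCLike.star_def, map_add, map_mul]
    ring
  have hherm := herm_lorentz A.1 (hyp ⟨(z, t), ht⟩)
  set v := lorentz A.1 (hyp ⟨(z, t), ht⟩) with hv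
  have hv11 : v.1 - v.2 2 = D / t := by
    have := congrFun (congrFun hherm 1) 1
    rw [h11] at this
    have h2 : herm v 1 1 = ((v.1 - v.2 2 : ℝ) : ℂ) := rfl
    rw [h2] at this
    exact_mod_cast this
  have hv01 : (⟨v.2 0, v.2 1⟩ : ℂ) =
      ((a * z + b) * (starRingEnd ℂ) (c * z + d) + a * (starRingEnd ℂ) c * (t : ℂ) ^ 2) / t := by
    rw [← h01, ← hherm]
    rfl
  refine ext_of_form_self ?_ ?_ ?_ ?_ ?_
  · rw [hv, form_lorentz_self A.2, form_hyp_self, form_hyp_self]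
  · rw [show v.2 0 = (⟨v.2 0, v.2 1⟩ : ℂ).re from rfl, hv01]
    simp only [hyp, act3SL, PiLp.toLp_apply, cons_val, Complex.div_ofReal_re, ← ha, ← hb, ← hc,
      ← hd, ← hDdef]
    field_simp
  · rw [show v.2 1 = (⟨v.2 0, v.2 1⟩ : ℂ).im from rfl, hv01]
    simp only [hyp, act3SL, PiLp.toLp_apply, cons_val, Complex.div_ofReal_im, ← ha, ← hb, ← hc,
      ← hd, ← hDdef]
    field_simp
  · rw [hv11]
    simp only [hyp, act3SL, PiLp.toLp_apply, cons_val, ← ha, ← hb, ← hc,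
      ← hd, ← hDdef]
    field_simp
    ring
  · rw [hv11]
    positivity

lemma hyp_act3 (q : PSL2C) (p : H3) : hyp (act3 q p) = lorentzPSL q (hyp p) := by
  rw [lorentzPSL_out]
  exact hyp_act3SL q.out p

end Mink

namespace Mink

open Matrix

/-! ### Ideal points -/

/-- The null vector of a vector of `ℂ²`. -/
def nulv (v : Fin 2 → ℂ) : Mink := unherm (vecMulVec v (star v))

lemma lorentz_nulv (A : Matrix (Fin 2) (Fin 2) ℂ) (v : Fin 2 → ℂ) :
    lorentz A (nulv v) = nulv (A *ᵥ v) := by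
  have h : herm (nulv v) = vecMulVec v (star v) :=
    herm_unherm (by rw [conjTranspose_vecMulVec, star_star])
  rw [lorentz_apply, h, mul_vecMulVec, vecMulVec_mul, nulv, star_mulVec]

lemma nulv_smul (c : ℂ) (v : Fin 2 → ℂ) : nulv (c • v) = ‖c‖ ^ 2 • nulv v := by
  rw [nulv, nulv, ← _root_.map_smul, star_smul, vecMulVec_smul, smul_vecMulVec, smul_smul]
  congr 1
  rw [RCLike.star_def, mul_comm, Complex.mul_conj, Complex.normSq_eq_norm_sq]
  rfl

lemma nulv_coord (v : Fin 2 → ℂ) : nulv v = ((‖v 0‖ ^ 2 + ‖v 1‖ ^ 2) / 2,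
    !₂[(v 0 * star (v 1)).re, (v 0 * star (v 1)).im, (‖v 0‖ ^ 2 - ‖v 1‖ ^ 2) / 2]) := by
  simp only [nulv, unherm, vecMulVec_apply, LinearMap.coe_mk, AddHom.coe_mk, Pi.star_apply,
    RCLike.star_def, Complex.mul_conj, Complex.normSq_eq_norm_sq, Complex.ofReal_re]

lemma form_nulv (v w : Fin 2 → ℂ) :
    form (nulv v) (nulv w) = ‖v 0 * w 1 - v 1 * w 0‖ ^ 2 / 2 := by
  rw [form_eq_coord, nulv_coord, nulv_coord]
  simp only [← Complex.normSq_eq_norm_sq, Complex.normSq_apply, RCLike.star_def, cons_val,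
    Complex.mul_re, Complex.mul_im, Complex.conj_re, Complex.conj_im,
    Complex.sub_re, Complex.sub_im]
  ring

lemma nulv_mem_cone (v : Fin 2 → ℂ) : nulv v ∈ cone := by
  refine mem_cone_of_form_self ?_ ?_
  · rw [nulv_coord]; positivity
  · rw [form_nulv]; positivity

lemma fst_nulv_pos {v : Fin 2 → ℂ} (hv : v ≠ 0) : 0 < (nulv v).1 := by
  refine lt_of_le_of_ne (fst_nonneg (nulv_mem_cone v)) fun h => hv ?_
  rw [nulv_coord] at h
  simp only at h
  have h0 : ‖v 0‖ = 0 := by nlinarith [sq_nonneg ‖v 0‖, sq_nonneg ‖v 1‖]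
  have h1 : ‖v 1‖ = 0 := by nlinarith [sq_nonneg ‖v 0‖, sq_nonneg ‖v 1‖]
  ext i
  fin_cases i
  · exact norm_eq_zero.1 h0
  · exact norm_eq_zero.1 h1

/-- The lift to `ℂ²` of a point of the Riemann sphere. -/
def lift (ξ : OnePoint ℂ) : Fin 2 → ℂ := Option.elim ξ ![1, 0] fun z => ![z, 1]

/-- The null vector of a point of the Riemann sphere. -/
def nul (ξ : OnePoint ℂ) : Mink := nulv (lift ξ)

lemma lift_infty : lift ∞ = ![1, 0] := rfl

lemma lift_coe (z : ℂ) : lift (z : OnePoint ℂ) = ![z, 1] := rfl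

lemma lift_ne_zero (ξ : OnePoint ℂ) : lift ξ ≠ 0 := by
  induction ξ using OnePoint.rec with
  | infty => exact fun h => by simpa [lift_infty] using congrFun h 0
  | coe z => exact fun h => by simpa [lift_coe] using congrFun h 1

lemma nul_mem_cone (ξ : OnePoint ℂ) : nul ξ ∈ cone := nulv_mem_cone _

lemma fst_nul_pos (ξ : OnePoint ℂ) : 0 < (nul ξ).1 := fst_nulv_pos (lift_ne_zero ξ)

lemma form_nul_self (ξ : OnePoint ℂ) : form (nul ξ) (nul ξ) = 0 := by
  rw [nul, form_nulv, mul_comm, sub_self]; simp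

lemma eq_of_form_nul {ξ ζ : OnePoint ℂ} (h : form (nul ξ) (nul ζ) = 0) : ξ = ζ := by
  rw [nul, nul, form_nulv, div_eq_zero_iff, or_iff_left two_ne_zero, sq_eq_zero_iff,
    norm_eq_zero] at h
  induction ξ using OnePoint.rec with
  | infty =>
    induction ζ using OnePoint.rec with
    | infty => rfl
    | coe w => simp [lift_infty, lift_coe] at h
  | coe z =>
    induction ζ using OnePoint.rec with
    | infty => simp [lift_infty, lift_coe] at h
    | coe w =>
      simp only [lift_coe, cons_val_zero, cons_val_one, mul_one, one_mul] at h
      rw [sub_eq_zero.1 h]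

lemma exists_smul_lift {v : Fin 2 → ℂ} (hv : v ≠ 0) :
    ∃ (ξ : OnePoint ℂ) (c : ℂ), c ≠ 0 ∧ v = c • lift ξ := by
  by_cases h : v 1 = 0
  · refine ⟨∞, v 0, fun h0 => hv ?_, ?_⟩
    · ext i
      fin_cases i
      · exact h0
      · exact h
    · ext i
      fin_cases i
      · simp [lift_infty]
      · simpa [lift_infty] using h
  · refine ⟨((v 0 / v 1 : ℂ) : OnePoint ℂ), v 1, h, ?_⟩
    ext i
    fin_cases i
    · simp only [lift_coe, Fin.zero_eta, Pi.smul_apply, cons_val_zero, smul_eq_mul]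
      field_simp
    · simp [lift_coe]

lemma exists_nulv_eq_smul {v : Fin 2 → ℂ} (hv : v ≠ 0) :
    ∃ (ξ : OnePoint ℂ) (r : ℝ), 0 < r ∧ nulv v = r • nul ξ := by
  obtain ⟨ξ, c, hc, h⟩ := exists_smul_lift hv
  refine ⟨ξ, ‖c‖ ^ 2, by positivity, ?_⟩
  rw [h, nulv_smul, nul]

/-- Every null vector is a multiple of the null vector of an ideal point. -/
lemma exists_eq_smul_nul {x : Mink} (hx : x ∈ cone) (h0 : x ≠ 0) (h : form x x = 0) :
    ∃ (ξ : OnePoint ℂ) (r : ℝ), 0 < r ∧ x = r • nul ξ := by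
  have hpos := fst_pos hx h0
  by_cases hs : x.1 - x.2 2 = 0
  · refine ⟨∞, 2 * x.1, by positivity, ?_⟩
    rw [form_eq_coord, ← sub_eq_zero.1 hs] at h
    have e0 : x.2 0 = 0 := by nlinarith [sq_nonneg (x.2 0), sq_nonneg (x.2 1)]
    have e1 : x.2 1 = 0 := by nlinarith [sq_nonneg (x.2 0), sq_nonneg (x.2 1)]
    rw [nul, nulv_coord, lift_infty]
    refine Prod.ext (by simp; ring) ?_
    ext i
    fin_cases i
    · simpa using e0
    · simpa using e1
    · simp [← sub_eq_zero.1 hs]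
      ring
  · have hle : x.2 2 ≤ x.1 := (le_abs_self _).trans ((PiLp.norm_apply_le x.2 2).trans hx)
    have hs' : 0 < x.1 - x.2 2 := lt_of_le_of_ne (by linarith) (Ne.symm hs)
    refine ⟨((⟨x.2 0 / (x.1 - x.2 2), x.2 1 / (x.1 - x.2 2)⟩ : ℂ) : OnePoint ℂ), x.1 - x.2 2, hs',
      ?_⟩
    symm
    refine ext_of_form_self ?_ ?_ ?_ ?_ hs
    · rw [h, form_smul_left, form_smul_right, form_nul_self]; ring
    all_goals
      rw [nul, nulv_coord, lift_coe]
      simp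
      field_simp
    ring

lemma lorentz_nul (A : SL2C) (ξ : OnePoint ℂ) :
    ∃ c : ℂ, c ≠ 0 ∧ A.1 *ᵥ lift ξ = c • lift (mobiusSL A ξ) := by
  have hdet := A.2
  rw [det_fin_two] at hdet
  induction ξ using OnePoint.rec with
  | infty =>
    have hm : mobiusSL A ∞ = if A.1 1 0 = 0 then (∞ : OnePoint ℂ)
      else ((A.1 0 0 / A.1 1 0 : ℂ) : OnePoint ℂ) := rfl
    rw [hm]
    split_ifs with h
    · refine ⟨A.1 0 0, fun h0 => by simp [h, h0] at hdet, ?_⟩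
      ext i
      fin_cases i <;> simp [lift_infty, mulVec, dotProduct, h]
    · refine ⟨A.1 1 0, h, ?_⟩
      ext i
      fin_cases i
      · simp [lift_infty, lift_coe, mulVec, dotProduct]
        field_simp
      · simp [lift_infty, lift_coe, mulVec, dotProduct]
  | coe z =>
    have hm : mobiusSL A (z : OnePoint ℂ) = if A.1 1 0 * z + A.1 1 1 = 0 then (∞ : OnePoint ℂ)
      else (((A.1 0 0 * z + A.1 0 1) / (A.1 1 0 * z + A.1 1 1) : ℂ) : OnePoint ℂ) := rfl
    rw [hm]
    split_ifs with h
    · refine ⟨A.1 0 0 * z + A.1 0 1, fun h0 => ?_, ?_⟩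
      · have : A.1 0 0 * (A.1 1 0 * z + A.1 1 1) - A.1 1 0 * (A.1 0 0 * z + A.1 0 1) = 1 := by
          linear_combination hdet
        rw [h, h0] at this
        simp at this
      · ext i
        fin_cases i <;> simp [lift_infty, lift_coe, mulVec, dotProduct, h]
    · refine ⟨A.1 1 0 * z + A.1 1 1, h, ?_⟩
      ext i
      fin_cases i
      · simp [lift_coe, mulVec, dotProduct, mul_div_cancel₀ _ h]
      · simp [lift_coe, mulVec, dotProduct]

lemma lorentzPSL_nul (q : PSL2C) (ξ : OnePoint ℂ) :
    ∃ r : ℝ, 0 < r ∧ lorentzPSL q (nul ξ) = r • nul (actS q ξ) := by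
  obtain ⟨c, hc, h⟩ := lorentz_nul q.out ξ
  refine ⟨‖c‖ ^ 2, by positivity, ?_⟩
  rw [lorentzPSL_out, nul, nul, actS, ← nulv_smul, ← h]
  exact lorentz_nulv _ _

/-! ### Distances -/

lemma d3_eq (p q : H3) : d3 p q = arcosh (form (hyp p) (hyp q)) := by rw [d3, form_hyp]

lemma arcosh_le_arcosh {x y : ℝ} (hx : 1 ≤ x) (hxy : x ≤ y) : arcosh x ≤ arcosh y := by
  unfold arcosh
  have := Real.sqrt_nonneg (x ^ 2 - 1)
  gcongr

lemma arcosh_lt_arcosh {x y : ℝ} (hx : 1 ≤ x) (hxy : x < y) : arcosh x < arcosh y := by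
  unfold arcosh
  have := Real.sqrt_nonneg (x ^ 2 - 1)
  refine Real.log_lt_log (by linarith) (add_lt_add_of_lt_of_le hxy ?_)
  gcongr

lemma d3_le_d3_iff {p q p' q' : H3} :
    d3 p q ≤ d3 p' q' ↔ form (hyp p) (hyp q) ≤ form (hyp p') (hyp q') := by
  rw [d3_eq, d3_eq]
  refine ⟨fun h => ?_, arcosh_le_arcosh (one_le_form_hyp p q)⟩
  by_contra! hlt
  exact absurd h (not_le.2 (arcosh_lt_arcosh (one_le_form_hyp p' q') hlt))

lemma form_hyp_le_exp_d3 (p q : H3) : form (hyp p) (hyp q) ≤ Real.exp (d3 p q) := by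
  have h1 := one_le_form_hyp p q
  have := Real.sqrt_nonneg (form (hyp p) (hyp q) ^ 2 - 1)
  rw [d3_eq, arcosh, Real.exp_log (by linarith)]
  linarith

lemma exp_d3_le (p q : H3) : Real.exp (d3 p q) ≤ 2 * form (hyp p) (hyp q) := by
  have h1 := one_le_form_hyp p q
  have := Real.sqrt_nonneg (form (hyp p) (hyp q) ^ 2 - 1)
  have h2 : Real.sqrt (form (hyp p) (hyp q) ^ 2 - 1) ≤ form (hyp p) (hyp q) :=
    Real.sqrt_le_iff.2 ⟨by linarith, by linarith⟩
  rw [d3_eq, arcosh, Real.exp_log (by linarith)]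
  linarith

/-- The point of `ℍ³` corresponding to `base`. -/
def origin : H3 := ⟨(0, 1), one_pos⟩

lemma hyp_origin : hyp origin = base := by
  refine Prod.ext (by simp [hyp, origin, base]) ?_
  ext i
  fin_cases i <;> simp [hyp, origin, base]

lemma exists_lorentzPSL_base (p : H3) : ∃ m : PSL2C, lorentzPSL m base = hyp p := by
  obtain ⟨⟨z, t⟩, ht⟩ := p
  simp only at ht
  have hs : 0 < Real.sqrt t := Real.sqrt_pos.2 ht
  have hsc : ((Real.sqrt t : ℝ) : ℂ) ≠ 0 := by exact_mod_cast hs.ne'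
  have hst : ((Real.sqrt t : ℝ) : ℂ) ^ 2 = t := by
    rw [← Complex.ofReal_pow, Real.sq_sqrt ht.le]
  let M : SL2C := ⟨!![(Real.sqrt t : ℂ), z / (Real.sqrt t : ℂ); 0, 1 / (Real.sqrt t : ℂ)], by
    rw [det_fin_two]; simp [hsc]⟩
  refine ⟨(M : PSL2C), ?_⟩
  rw [lorentzPSL_mk, ← hyp_origin]
  refine (hyp_act3SL M origin).symm.trans (congrArg hyp ?_)
  refine Subtype.ext (Prod.ext ?_ ?_)
  · simp [act3SL, M, origin, Complex.normSq_apply]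
    field_simp
  · simp [act3SL, M, origin, ← sq, Real.sq_sqrt ht.le]

/-- A weak form of the triangle inequality. -/
lemma form_le_through_hyp {x z : Mink} (hx : x ∈ cone) (hz : z ∈ cone) (p : H3) :
    form x z ≤ 2 * (form x (hyp p) * form z (hyp p)) := by
  obtain ⟨m, hm⟩ := exists_lorentzPSL_base p
  have h := form_le (lorentzPSL_mem_cone m⁻¹ hx) (lorentzPSL_mem_cone m⁻¹ hz)
  rw [← form_base (lorentzPSL m⁻¹ x), ← form_base (lorentzPSL m⁻¹ z), form_lorentzPSL,
    form_lorentzPSL_left, form_lorentzPSL_left, inv_inv, hm] at h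
  exact h

lemma form_hyp_triangle (p q r : H3) :
    form (hyp p) (hyp r) ≤ 2 * (form (hyp p) (hyp q) * form (hyp q) (hyp r)) := by
  rw [form_comm (hyp q)]
  exact form_le_through_hyp (hyp_mem_cone p) (hyp_mem_cone r) q

lemma form_hyp_act3 (g : PSL2C) (p q : H3) :
    form (hyp (act3 g p)) (hyp (act3 g q)) = form (hyp p) (hyp q) := by
  rw [hyp_act3, hyp_act3, form_lorentzPSL]

lemma fst_hyp (p : H3) : (hyp p).1 = form (hyp p) (hyp origin) := by rw [hyp_origin, form_base]

lemma act3_mul (g h : PSL2C) (p : H3) : act3 (g * h) p = act3 g (act3 h p) :=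
  hyp_injective (by rw [hyp_act3, hyp_act3, hyp_act3, lorentzPSL_mul_apply])

end Mink

namespace Mink

open Matrix

/-! ### Discreteness -/

lemma isTopologicalGroup_SL2C : IsTopologicalGroup SL2C :=
  Matrix.SpecialLinearGroup.topologicalGroup

lemma isClosedEmbedding_SL2C :
    Topology.IsClosedEmbedding (fun g : SL2C => (g : Matrix (Fin 2) (Fin 2) ℂ)) := by
  have hcl : IsClosed {A : Matrix (Fin 2) (Fin 2) ℂ | A.det = 1} :=
    isClosed_eq (continuous_id.matrix_det) continuous_const
  exact hcl.isClosedEmbedding_subtypeVal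

lemma isCompact_fst_le (C : ℝ) : IsCompact {A : SL2C | (lorentz A.1 base).1 ≤ C} := by
  have hK : IsCompact {A : Matrix (Fin 2) (Fin 2) ℂ |
      ∀ i j, A i j ∈ Metric.closedBall (0 : ℂ) (2 * C + 1)} := by
    have := isCompact_univ_pi fun _ : Fin 2 => isCompact_univ_pi fun _ : Fin 2 =>
      isCompact_closedBall (0 : ℂ) (2 * C + 1)
    refine this.of_isClosed_subset ?_ fun A hA i _ j _ => hA i j
    simp only [Set.ofPred_forall]
    exact isClosed_iInter fun i => isClosed_iInter fun j =>
      Metric.isClosed_closedBall.preimage (continuous_id.matrix_elem i j)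
  refine (isClosedEmbedding_SL2C.isCompact_preimage hK).of_isClosed_subset ?_ fun A hA i j => ?_
  · simp only [fst_lorentz_base]
    refine isClosed_le ?_ continuous_const
    have hc : ∀ i j, Continuous fun A : SL2C => A.1 i j := fun i j =>
      isClosedEmbedding_SL2C.continuous.matrix_elem i j
    have h00 := hc 0 0
    have h01 := hc 0 1
    have h10 := hc 1 0
    have h11 := hc 1 1
    fun_prop
  · simp only [Set.mem_ofPred_eq, fst_lorentz_base] at hA
    rw [mem_closedBall_zero_iff]
    have h : ‖A.1 i j‖ ^ 2 ≤ 2 * C := by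
      fin_cases i <;> fin_cases j <;> simp only [Fin.zero_eta, Fin.mk_one, Fin.isValue] <;>
        nlinarith [sq_nonneg ‖A.1 0 0‖, sq_nonneg ‖A.1 0 1‖, sq_nonneg ‖A.1 1 0‖,
          sq_nonneg ‖A.1 1 1‖]
    nlinarith [sq_nonneg (‖A.1 i j‖ - 1)]

lemma finite_fst_le {Γ : Subgroup PSL2C} (hΓ : IsDiscreteSubgroup Γ) (C : ℝ) :
    {g : PSL2C | g ∈ Γ ∧ (lorentzPSL g base).1 ≤ C}.Finite := by
  have := isTopologicalGroup_SL2C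
  have : T2Space SL2C := isClosedEmbedding_SL2C.toIsEmbedding.t2Space
  have : IsClosed (Subgroup.center SL2C : Set SL2C) := by
    rw [← Subgroup.centralizer_univ]
    exact Set.isClosed_centralizer _
  have : T2Space PSL2C := inferInstance
  have hd : DiscreteTopology Γ := by
    refine discreteTopology_iff_isOpen_singleton.2 fun g => ?_
    obtain ⟨U, hU, hgU, h⟩ := hΓ g.1 g.2
    refine isOpen_induced_iff.2 ⟨U, hU, ?_⟩
    ext x
    exact ⟨fun hx => Subtype.ext (h x x.2 hx), fun hx => by
      rw [Set.mem_singleton_iff.1 hx]; exact hgU⟩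
  have hcl : IsClosed (Γ : Set PSL2C) := Subgroup.isClosed_of_discrete
  have hK := ((isCompact_fst_le C).image QuotientGroup.continuous_mk
    (Y := PSL2C)).inter_right hcl
  refine (hK.finite ?_).subset ?_
  · exact (isDiscrete_iff_discreteTopology.2 hd).mono Set.inter_subset_right
  · rintro g ⟨hg, hC⟩
    rw [lorentzPSL_out] at hC
    exact ⟨⟨g.out, hC, QuotientGroup.out_eq' g⟩, hg⟩

lemma finite_form_hyp_le {Γ : Subgroup PSL2C} (hΓ : IsDiscreteSubgroup Γ) (p : H3) (C : ℝ) :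
    {g : PSL2C | g ∈ Γ ∧ form (hyp (act3 g p)) (hyp p) ≤ C}.Finite := by
  refine (finite_fst_le hΓ (2 * ((hyp p).1 * (2 * (C * (hyp p).1))))).subset fun g hg => ⟨hg.1, ?_⟩
  rw [← hyp_origin, ← hyp_act3, fst_hyp]
  have h1 := form_hyp_triangle (act3 g origin) (act3 g p) origin
  have h2 := form_hyp_triangle (act3 g p) p origin
  rw [form_hyp_act3, form_comm (hyp origin) (hyp p), ← fst_hyp p, ← fst_hyp (act3 g p)] at h1
  rw [← fst_hyp p] at h2
  have h3 := fst_hyp_pos p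
  refine h1.trans ?_
  have h4 := hg.2
  have h5 := (fst_hyp_pos (act3 g p)).le
  rw [← fst_hyp] at h2
  gcongr
  refine h2.trans ?_
  gcongr

/-- The Lorentz action of a discrete group whose base point is `p`. -/
def lorentzAction {Γ : Subgroup PSL2C} (hΓ : IsDiscreteSubgroup Γ) {p : H3} {m : PSL2C}
    (hm : lorentzPSL m base = hyp p) (hfree : ∀ g ∈ Γ, g ≠ 1 → act3 g p ≠ p) :
    LorentzAction Γ where
  rep := lorentzPSL.comp ((MulAut.conj m⁻¹).toMonoidHom.comp Γ.subtype)
  form_rep _ _ _ := form_lorentzPSL _ _ _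
  rep_mem_cone _ _ hx := lorentzPSL_mem_cone _ hx
  proper C := by
    refine Set.Finite.subset ((finite_form_hyp_le hΓ p C).preimage
      (Subtype.val_injective.injOn)) fun g hg => ⟨g.2, ?_⟩
    refine le_of_eq_of_le ?_ hg
    change _ = (lorentzPSL (m⁻¹ * g * m⁻¹⁻¹) base).1
    rw [← form_base, inv_inv, mul_assoc, lorentzPSL_mul_apply, form_lorentzPSL_left, inv_inv,
      lorentzPSL_mul_apply, hm, hyp_act3]
  free g hg := by
    by_contra hne
    refine hfree g g.2 (fun h => hne (Subtype.ext h)) (hyp_injective ?_)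
    change lorentzPSL (m⁻¹ * g * m⁻¹⁻¹) base = base at hg
    rw [hyp_act3, ← hm, ← lorentzPSL_mul_apply]
    nth_rw 2 [← hg]
    rw [← lorentzPSL_mul_apply]
    congr 2
    group

section

variable {Γ : Subgroup PSL2C} (hΓ : IsDiscreteSubgroup Γ) {p : H3} {m : PSL2C}
  (hm : lorentzPSL m base = hyp p) (hfree : ∀ g ∈ Γ, g ≠ 1 → act3 g p ≠ p)

lemma orb_lorentzAction (g : Γ) :
    (lorentzAction hΓ hm hfree).orb g = lorentzPSL m⁻¹ (hyp (act3 g p)) := by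
  change lorentzPSL (m⁻¹ * g * m⁻¹⁻¹) base = _
  rw [hyp_act3, ← hm, ← lorentzPSL_mul_apply, ← lorentzPSL_mul_apply, inv_inv, mul_assoc]

lemma fst_orb_lorentzAction (g : Γ) :
    ((lorentzAction hΓ hm hfree).orb g).1 = form (hyp (act3 g p)) (hyp p) := by
  rw [← form_base, orb_lorentzAction, form_lorentzPSL_left, inv_inv, hm]

lemma form_orb_lorentzAction (g h : Γ) :
    form ((lorentzAction hΓ hm hfree).orb g) ((lorentzAction hΓ hm hfree).orb h) =
      form (hyp (act3 g p)) (hyp (act3 h p)) := by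
  rw [orb_lorentzAction, orb_lorentzAction, form_lorentzPSL]

lemma finite_nbrs_lorentzAction (hfin : Set.Finite {g : PSL2C | g ∈ Γ ∧ g ≠ 1 ∧
      ∃ x ∈ DirichletDomain Γ p, d3 x p = d3 x (act3 g p)}) :
    (lorentzAction hΓ hm hfree).nbrs.Finite := by
  refine Set.Finite.subset (hfin.preimage Subtype.val_injective.injOn) ?_
  rintro g ⟨hg1, x, hx, hxx, hmin, heq⟩
  refine ⟨g.2, fun h => hg1 (Subtype.ext h), ?_⟩
  have hs := Real.sqrt_pos.2 hxx
  set s := (Real.sqrt (form x x))⁻¹ with hsdef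
  have hs0 : 0 < s := inv_pos.2 hs
  obtain ⟨y, hy⟩ := exists_hyp_eq (v := lorentzPSL m (s • x))
    (lorentzPSL_mem_cone m (smul_mem_cone hs0.le hx)) (by
      rw [form_lorentzPSL, form_smul_left, form_smul_right, hsdef, ← mul_assoc, ← mul_inv,
        Real.mul_self_sqrt hxx.le, inv_mul_cancel₀ hxx.ne'])
  have hform : ∀ h : Γ, form (hyp y) (hyp (act3 h p)) =
      s * form x ((lorentzAction hΓ hm hfree).orb h) := fun h => by
    rw [hy, form_lorentzPSL_left, ← orb_lorentzAction hΓ hm hfree, form_smul_left]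
  have hbase : form (hyp y) (hyp p) = s * form x base := by
    rw [hy, form_lorentzPSL_left, ← hm, lorentzPSL_inv_apply, form_smul_left]
  refine ⟨y, fun h hh => ?_, ?_⟩
  · rw [d3_le_d3_iff, hbase, hform ⟨h, hh⟩]
    exact mul_le_mul_of_nonneg_left (hmin _) hs0.le
  · rw [d3_eq, d3_eq, hbase, hform g, heq]

end

/-- Word geodesics far from the identity have endpoints that are close on the sphere at infinity. -/
lemma exists_form_orbit_lt {Γ : Subgroup PSL2C} (hΓ : IsDiscreteSubgroup Γ)
    (hGF : IsGeometricallyFinite Γ) (O : H3) {S : Set Γ} (hS : S.Finite)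
    {len : Γ → ℕ} (hmul : ∀ g h, len (g * h) ≤ len g + len h) (hinv : ∀ g, len g⁻¹ = len g)
    {ε : ℝ} (hε : 0 < ε) :
    ∃ R : ℕ, ∀ (m : ℕ) (w : ℕ → Γ), (∀ i < m, (w i)⁻¹ * w (i + 1) ∈ S) →
      (∀ i ≤ m, ∀ j ≤ m, i ≤ j → j - i ≤ len ((w i)⁻¹ * w j)) → (∀ i ≤ m, R ≤ len (w i)) →
      form (hyp (act3 (w 0) O)) (hyp (act3 (w m) O)) <
        ε * ((hyp (act3 (w 0) O)).1 * (hyp (act3 (w m) O)).1) := by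
  obtain ⟨p, hfree, hfin⟩ := hGF
  obtain ⟨c, hc⟩ := exists_lorentzPSL_base p
  set D := form (hyp O) (hyp p) with hD
  have hD1 : 1 ≤ D := one_le_form_hyp O p
  have hp := fst_hyp_pos p
  set E := 2 * (D * (2 * (2 * (2 * (D * (hyp p).1)) * (2 * (2 * (D * (hyp p).1))) * D))) with hE
  have hE0 : 0 < E := by positivity
  obtain ⟨R, hR⟩ := (lorentzAction hΓ hc hfree).exists_form_lt_of_far_geodesic
    (finite_nbrs_lorentzAction hΓ hc hfree hfin) hS hmul hinv (div_pos hε hE0)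
  refine ⟨R, fun m w h1 h2 h3 => ?_⟩
  have h := hR m w h1 h2 h3
  rw [form_orb_lorentzAction, fst_orb_lorentzAction, fst_orb_lorentzAction] at h
  have hfst : ∀ g : PSL2C, form (hyp (act3 g p)) (hyp p) ≤
      2 * (2 * (D * (hyp p).1)) * (hyp (act3 g O)).1 := fun g => by
    have e1 := form_hyp_triangle (act3 g p) origin p
    have e2 := form_hyp_triangle (act3 g p) (act3 g O) origin
    rw [form_hyp_act3, form_comm (hyp p) (hyp O), ← hD, ← fst_hyp (act3 g O), ← fst_hyp] at e2
    rw [← fst_hyp, form_comm (hyp origin), ← fst_hyp] at e1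
    refine e1.trans ?_
    calc 2 * ((hyp (act3 g p)).1 * (hyp p).1)
        ≤ 2 * (2 * (D * (hyp (act3 g O)).1) * (hyp p).1) := by gcongr
      _ = _ := by ring
  have ha := fst_hyp_pos (act3 (w 0) O)
  have hb := fst_hyp_pos (act3 (w m) O)
  have t1 := form_hyp_triangle (act3 (w 0) O) (act3 (w 0) p) (act3 (w m) O)
  have t2 := form_hyp_triangle (act3 (w 0) p) (act3 (w m) p) (act3 (w m) O)
  rw [form_hyp_act3, ← hD] at t1
  rw [form_hyp_act3, form_comm (hyp p), ← hD] at t2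
  have f0 := hfst (w 0)
  have fm := hfst (w m)
  have n0 := zero_le_one.trans (one_le_form_hyp (act3 (w m) p) p)
  set a := (hyp (act3 (w 0) O)).1
  set b := (hyp (act3 (w m) O)).1
  set k := 2 * (2 * (D * (hyp p).1)) with hk
  calc form (hyp (act3 (w 0) O)) (hyp (act3 (w m) O))
      ≤ 2 * (D * (2 * (form (hyp (act3 (w 0) p)) (hyp (act3 (w m) p)) * D))) :=
        t1.trans (by gcongr)
    _ < 2 * (D * (2 * (ε / E * (form (hyp (act3 (w 0) p)) (hyp p) *
          form (hyp (act3 (w m) p)) (hyp p)) * D))) := by gcongr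
    _ ≤ 2 * (D * (2 * (ε / E * ((k * a) * (k * b)) * D))) := by gcongr
    _ = (ε / E * E) * (a * b) := by rw [hE]; ring
    _ = ε * (a * b) := by rw [div_mul_cancel₀ _ hE0.ne']

end Mink

namespace Mink

open Matrix Filter

/-! ### The sphere at infinity in the projective model -/

lemma klein_smul {r : ℝ} (hr : r ≠ 0) (x : Mink) : klein (r • x) = klein x := by
  rw [klein, klein, Prod.smul_fst, Prod.smul_snd, smul_eq_mul, smul_smul, _root_.mul_inv_rev,
    mul_assoc, inv_mul_cancel₀ hr, mul_one]

lemma form_self_eq_klein {x : Mink} (hx : x.1 ≠ 0) :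
    form x x = x.1 ^ 2 * (1 - ‖klein x‖ ^ 2) := by
  rw [form_eq_klein hx hx, real_inner_self_eq_norm_sq, sq x.1]

/-- The ideal point `ξ` as a unit vector. -/
def kb (ξ : OnePoint ℂ) : EuclideanSpace ℝ (Fin 3) := klein (nul ξ)

lemma norm_kb (ξ : OnePoint ℂ) : ‖kb ξ‖ = 1 := by
  have h := form_self_eq_klein (fst_nul_pos ξ).ne'
  rw [form_nul_self, eq_comm, mul_eq_zero, or_iff_right (pow_pos (fst_nul_pos ξ) 2).ne'] at h
  rw [← sq_eq_sq₀ (norm_nonneg _) zero_le_one, kb]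
  linarith

lemma kb_injective : Function.Injective kb := fun ξ ζ h => by
  refine eq_of_form_nul ?_
  have h1 : klein (nul ξ) = klein (nul ζ) := h
  rw [form_eq_klein (fst_nul_pos ξ).ne' (fst_nul_pos ζ).ne', h1, real_inner_self_eq_norm_sq,
    show ‖klein (nul ζ)‖ = 1 from norm_kb ζ]
  ring

lemma exists_kb_eq {u : EuclideanSpace ℝ (Fin 3)} (hu : ‖u‖ = 1) : ∃ ξ, kb ξ = u := by
  have hcone : ((1, u) : Mink) ∈ cone := le_of_eq hu
  obtain ⟨ξ, r, hr, h⟩ := exists_eq_smul_nul hcone (fun h => one_ne_zero (congrArg Prod.fst h))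
    (by rw [form_self, hu]; norm_num)
  refine ⟨ξ, ?_⟩
  rw [kb, ← klein_smul hr.ne', ← h, klein, inv_one, one_smul]

lemma kb_actS (q : PSL2C) (ξ : OnePoint ℂ) : kb (actS q ξ) = klein (lorentzPSL q (nul ξ)) := by
  obtain ⟨r, hr, h⟩ := lorentzPSL_nul q ξ
  rw [h, klein_smul hr.ne', kb]

lemma one_le_fst_hyp (p : H3) : 1 ≤ (hyp p).1 := by
  rw [fst_hyp]; exact one_le_form_hyp p origin

lemma norm_klein_hyp_sq (p : H3) : ‖klein (hyp p)‖ ^ 2 = 1 - ((hyp p).1 ^ 2)⁻¹ := by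
  have hp := fst_hyp_pos p
  have h := form_self_eq_klein hp.ne'
  rw [form_hyp_self] at h
  field_simp
  linarith

section compactification

/-- The stereographic embedding of `ℍ³ ∪ Ĉ` into the closed unit ball. -/
def stereo (x : OnePoint (ℂ × ℝ)) : EuclideanSpace ℝ (Fin 3) :=
  Option.elim x !₂[0, 0, 1] fun p =>
    !₂[2 * p.1.re / (‖p.1‖ ^ 2 + p.2 ^ 2 + 1), 2 * p.1.im / (‖p.1‖ ^ 2 + p.2 ^ 2 + 1),
      (‖p.1‖ ^ 2 + p.2 ^ 2 - 1) / (‖p.1‖ ^ 2 + p.2 ^ 2 + 1)]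

lemma stereo_coe (p : ℂ × ℝ) : stereo (p : OnePoint (ℂ × ℝ)) =
    !₂[2 * p.1.re / (‖p.1‖ ^ 2 + p.2 ^ 2 + 1), 2 * p.1.im / (‖p.1‖ ^ 2 + p.2 ^ 2 + 1),
      (‖p.1‖ ^ 2 + p.2 ^ 2 - 1) / (‖p.1‖ ^ 2 + p.2 ^ 2 + 1)] := rfl

lemma stereo_infty : stereo ∞ = !₂[0, 0, 1] := rfl

lemma stereo_iH3 (p : H3) : stereo (iH3 p) = klein (hyp p) := by
  obtain ⟨⟨z, t⟩, ht⟩ := p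
  simp only at ht
  have h : 0 < ‖z‖ ^ 2 + t ^ 2 + 1 := by positivity
  rw [iH3, stereo_coe, klein, hyp]
  ext i
  fin_cases i <;> simp <;> field_simp

lemma stereo_iBd (ξ : OnePoint ℂ) : stereo (iBd ξ) = kb ξ := by
  induction ξ using OnePoint.rec with
  | infty =>
    rw [show iBd ∞ = ∞ from rfl, stereo_infty, kb, klein, nul, nulv_coord, lift_infty]
    ext i
    fin_cases i <;> simp
  | coe z =>
    have h : 0 < ‖z‖ ^ 2 + 1 := by positivity
    rw [show iBd (z : OnePoint ℂ) = (((z, (0 : ℝ)) : ℂ × ℝ) : OnePoint (ℂ × ℝ)) from rfl,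
      stereo_coe, kb, klein, nul, nulv_coord, lift_coe]
    ext i
    fin_cases i <;> simp <;> field_simp

lemma continuous_stereo : Continuous stereo := by
  rw [OnePoint.continuous_iff, coclosedCompact_eq_cocompact]
  constructor
  · rw [tendsto_iff_norm_sub_tendsto_zero]
    refine squeeze_zero' (g := fun p : ℂ × ℝ => 2 / ‖p‖)
      (Eventually.of_forall fun _ => norm_nonneg _) ?_
      ((tendsto_norm_cocompact_atTop (E := ℂ × ℝ)).const_div_atTop 2)
    filter_upwards [(tendsto_norm_cocompact_atTop (E := ℂ × ℝ)).eventually_gt_atTop 0] with p hp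
    have hn : ‖p‖ ^ 2 ≤ ‖p.1‖ ^ 2 + p.2 ^ 2 := by
      rw [Prod.norm_def]
      rcases max_cases ‖p.1‖ ‖p.2‖ with h | h <;> rw [h.1]
      · nlinarith [sq_nonneg p.2]
      · rw [Real.norm_eq_abs, sq_abs]
        nlinarith [sq_nonneg ‖p.1‖]
    have hz : ‖p.1‖ ^ 2 = p.1.re ^ 2 + p.1.im ^ 2 := by
      rw [← Complex.normSq_eq_norm_sq, Complex.normSq_apply]; ring
    have hd : 0 < ‖p.1‖ ^ 2 + p.2 ^ 2 + 1 := by positivity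
    refine abs_le_of_sq_le_sq' ?_ (by positivity) |>.2
    rw [EuclideanSpace.norm_sq_eq, Fin.sum_univ_three, stereo_coe, stereo_infty]
    simp only [PiLp.sub_apply, cons_val, Real.norm_eq_abs, sq_abs, sub_zero, div_pow]
    have : (2 * p.1.re) ^ 2 / (‖p.1‖ ^ 2 + p.2 ^ 2 + 1) ^ 2 +
        (2 * p.1.im) ^ 2 / (‖p.1‖ ^ 2 + p.2 ^ 2 + 1) ^ 2 +
        ((‖p.1‖ ^ 2 + p.2 ^ 2 - 1) / (‖p.1‖ ^ 2 + p.2 ^ 2 + 1) - 1) ^ 2 =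
        4 * (‖p.1‖ ^ 2 + 1) / (‖p.1‖ ^ 2 + p.2 ^ 2 + 1) ^ 2 := by
      field_simp
      rw [hz]
      ring
    rw [this, div_le_div_iff₀ (by positivity) (by positivity)]
    nlinarith [sq_nonneg p.2, sq_nonneg ‖p.1‖, sq_nonneg ‖p‖]
  · simp only [stereo_coe]
    have hd : ∀ p : ℂ × ℝ, ‖p.1‖ ^ 2 + p.2 ^ 2 + 1 ≠ 0 := fun p => by positivity
    refine (PiLp.continuous_toLp 2 _).comp (continuous_pi fun i => ?_)
    fin_cases i <;> simp <;> fun_prop (disch := exact hd _)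

lemma continuous_iBd : Continuous iBd := by
  rw [OnePoint.continuous_iff]
  have hemb : Topology.IsClosedEmbedding fun z : ℂ => (z, (0 : ℝ)) := by
    refine Topology.IsClosedEmbedding.of_continuous_injective_isClosedMap (by fun_prop)
      (fun a b h => congrArg Prod.fst h) ?_
    have : IsClosed ({(0 : ℝ)} : Set ℝ) := isClosed_singleton
    intro s hs
    convert hs.prod this using 1
    ext ⟨a, b⟩
    simp [eq_comm]
  refine ⟨?_, OnePoint.continuous_coe.comp hemb.continuous⟩
  rw [coclosedCompact_eq_cocompact]
  refine OnePoint.tendsto_coe_infty.comp (?_ : Tendsto (fun z : ℂ => (z, (0 : ℝ))) _ _)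
  rw [coclosedCompact_eq_cocompact]
  exact hemb.tendsto_cocompact

lemma isEmbedding_kb : Topology.IsEmbedding kb := by
  have hc : Continuous kb := by
    have : kb = stereo ∘ iBd := funext fun ξ => (stereo_iBd ξ).symm
    rw [this]
    exact continuous_stereo.comp continuous_iBd
  exact (hc.isClosedEmbedding kb_injective).isEmbedding

lemma mem_limitSet_iff {Γ : Subgroup PSL2C} {O : H3} {ξ : OnePoint ℂ} :
    ξ ∈ limitSet Γ O ↔ kb ξ ∈ closure ((fun g => klein (hyp (act3 g O))) '' (Γ : Set PSL2C)) := by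
  have himg : stereo '' (iH3 '' ((fun g => act3 g O) '' (Γ : Set PSL2C))) =
      (fun g => klein (hyp (act3 g O))) '' (Γ : Set PSL2C) := by
    simp only [Set.image_image, stereo_iH3]
  rw [limitSet, Set.mem_ofPred_eq, ← himg,
    (continuous_stereo.isClosedMap).closure_image_eq_of_continuous continuous_stereo]
  refine ⟨fun h => ⟨_, h, stereo_iBd ξ⟩, ?_⟩
  rintro ⟨y, hy, hyξ⟩
  suffices h : y = iBd ξ by rwa [← h]
  induction y using OnePoint.rec with
  | infty =>
    rw [show (∞ : OnePoint (ℂ × ℝ)) = iBd ∞ from rfl] at hyξ ⊢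
    rw [stereo_iBd] at hyξ
    rw [kb_injective hyξ]
  | coe p =>
    obtain ⟨z, t⟩ := p
    have ht : 0 ≤ t := by
      by_contra! hneg
      have hopen : IsOpen ((fun p : ℂ × ℝ => (p : OnePoint (ℂ × ℝ))) '' {p | p.2 < 0}) :=
        OnePoint.isOpenMap_coe _ (isOpen_lt continuous_snd continuous_const)
      obtain ⟨x, ⟨p, hp, hpx⟩, q, -, hqx⟩ := mem_closure_iff.1 hy _ hopen ⟨(z, t), hneg, rfl⟩
      rw [← hqx] at hpx
      have : p = q.1 := OnePoint.coe_injective hpx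
      have h2 := q.2
      rw [← this] at h2
      exact absurd hp (not_lt.2 h2.le)
    rcases ht.eq_or_lt with rfl | ht
    · rw [show (((z, (0 : ℝ)) : ℂ × ℝ) : OnePoint (ℂ × ℝ)) = iBd (z : OnePoint ℂ) from rfl] at hyξ ⊢
      rw [stereo_iBd] at hyξ
      rw [kb_injective hyξ]
    · have h1 := norm_klein_hyp_sq ⟨(z, t), ht⟩
      rw [← stereo_iH3, show stereo (iH3 ⟨(z, t), ht⟩) = kb ξ from hyξ, norm_kb] at h1
      have h2 := inv_pos.2 (pow_pos (fst_hyp_pos ⟨(z, t), ht⟩) 2)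
      linarith

end compactification

end Mink

namespace Mink

open Matrix Filter

/-! ### Dynamics at infinity -/

section dynamics

variable {ι : Type*} {l : Filter ι}

lemma tendsto_fst_hyp_atTop {p : ι → H3} {u : EuclideanSpace ℝ (Fin 3)} (hu : ‖u‖ = 1)
    (h : Tendsto (fun i => klein (hyp (p i))) l (𝓝 u)) :
    Tendsto (fun i => (hyp (p i)).1) l atTop := by
  have h1 : Tendsto (fun i => ((hyp (p i)).1 ^ 2)⁻¹) l (𝓝 0) := by
    have := (h.norm.pow 2).const_sub 1
    simp only [norm_klein_hyp_sq, sub_sub_cancel, hu] at this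
    simpa using this
  have h2 : Tendsto (fun i => (hyp (p i)).1 ^ 2) l atTop := by
    have := (tendsto_nhdsWithin_iff.2 ⟨h1, Eventually.of_forall fun i =>
      inv_pos.2 (pow_pos (fst_hyp_pos (p i)) 2)⟩).inv_tendsto_nhdsGT_zero
    simpa [Pi.inv_def] using this
  have h3 := Real.tendsto_sqrt_atTop.comp h2
  refine h3.congr fun i => ?_
  rw [Function.comp_apply, Real.sqrt_sq (fst_hyp_pos (p i)).le]

lemma norm_eq_one_of_tendsto [l.NeBot] {p : ι → H3} {u : EuclideanSpace ℝ (Fin 3)}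
    (hfst : Tendsto (fun i => (hyp (p i)).1) l atTop)
    (h : Tendsto (fun i => klein (hyp (p i))) l (𝓝 u)) : ‖u‖ = 1 := by
  have h1 := h.norm.pow 2
  simp only [norm_klein_hyp_sq] at h1
  have h2 : Tendsto (fun i => 1 - ((hyp (p i)).1 ^ 2)⁻¹) l (𝓝 (1 - 0)) :=
    ((tendsto_inv_atTop_zero.comp ((tendsto_pow_atTop two_ne_zero).comp hfst))).const_sub 1
  have h3 := tendsto_nhds_unique h1 h2
  rw [← sq_eq_sq₀ (norm_nonneg _) zero_le_one, h3]
  norm_num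

lemma mem_limitSet_of_tendsto [l.NeBot] {Γ : Subgroup PSL2C} {O : H3} {g : ι → PSL2C}
    (hg : ∀ i, g i ∈ Γ) {ξ : OnePoint ℂ}
    (h : Tendsto (fun i => klein (hyp (act3 (g i) O))) l (𝓝 (kb ξ))) : ξ ∈ limitSet Γ O :=
  mem_limitSet_iff.2 (mem_closure_of_tendsto h (Eventually.of_forall fun i => ⟨g i, hg i, rfl⟩))

lemma exists_tendsto_of_mem_limitSet {Γ : Subgroup PSL2C} {O : H3} {ξ : OnePoint ℂ}
    (hξ : ξ ∈ limitSet Γ O) : ∃ g : ℕ → PSL2C, (∀ n, g n ∈ Γ) ∧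
      Tendsto (fun n => klein (hyp (act3 (g n) O))) atTop (𝓝 (kb ξ)) := by
  obtain ⟨x, hx, hlim⟩ := mem_closure_iff_seq_limit.1 (mem_limitSet_iff.1 hξ)
  choose g hg hgx using hx
  exact ⟨g, hg, by simpa only [hgx] using hlim⟩

lemma tendsto_of_norm_sub_sq_le {E : Type*} [NormedAddCommGroup E] {a b : ι → E} {u : E}
    {e : ι → ℝ} (ha : Tendsto a l (𝓝 u)) (he : Tendsto e l (𝓝 0))
    (h : ∀ᶠ i in l, ‖b i - a i‖ ^ 2 ≤ e i) : Tendsto b l (𝓝 u) := by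
  have h1 : Tendsto (fun i => b i - a i) l (𝓝 0) := by
    rw [tendsto_zero_iff_norm_tendsto_zero]
    have h2 : Tendsto (fun i => Real.sqrt (e i)) l (𝓝 0) := by
      simpa using he.sqrt
    refine squeeze_zero' (Eventually.of_forall fun _ => norm_nonneg _) ?_ h2
    filter_upwards [h] with i hi
    exact Real.le_sqrt_of_sq_le hi
  simpa using h1.add ha

lemma norm_klein_sub_sq_le {x y : Mink} (hx : x ∈ cone) (hy : y ∈ cone) (hx0 : 0 < x.1)
    (hy0 : 0 < y.1) : ‖klein x - klein y‖ ^ 2 ≤ 2 * (form x y / (x.1 * y.1)) := by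
  have h := norm_sub_sq_le (norm_klein_le hx) (norm_klein_le hy)
  rw [form_eq_klein hx0.ne' hy0.ne', mul_div_cancel_left₀ _ (mul_pos hx0 hy0).ne']
  exact h

lemma fst_pos_lorentzPSL_nul (q : PSL2C) (ξ : OnePoint ℂ) : 0 < (lorentzPSL q (nul ξ)).1 := by
  obtain ⟨r, hr, h⟩ := lorentzPSL_nul q ξ
  rw [h]
  exact mul_pos hr (fst_nul_pos _)

/-- The convergence property of sequences of Möbius transformations. -/
lemma tendsto_kb_actS {O : H3} {g : ι → PSL2C} {ξ ζ e : OnePoint ℂ}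
    (hg : Tendsto (fun i => klein (hyp (act3 (g i) O))) l (𝓝 (kb ξ)))
    (hg' : Tendsto (fun i => klein (hyp (act3 (g i)⁻¹ O))) l (𝓝 (kb ζ))) (he : e ≠ ζ) :
    Tendsto (fun i => kb (actS (g i) e)) l (𝓝 (kb ξ)) := by
  have hfst := tendsto_fst_hyp_atTop (norm_kb ξ) hg
  set d := ‖kb e - kb ζ‖ with hd
  have hd0 : 0 < d := norm_pos_iff.2 (sub_ne_zero.2 fun h => he (kb_injective h))
  set c := form (nul e) (hyp O) with hc
  have hc0 : 0 ≤ c := form_nonneg (nul_mem_cone e) (hyp_mem_cone O)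
  have hn := fst_nul_pos e
  have hO := fst_hyp_pos O
  set δ := (nul e).1 * ((d / 2) ^ 2 / 2) / (2 * (hyp O).1) with hδ
  have hδ0 : 0 < δ := by positivity
  refine tendsto_of_norm_sub_sq_le hg (e := fun i => 2 * (c / δ / (hyp (act3 (g i) O)).1)) ?_ ?_
  · simpa using (hfst.const_div_atTop (c / δ)).const_mul 2
  have hev : ∀ᶠ i in l, d / 2 < ‖kb e - klein (hyp (act3 (g i)⁻¹ O))‖ :=
    (hg'.const_sub (kb e)).norm.eventually_const_lt (half_lt_self hd0)
  filter_upwards [hev] with i hi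
  have hx0 := fst_pos_lorentzPSL_nul (g i) e
  have hy0 := fst_hyp_pos (act3 (g i) O)
  have hxδ : δ ≤ (lorentzPSL (g i) (nul e)).1 := by
    have e1 : form (nul e) (hyp (act3 (g i)⁻¹ O)) = form (lorentzPSL (g i) (nul e)) (hyp O) := by
      rw [form_lorentzPSL_left, hyp_act3]
    have e2 := form_le (lorentzPSL_mem_cone (g i) (nul_mem_cone e)) (hyp_mem_cone O)
    rw [← e1, form_eq_klein hn.ne' (fst_hyp_pos _).ne'] at e2
    have e3 := norm_sub_sq_le (norm_klein_le (nul_mem_cone e))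
      (norm_klein_le (hyp_mem_cone (act3 (g i)⁻¹ O)))
    have e4 : (d / 2) ^ 2 ≤ ‖kb e - klein (hyp (act3 (g i)⁻¹ O))‖ ^ 2 := by gcongr
    have e5 := one_le_fst_hyp (act3 (g i)⁻¹ O)
    rw [hδ, div_le_iff₀ (by positivity)]
    calc (nul e).1 * ((d / 2) ^ 2 / 2)
        ≤ (nul e).1 * (hyp (act3 (g i)⁻¹ O)).1 *
          (1 - inner ℝ (klein (nul e)) (klein (hyp (act3 (g i)⁻¹ O)))) := by
          have e6 : (d / 2) ^ 2 / 2 ≤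
            1 - inner ℝ (klein (nul e)) (klein (hyp (act3 (g i)⁻¹ O))) := by
            have : kb e = klein (nul e) := rfl
            rw [this] at e4
            linarith
          have e7 : (nul e).1 ≤ (nul e).1 * (hyp (act3 (g i)⁻¹ O)).1 :=
            le_mul_of_one_le_right hn.le e5
          exact mul_le_mul e7 e6 (by positivity) (by positivity)
      _ ≤ _ := e2
      _ = _ := by ring
  rw [kb_actS]
  refine (norm_klein_sub_sq_le (lorentzPSL_mem_cone _ (nul_mem_cone e)) (hyp_mem_cone _) hx0
    hy0).trans ?_
  rw [hyp_act3, form_lorentzPSL, ← hyp_act3, ← hc, div_div]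
  gcongr

lemma tendsto_klein_lorentzPSL (q : PSL2C) {p : ι → H3} {ξ : OnePoint ℂ}
    (h : Tendsto (fun i => klein (hyp (p i))) l (𝓝 (kb ξ))) :
    Tendsto (fun i => klein (hyp (act3 q (p i)))) l (𝓝 (kb (actS q ξ))) := by
  have hk : ∀ x : Mink, 0 < x.1 →
      klein (lorentzPSL q x) = klein (lorentzPSL q ((1, klein x) : Mink)) := fun x hx => by
    have : ((1, klein x) : Mink) = x.1⁻¹ • x :=
      Prod.ext (by simp [hx.ne']) rfl
    rw [this, LinearMap.map_smul, klein_smul (inv_pos.2 hx).ne']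
  have hcont : Continuous (lorentzPSL q) := LinearMap.continuous_of_finiteDimensional _
  have h1 : Tendsto (fun i => lorentzPSL q ((1, klein (hyp (p i))) : Mink)) l
      (𝓝 (lorentzPSL q ((1, kb ξ) : Mink))) :=
    (hcont.tendsto _).comp (tendsto_const_nhds.prodMk_nhds h)
  have hpos : (lorentzPSL q ((1, kb ξ) : Mink)).1 ≠ 0 := by
    have : ((1, kb ξ) : Mink) = (nul ξ).1⁻¹ • nul ξ :=
      Prod.ext (by simp [(fst_nul_pos ξ).ne']) rfl
    rw [this, LinearMap.map_smul]
    exact (mul_pos (inv_pos.2 (fst_nul_pos ξ)) (fst_pos_lorentzPSL_nul q ξ)).ne'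
  rw [kb_actS, hk _ (fst_nul_pos ξ)]
  simp only [hyp_act3, hk _ (fst_hyp_pos _)]
  have h2 := (continuous_fst.tendsto _).comp h1
  have h3 := (continuous_snd.tendsto _).comp h1
  exact (h2.inv₀ hpos).smul h3

lemma actS_mem_limitSet {Γ : Subgroup PSL2C} {O : H3} {q : PSL2C} (hq : q ∈ Γ) {ξ : OnePoint ℂ}
    (hξ : ξ ∈ limitSet Γ O) : actS q ξ ∈ limitSet Γ O := by
  obtain ⟨g, hg, hlim⟩ := exists_tendsto_of_mem_limitSet hξ
  refine mem_limitSet_of_tendsto (g := fun n => q * g n) (fun n => Γ.mul_mem hq (hg n))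
    (l := atTop) ?_
  simpa only [act3_mul] using tendsto_klein_lorentzPSL q hlim

/-- An ultrafilter on elements going to infinity has a limit on the sphere at infinity. -/
lemma exists_tendsto_kb (U : Ultrafilter ι) {p : ι → H3}
    (h : Tendsto (fun i => (hyp (p i)).1) U atTop) :
    ∃ ξ, Tendsto (fun i => klein (hyp (p i))) U (𝓝 (kb ξ)) := by
  have hmem : ∀ᶠ i in (U : Filter ι),
      klein (hyp (p i)) ∈ Metric.closedBall (0 : EuclideanSpace ℝ (Fin 3)) 1 :=
    Eventually.of_forall fun i => by
      rw [mem_closedBall_zero_iff]; exact norm_klein_le (hyp_mem_cone _)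
  obtain ⟨u, -, hu⟩ := (isCompact_closedBall (0 : EuclideanSpace ℝ (Fin 3)) 1).ultrafilter_le_nhds
    (U.map fun i => klein (hyp (p i))) (by rw [le_principal_iff]; exact hmem)
  obtain ⟨ξ, rfl⟩ := exists_kb_eq (norm_eq_one_of_tendsto h hu)
  exact ⟨ξ, hu⟩

lemma fst_hyp_inv_le (O : H3) (g : PSL2C) :
    (hyp (act3 g O)).1 ≤ 4 * (hyp O).1 ^ 2 * (hyp (act3 g⁻¹ O)).1 := by
  have h1 := form_hyp_triangle (act3 g O) O origin
  have h2 := form_le (hyp_mem_cone (act3 g⁻¹ O)) (hyp_mem_cone O)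
  rw [hyp_act3 g⁻¹, form_comm, ← form_lorentzPSL g, ← lorentzPSL_mul_apply, mul_inv_cancel,
    ← hyp_act3, map_one, Module.End.one_apply, ← hyp_act3] at h2
  have hO := fst_hyp_pos O
  rw [← fst_hyp, ← fst_hyp] at h1
  calc (hyp (act3 g O)).1 ≤ _ := h1
    _ ≤ 2 * (2 * ((hyp (act3 g⁻¹ O)).1 * (hyp O).1) * (hyp O).1) := by gcongr
    _ = _ := by ring

lemma tendsto_fst_hyp_inv {O : H3} {g : ι → PSL2C}
    (h : Tendsto (fun i => (hyp (act3 (g i) O)).1) l atTop) :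
    Tendsto (fun i => (hyp (act3 (g i)⁻¹ O)).1) l atTop := by
  have hO := fst_hyp_pos O
  exact (tendsto_const_mul_atTop_of_pos (r := 4 * (hyp O).1 ^ 2) (by positivity)).1
    (tendsto_atTop_mono (fun i => fst_hyp_inv_le O (g i)) h)

end dynamics

end Mink

namespace Mink

open Matrix Filter

/-! ### Discrete groups with a fixed point at infinity -/

/-- If the product of the horofunctions of two ideal points is bounded on an orbit, the limit set
consists of at most these two points. -/
lemma limitSet_subset_pair {Γ : Subgroup PSL2C} {O : H3} {a b : OnePoint ℂ} {C : ℝ}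
    (h : ∀ g ∈ Γ, form (nul a) (hyp (act3 g O)) * form (nul b) (hyp (act3 g O)) ≤ C) :
    limitSet Γ O ⊆ {a, b} := fun η hη => by
  obtain ⟨g, hg, hlim⟩ := exists_tendsto_of_mem_limitSet hη
  have hfst := tendsto_fst_hyp_atTop (norm_kb η) hlim
  have ha := fst_nul_pos a
  have hb := fst_nul_pos b
  have hlim2 : ∀ c : OnePoint ℂ, Tendsto
      (fun n => 1 - inner ℝ (kb c) (klein (hyp (act3 (g n) O)))) atTop
      (𝓝 (1 - inner ℝ (kb c) (kb η))) := fun c =>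
    (tendsto_const_nhds.inner hlim).const_sub 1
  have hbound : ∀ n, (1 - inner ℝ (kb a) (klein (hyp (act3 (g n) O)))) *
      (1 - inner ℝ (kb b) (klein (hyp (act3 (g n) O)))) ≤
      C / ((nul a).1 * (nul b).1) / (hyp (act3 (g n) O)).1 ^ 2 := fun n => by
    have hy := fst_hyp_pos (act3 (g n) O)
    have h1 := h (g n) (hg n)
    rw [form_eq_klein ha.ne' hy.ne', form_eq_klein hb.ne' hy.ne'] at h1
    rw [div_div, le_div_iff₀ (by positivity)]
    refine le_of_eq_of_le ?_ h1
    simp only [kb]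
    ring
  have hle := le_of_tendsto_of_tendsto' ((hlim2 a).mul (hlim2 b))
    ((((tendsto_pow_atTop two_ne_zero).comp hfst)).const_div_atTop (C / ((nul a).1 * (nul b).1)))
    hbound
  have hsq : ∀ c : OnePoint ℂ, ‖kb c - kb η‖ ^ 2 ≤ 2 * (1 - inner ℝ (kb c) (kb η)) := fun c =>
    norm_sub_sq_le (norm_kb c).le (norm_kb η).le
  by_contra hne
  simp only [Set.mem_insert_iff, Set.mem_singleton_iff, not_or] at hne
  have hpos : ∀ c : OnePoint ℂ, η ≠ c → 0 < 1 - inner ℝ (kb c) (kb η) := fun c hc => by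
    have h1 : 0 < ‖kb c - kb η‖ :=
      norm_pos_iff.2 (sub_ne_zero.2 fun h => hc (kb_injective h).symm)
    have := hsq c
    have := pow_pos h1 2
    linarith
  exact absurd hle (not_le.2 (mul_pos (hpos a hne.1) (hpos b hne.2)))

/-- A transformation that scales one null line nontrivially has a second invariant null line. -/
lemma exists_second_fixed {g : PSL2C} {f : OnePoint ℂ} (hf : actS g f = f) {r : ℝ}
    (hr : lorentzPSL g (nul f) = r • nul f) :
    ∃ f', lorentzPSL g (nul f') = r⁻¹ • nul f' := by
  set A := g.out with hA
  obtain ⟨α, hα, hAf⟩ := lorentz_nul A f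
  rw [show mobiusSL A f = f from hf] at hAf
  have hrα : r = ‖α‖ ^ 2 := by
    have h1 : lorentzPSL g (nul f) = ‖α‖ ^ 2 • nul f := by
      rw [lorentzPSL_out, ← hA, nul, ← nulv_smul, ← hAf]
      exact lorentz_nulv _ _
    rw [hr] at h1
    exact smul_left_injective ℝ (fun h => (fst_nul_pos f).ne' (congrArg Prod.fst h)) h1
  have hdet := A.2
  have hchar : ∀ x : ℂ, (A.1 - x • (1 : Matrix (Fin 2) (Fin 2) ℂ)).det =
      x ^ 2 - (A.1 0 0 + A.1 1 1) * x + 1 := fun x => by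
    rw [det_fin_two] at hdet ⊢
    simp only [Matrix.sub_apply, Matrix.smul_apply, one_apply_eq, smul_eq_mul, mul_one, ne_eq,
      zero_ne_one,
      one_ne_zero, not_false_eq_true, one_apply_ne, mul_zero, sub_zero]
    linear_combination hdet
  have hα0 : (A.1 - α • (1 : Matrix (Fin 2) (Fin 2) ℂ)).det = 0 :=
    exists_mulVec_eq_zero_iff.1 ⟨lift f, lift_ne_zero f, by
      rw [sub_mulVec, hAf, smul_mulVec, one_mulVec, sub_self]⟩
  have hβ0 : (A.1 - α⁻¹ • (1 : Matrix (Fin 2) (Fin 2) ℂ)).det = 0 := by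
    rw [hchar] at hα0 ⊢
    field_simp
    linear_combination hα0
  obtain ⟨v, hv, hAv⟩ := exists_mulVec_eq_zero_iff.2 hβ0
  rw [sub_mulVec, smul_mulVec, one_mulVec, sub_eq_zero] at hAv
  obtain ⟨f', s, hs, hf'⟩ := exists_nulv_eq_smul hv
  refine ⟨f', ?_⟩
  have h2 : lorentzPSL g (nulv v) = r⁻¹ • nulv v := by
    rw [hrα, ← inv_pow, ← norm_inv, ← nulv_smul, ← hAv, lorentzPSL_out, ← hA]
    exact lorentz_nulv _ _
  rw [hf', LinearMap.map_smul, smul_comm] at h2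
  exact smul_right_injective Mink hs.ne' h2

lemma lorentzPSL_pow_apply {g : PSL2C} {v : Mink} {r : ℝ} (h : lorentzPSL g v = r • v) (n : ℕ) :
    lorentzPSL (g ^ n) v = r ^ n • v := by
  induction n with
  | zero => rw [pow_zero, pow_zero, map_one, one_smul]; rfl
  | succ n ih => rw [pow_succ, lorentzPSL_mul_apply, h, LinearMap.map_smul, ih, smul_smul, pow_succ,
      mul_comm]

lemma lorentzPSL_inv_eigen {g : PSL2C} {v : Mink} {r : ℝ} (hr : r ≠ 0)
    (h : lorentzPSL g v = r • v) : lorentzPSL g⁻¹ v = r⁻¹ • v := by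
  have h1 := lorentzPSL_inv_apply g v
  rw [h, LinearMap.map_smul] at h1
  rw [← h1, smul_smul, inv_mul_cancel₀ hr, one_smul, h1]

/-- In a discrete group fixing `f`, everything fixes the other end of a contracting element. -/
lemma actS_second_fixed {G : Subgroup PSL2C} (hG : IsDiscreteSubgroup G) {g h : PSL2C} (hg : g ∈ G)
    (hh : h ∈ G) {f f' : OnePoint ℂ} (hne : f ≠ f') {r s : ℝ} (hr0 : 0 < r) (hr1 : r < 1)
    (hf : lorentzPSL g (nul f) = r • nul f) (hf' : lorentzPSL g (nul f') = r⁻¹ • nul f')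
    (hs : lorentzPSL h (nul f) = s • nul f) : actS h f' = f' := by
  set k := form (nul f) (nul f') with hk
  have hk0 : 0 < k := lt_of_le_of_ne (form_nonneg (nul_mem_cone f) (nul_mem_cone f'))
    fun h0 => hne (eq_of_form_nul h0.symm)
  set w := lorentzPSL h (nul f') with hw
  have hwc : w ∈ cone := lorentzPSL_mem_cone h (nul_mem_cone f')
  set c := (Real.sqrt (2 * k))⁻¹ with hc
  have hc0 : 0 < c := inv_pos.2 (Real.sqrt_pos.2 (by positivity))
  obtain ⟨p, hp⟩ := exists_hyp_eq (v := c • (nul f + nul f'))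
    (smul_mem_cone hc0.le (add_mem_cone (nul_mem_cone f) (nul_mem_cone f'))) (by
      rw [form_smul_left, form_smul_right, form_add_left, form_add_right, form_add_right,
        form_nul_self, form_nul_self, form_comm (nul f'), ← hk, hc, ← mul_assoc, ← mul_inv,
        Real.mul_self_sqrt (by positivity)]
      field_simp
      ring)
  set C := c * (c * (s * k + (form w (nul f) + form w (nul f')))) with hC
  have hbound : ∀ n : ℕ, form (hyp (act3 (g ^ n * h * (g ^ n)⁻¹) p)) (hyp p) ≤ C := fun n => by
    have hn : 0 < r ^ n := pow_pos hr0 n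
    have e1 : lorentzPSL (g ^ n) (nul f) = r ^ n • nul f := lorentzPSL_pow_apply hf n
    have e2 : lorentzPSL (g ^ n) (nul f') = (r ^ n)⁻¹ • nul f' := by
      rw [← inv_pow]; exact lorentzPSL_pow_apply hf' n
    have i1 := lorentzPSL_inv_eigen hn.ne' e1
    have i2 := lorentzPSL_inv_eigen (inv_pos.2 hn).ne' e2
    rw [inv_inv] at i2
    have c1 : lorentzPSL (g ^ n * h * (g ^ n)⁻¹) (nul f) = s • nul f := by
      rw [lorentzPSL_mul_apply, i1, LinearMap.map_smul, lorentzPSL_mul_apply, hs,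
        LinearMap.map_smul, e1, smul_smul, smul_smul]
      congr 1
      field_simp
    have c2 : lorentzPSL (g ^ n * h * (g ^ n)⁻¹) (nul f') = r ^ n • lorentzPSL (g ^ n) w := by
      rw [lorentzPSL_mul_apply, i2, LinearMap.map_smul, lorentzPSL_mul_apply, hw]
    have d1 : form (lorentzPSL (g ^ n) w) (nul f) = (r ^ n)⁻¹ * form w (nul f) := by
      rw [form_lorentzPSL_left, i1, form_smul_right]
    have d2 : form (lorentzPSL (g ^ n) w) (nul f') = r ^ n * form w (nul f') := by
      rw [form_lorentzPSL_left, i2, form_smul_right]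
    have hfw : 0 ≤ form w (nul f') := form_nonneg hwc (nul_mem_cone f')
    rw [hyp_act3, hp, LinearMap.map_smul, map_add, c1, c2, form_smul_left, form_smul_right,
      form_add_left, form_add_right, form_add_right, form_smul_left, form_smul_left,
      form_smul_left, form_smul_left, form_nul_self, ← hk, d1, d2, hC]
    have e3 : r ^ n * (r ^ n)⁻¹ = 1 := mul_inv_cancel₀ hn.ne'
    have e4 : r ^ n * (r ^ n * form w (nul f')) ≤ form w (nul f') := by
      have : r ^ n ≤ 1 := pow_le_one₀ hr0.le hr1.le
      calc r ^ n * (r ^ n * form w (nul f')) ≤ 1 * (1 * form w (nul f')) := by gcongr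
        _ = _ := by ring
    have e5 : r ^ n * ((r ^ n)⁻¹ * form w (nul f)) = form w (nul f) := by
      rw [← mul_assoc, e3, one_mul]
    rw [e5]
    gcongr
    linarith
  obtain ⟨i, j, hij, heq⟩ : ∃ i j : ℕ, i < j ∧
      g ^ i * h * (g ^ i)⁻¹ = g ^ j * h * (g ^ j)⁻¹ := by
    have hfin := finite_form_hyp_le hG p C
    obtain ⟨i, -, j, -, hne, heq⟩ := Set.infinite_univ.exists_ne_map_eq_of_mapsTo
      (f := fun n : ℕ => g ^ n * h * (g ^ n)⁻¹)
      (t := {x | x ∈ G ∧ form (hyp (act3 x p)) (hyp p) ≤ C}) (fun n _ =>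
        ⟨G.mul_mem (G.mul_mem (G.pow_mem hg n) hh) (G.inv_mem (G.pow_mem hg n)), hbound n⟩) hfin
    rcases hne.lt_or_gt with hlt | hlt
    · exact ⟨i, j, hlt, heq⟩
    · exact ⟨j, i, hlt, heq.symm⟩
  obtain ⟨m, rfl⟩ := Nat.exists_eq_add_of_lt hij
  set t := m + 1 with ht
  have hcomm : g ^ t * h = h * g ^ t := by
    rw [add_assoc, ← ht, pow_add] at heq
    have h1 : h = g ^ t * h * (g ^ t)⁻¹ := by
      have := congrArg (fun x => (g ^ i)⁻¹ * x * g ^ i) heq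
      simpa [mul_assoc] using this
    exact (mul_inv_eq_iff_eq_mul.1 h1.symm)
  have hwt : lorentzPSL (g ^ t) w = (r⁻¹) ^ t • w := by
    rw [hw, ← lorentzPSL_mul_apply, hcomm, lorentzPSL_mul_apply, lorentzPSL_pow_apply hf',
      LinearMap.map_smul]
  have hzero : form w (nul f') = 0 := by
    have h1 := form_lorentzPSL (g ^ t) w (nul f')
    rw [hwt, lorentzPSL_pow_apply hf', form_smul_left, form_smul_right] at h1
    have h2 : 1 < r⁻¹ ^ t := one_lt_pow₀ ((one_lt_inv₀ hr0).2 hr1) (by omega)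
    have h3 : form w (nul f') * (r⁻¹ ^ t * r⁻¹ ^ t - 1) = 0 := by linear_combination h1
    rcases mul_eq_zero.1 h3 with h4 | h4
    · exact h4
    · nlinarith
  obtain ⟨q, hq, hqw⟩ := lorentzPSL_nul h f'
  rw [hw, hqw, form_smul_left, mul_eq_zero, or_iff_right hq.ne'] at hzero
  exact eq_of_form_nul hzero

/-- A discrete group fixing an ideal point is elementary. -/
lemma not_isNonElementary_of_fixed {G : Subgroup PSL2C} (hG : IsDiscreteSubgroup G) {O : H3}
    {f : OnePoint ℂ} (hf : ∀ g ∈ G, actS g f = f) : ¬ IsNonElementary G O := by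
  rw [IsNonElementary, not_not]
  have hscale : ∀ {e : OnePoint ℂ} {g : PSL2C}, actS g e = e →
      ∃ r : ℝ, 0 < r ∧ lorentzPSL g (nul e) = r • nul e := fun {e g} he => by
    obtain ⟨r, hr, h⟩ := lorentzPSL_nul g e
    rw [he] at h
    exact ⟨r, hr, h⟩
  by_cases hall : ∀ g ∈ G, lorentzPSL g (nul f) = nul f
  · refine ⟨f, f, limitSet_subset_pair (C := form (nul f) (hyp O) * form (nul f) (hyp O))
      fun g hg => ?_⟩
    rw [form_comm (nul f) (hyp (act3 g O)), hyp_act3, form_lorentzPSL_left, hall _ (G.inv_mem hg),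
      form_comm]
  · push Not at hall
    obtain ⟨g, hg, hgf⟩ := hall
    obtain ⟨g, hg, r, hr0, hr1, hgr⟩ : ∃ g ∈ G, ∃ r : ℝ, 0 < r ∧ r < 1 ∧
        lorentzPSL g (nul f) = r • nul f := by
      obtain ⟨r, hr0, hr⟩ := hscale (hf g hg)
      rcases lt_trichotomy r 1 with h | h | h
      · exact ⟨g, hg, r, hr0, h, hr⟩
      · rw [h, one_smul] at hr
        exact absurd hr hgf
      · exact ⟨g⁻¹, G.inv_mem hg, r⁻¹, inv_pos.2 hr0, inv_lt_one_of_one_lt₀ h,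
          lorentzPSL_inv_eigen hr0.ne' hr⟩
    obtain ⟨f', hf'⟩ := exists_second_fixed (hf g hg) hgr
    have hne : f ≠ f' := by
      rintro rfl
      rw [hgr] at hf'
      have h1 : r = r⁻¹ :=
        smul_left_injective ℝ (fun h => (fst_nul_pos f).ne' (congrArg Prod.fst h)) hf'
      have h2 := (one_lt_inv₀ hr0).2 hr1
      linarith
    refine ⟨f, f', limitSet_subset_pair (C := form (nul f) (hyp O) * form (nul f') (hyp O))
      fun h hh => ?_⟩
    have hh' := G.inv_mem hh
    obtain ⟨s, hs0, hs⟩ := hscale (hf _ hh')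
    obtain ⟨t, ht0, ht⟩ := hscale (actS_second_fixed hG hg hh' hne hr0 hr1 hgr hf' hs)
    have hst : s * t = 1 := by
      have h1 := form_lorentzPSL h⁻¹ (nul f) (nul f')
      rw [hs, ht, form_smul_left, form_smul_right] at h1
      have h2 : form (nul f) (nul f') ≠ 0 := fun h0 => hne (eq_of_form_nul h0)
      refine mul_right_cancel₀ h2 ?_
      linear_combination h1
    rw [form_comm (nul f), form_comm (nul f'), hyp_act3, form_lorentzPSL_left,
      form_lorentzPSL_left, hs, ht, form_smul_right, form_smul_right, form_comm (hyp O),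
      form_comm (hyp O)]
    refine le_of_eq ?_
    linear_combination (form (nul f) (hyp O) * form (nul f') (hyp O)) * hst

end Mink

namespace Mink

open Filter

/-! ### Cannon–Thurston maps and sequences of group elements -/

section sequences

variable {ι : Type*} {l : Filter ι} {Γ : Subgroup PSL2C} {O : H3}

/-- Pairwise distinct elements of a discrete group move the base point to infinity. -/
lemma tendsto_fst_hyp_of_cofinite (hΓ : IsDiscreteSubgroup Γ) (O : H3) {g : ι → PSL2C}
    (hg : ∀ i, g i ∈ Γ) (h : Tendsto g l cofinite) :
    Tendsto (fun i => (hyp (act3 (g i) O)).1) l atTop := by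
  refine tendsto_atTop.2 fun C => ?_
  have hfin := finite_form_hyp_le hΓ O (2 * (C * (hyp O).1))
  filter_upwards [h.eventually hfin.eventually_cofinite_notMem] with i hi
  by_contra! hlt
  refine hi ⟨hg i, (form_le (hyp_mem_cone _) (hyp_mem_cone _)).trans ?_⟩
  have := fst_hyp_pos O
  gcongr

lemma exists_tendsto_kb_of_cofinite (hΓ : IsDiscreteSubgroup Γ) (O : H3) (U : Ultrafilter ι)
    {g : ι → PSL2C} (hg : ∀ i, g i ∈ Γ) (h : Tendsto g U cofinite) :
    ∃ ξ ζ, Tendsto (fun i => klein (hyp (act3 (g i) O))) U (𝓝 (kb ξ)) ∧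
      Tendsto (fun i => klein (hyp (act3 (g i)⁻¹ O))) U (𝓝 (kb ζ)) := by
  have hfst := tendsto_fst_hyp_of_cofinite hΓ O hg h
  obtain ⟨ξ, hξ⟩ := exists_tendsto_kb U hfst
  obtain ⟨ζ, hζ⟩ := exists_tendsto_kb U (tendsto_fst_hyp_inv hfst)
  exact ⟨ξ, ζ, hξ, hζ⟩

/-- A discrete non-elementary group has no nonempty invariant set with at most two points. -/
lemma not_subset_pair_of_invariant (hΓ : IsDiscreteSubgroup Γ) (hne : IsNonElementary Γ O)
    {F : Set (OnePoint ℂ)} (hF : F.Nonempty) (hinv : ∀ g ∈ Γ, ∀ f ∈ F, actS g f ∈ F)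
    (a b : OnePoint ℂ) : ¬ F ⊆ {a, b} := fun hsub => by
  obtain ⟨η, hη, hηab⟩ : ∃ η ∈ limitSet Γ O, η ∉ ({a, b} : Set (OnePoint ℂ)) := by
    by_contra! h
    exact hne ⟨a, b, h⟩
  obtain ⟨g, hg, hlim⟩ := exists_tendsto_of_mem_limitSet hη
  set U : Ultrafilter ℕ := Ultrafilter.of atTop with hU
  have hlimU := hlim.mono_left (Ultrafilter.of_le (f := atTop))
  obtain ⟨ζ, hζ⟩ := exists_tendsto_kb U
    (tendsto_fst_hyp_inv (tendsto_fst_hyp_atTop (norm_kb η) hlimU))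
  have honly : ∀ f ∈ F, f = ζ := fun f hf => by
    by_contra hfζ
    have h1 := isEmbedding_kb.tendsto_nhds_iff.2 (tendsto_kb_actS hlimU hζ hfζ)
    exact hηab ((Set.toFinite ({a, b} : Set (OnePoint ℂ))).isClosed.mem_of_tendsto h1
      (Eventually.of_forall fun n => hsub (hinv _ (hg n) f hf)))
  obtain ⟨f, hf⟩ := hF
  refine not_isNonElementary_of_fixed hΓ (f := f) (fun g hg => ?_) hne
  rw [honly _ (hinv g hg f hf), honly f hf]

/-- A Cannon–Thurston map carries the limit of a sequence of group elements to the limit of its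
image. -/
lemma ct_eq_of_tendsto [l.NeBot] {ρ : Γ →* PSL2C} {ct : OnePoint ℂ → OnePoint ℂ}
    (hct : IsCTMap Γ ρ O ct) (hG : IsDiscreteSubgroup ρ.range) (hne : IsNonElementary ρ.range O)
    {γ : ι → Γ} {ξ ζ η θ : OnePoint ℂ}
    (hξ : Tendsto (fun i => klein (hyp (act3 (γ i : PSL2C) O))) l (𝓝 (kb ξ)))
    (hζ : Tendsto (fun i => klein (hyp (act3 (γ i : PSL2C)⁻¹ O))) l (𝓝 (kb ζ)))
    (hη : Tendsto (fun i => klein (hyp (act3 (ρ (γ i)) O))) l (𝓝 (kb η)))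
    (hθ : Tendsto (fun i => klein (hyp (act3 (ρ (γ i))⁻¹ O))) l (𝓝 (kb θ))) :
    ct ξ = η := by
  obtain ⟨hcont, -, hequiv⟩ := hct
  have hξΛ : ξ ∈ limitSet Γ O := mem_limitSet_of_tendsto (fun i => (γ i).2) hξ
  obtain ⟨e, he, heζ, heθ⟩ : ∃ e ∈ limitSet Γ O, e ≠ ζ ∧ ct e ≠ θ := by
    have h := not_subset_pair_of_invariant hG hne (F := ct '' limitSet Γ O) ⟨_, ξ, hξΛ, rfl⟩
      (by
        rintro _ ⟨γ, rfl⟩ _ ⟨x, hx, rfl⟩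
        exact ⟨_, actS_mem_limitSet γ.2 hx, hequiv γ x hx⟩) (ct ζ) θ
    obtain ⟨_, ⟨e, he, rfl⟩, hpair⟩ := Set.not_subset.1 h
    exact ⟨e, he, fun h => hpair (Or.inl (congrArg ct h)), fun h => hpair (Or.inr h)⟩
  have h1 := isEmbedding_kb.tendsto_nhds_iff.2 (tendsto_kb_actS hξ hζ heζ)
  have h2 := isEmbedding_kb.tendsto_nhds_iff.2 (tendsto_kb_actS hη hθ heθ)
  have h3 := (hcont ξ hξΛ).tendsto.comp (tendsto_nhdsWithin_iff.2
    ⟨h1, Eventually.of_forall fun i => actS_mem_limitSet (γ i).2 he⟩)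
  exact tendsto_nhds_unique (h3.congr fun i => hequiv (γ i) e he) h2

end sequences

/-- A segment passing near the base point subtends a definite angle there. -/
lemma fst_mul_fst_le_of_mem_geoSeg {O X Y p : H3} (hp : p ∈ geoSeg X Y) {L : ℝ}
    (hL : d3 O p ≤ L) : (hyp X).1 * (hyp Y).1 ≤
      8 * (2 * (Real.exp L * (hyp O).1)) ^ 2 * form (hyp X) (hyp Y) := by
  have hpL : (hyp p).1 ≤ 2 * (Real.exp L * (hyp O).1) := by
    have h1 := form_hyp_triangle p O origin
    rw [← fst_hyp, ← fst_hyp, form_comm] at h1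
    refine h1.trans ?_
    have := fst_hyp_pos O
    have h2 := (form_hyp_le_exp_d3 O p).trans (Real.exp_le_exp.2 hL)
    gcongr
  have hX := form_hyp_triangle X p origin
  have hY := form_hyp_triangle Y p origin
  rw [← fst_hyp, ← fst_hyp] at hX hY
  have hXY : form (hyp X) (hyp p) * form (hyp Y) (hyp p) ≤ 2 * form (hyp X) (hyp Y) := by
    have h1 := one_le_form_hyp X p
    have h2 := one_le_form_hyp Y p
    have h3 := form_hyp_le_exp_d3 p Y
    rw [form_comm] at h3
    calc _ ≤ Real.exp (d3 X p) * Real.exp (d3 p Y) := by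
          have := form_hyp_le_exp_d3 X p
          gcongr
      _ = Real.exp (d3 X Y) := by rw [← Real.exp_add]; exact congrArg _ hp
      _ ≤ _ := exp_d3_le X Y
  have hp0 := fst_hyp_pos p
  have hX0 := fst_hyp_pos X
  have hY0 := fst_hyp_pos Y
  have hXY0 := one_le_form_hyp X Y
  calc (hyp X).1 * (hyp Y).1
      ≤ (2 * (form (hyp X) (hyp p) * (hyp p).1)) * (2 * (form (hyp Y) (hyp p) * (hyp p).1)) := by
        have := hX0.le.trans hX
        gcongr
    _ = 4 * (hyp p).1 ^ 2 * (form (hyp X) (hyp p) * form (hyp Y) (hyp p)) := by ring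
    _ ≤ 4 * (hyp p).1 ^ 2 * (2 * form (hyp X) (hyp Y)) := by gcongr
    _ = 8 * (hyp p).1 ^ 2 * form (hyp X) (hyp Y) := by ring
    _ ≤ _ := by gcongr

/-- Word geodesics far from the identity have images spanning segments far from the base point. -/
lemma exists_radius {Γ : Subgroup PSL2C} (hΓ : IsDiscreteSubgroup Γ)
    (hGF : IsGeometricallyFinite Γ) {O : H3} {S : Set Γ} (hS : S.Finite)
    {len : Γ → ℕ} (hmul : ∀ g h, len (g * h) ≤ len g + len h) (hinv : ∀ g, len g⁻¹ = len g)
    {ρ : Γ →* PSL2C} (hρ : Function.Injective ρ) (hG : IsDiscreteSubgroup ρ.range)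
    (hne : IsNonElementary ρ.range O) {ct : OnePoint ℂ → OnePoint ℂ} (hct : IsCTMap Γ ρ O ct)
    (L : ℝ) :
    ∃ R : ℕ, ∀ (m : ℕ) (w : ℕ → Γ), (∀ i < m, (w i)⁻¹ * w (i + 1) ∈ S) →
      (∀ i ≤ m, ∀ j ≤ m, i ≤ j → j - i ≤ len ((w i)⁻¹ * w j)) → (∀ i ≤ m, R ≤ len (w i)) →
      ∀ p ∈ geoSeg (act3 (ρ (w 0)) O) (act3 (ρ (w m)) O), L ≤ d3 O p := by
  by_contra! hcon
  choose m w hstep hgeo hlen p hp hd using hcon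
  set U : Ultrafilter ℕ := Ultrafilter.of atTop with hU
  have hUle : (U : Filter ℕ) ≤ atTop := Ultrafilter.of_le _
  have hcof : ∀ γ : ℕ → Γ, (∀ n, n ≤ len (γ n)) → Tendsto γ U cofinite := fun γ hγ => by
    rw [Tendsto, le_cofinite_iff_eventually_ne]
    intro x
    rw [eventually_map]
    filter_upwards [hUle (eventually_gt_atTop (len x))] with n hn h
    have := hγ n
    rw [h] at this
    exact (this.trans_lt hn).false
  have hlimits : ∀ γ : ℕ → Γ, (∀ n, n ≤ len (γ n)) → ∃ ξ,
      Tendsto (fun n => klein (hyp (act3 (γ n : PSL2C) O))) U (𝓝 (kb ξ)) ∧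
      Tendsto (fun n => klein (hyp (act3 (ρ (γ n)) O))) U (𝓝 (kb (ct ξ))) := fun γ hγ => by
    obtain ⟨ξ, ζ, hξ, hζ⟩ := exists_tendsto_kb_of_cofinite hΓ O U (fun n => (γ n).2)
      (Subtype.val_injective.tendsto_cofinite.comp (hcof γ hγ))
    obtain ⟨η, θ, hη, hθ⟩ := exists_tendsto_kb_of_cofinite hG O U (fun n => ⟨γ n, rfl⟩)
      (hρ.tendsto_cofinite.comp (hcof γ hγ))
    have := ct_eq_of_tendsto hct hG hne hξ hζ hη hθ
    exact ⟨ξ, hξ, this ▸ hη⟩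
  obtain ⟨ξ, hξ, hη⟩ := hlimits (fun n => w n 0) fun n => hlen n 0 (Nat.zero_le _)
  obtain ⟨ξ', hξ', hη'⟩ := hlimits (fun n => w n (m n)) fun n => hlen n (m n) le_rfl
  have heq : ξ = ξ' := by
    refine kb_injective (tendsto_nhds_unique ?_ hξ')
    refine tendsto_of_norm_sub_sq_le hξ (e := fun n => 2 *
      (form (hyp (act3 (w n 0 : PSL2C) O)) (hyp (act3 (w n (m n) : PSL2C) O)) /
        ((hyp (act3 (w n 0 : PSL2C) O)).1 * (hyp (act3 (w n (m n) : PSL2C) O)).1))) ?_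
      (Eventually.of_forall fun n => ?_)
    · rw [← mul_zero (2 : ℝ)]
      refine Tendsto.const_mul 2 ?_
      refine tendsto_order.2 ⟨fun a ha => Eventually.of_forall fun n => ha.trans_le ?_,
        fun ε hε => ?_⟩
      · exact div_nonneg (form_nonneg (hyp_mem_cone _) (hyp_mem_cone _))
          (mul_pos (fst_hyp_pos _) (fst_hyp_pos _)).le
      · obtain ⟨R, hR⟩ := exists_form_orbit_lt hΓ hGF O hS hmul hinv hε
        filter_upwards [hUle (eventually_ge_atTop R)] with n hn
        rw [div_lt_iff₀ (mul_pos (fst_hyp_pos _) (fst_hyp_pos _))]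
        exact hR (m n) (w n) (hstep n) (hgeo n) fun i hi => le_trans hn (hlen n i hi)
    · rw [norm_sub_rev]
      exact norm_klein_sub_sq_le (hyp_mem_cone _) (hyp_mem_cone _) (fst_hyp_pos _) (fst_hyp_pos _)
  subst heq
  set K := 8 * (2 * (Real.exp L * (hyp O).1)) ^ 2 with hK
  have hinner := (hη.inner hη').const_sub 1 |>.const_mul K
  rw [real_inner_self_eq_norm_sq, norm_kb, one_pow, sub_self, mul_zero] at hinner
  refine absurd (ge_of_tendsto hinner (b := 1) (Eventually.of_forall fun n => ?_)) (by norm_num)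
  have h1 := fst_mul_fst_le_of_mem_geoSeg (hp n) (hd n).le
  have hX := fst_hyp_pos (act3 (ρ (w n 0)) O)
  have hY := fst_hyp_pos (act3 (ρ (w n (m n))) O)
  rw [form_eq_klein hX.ne' hY.ne', ← hK] at h1
  refine le_of_mul_le_mul_left ?_ (mul_pos hX hY)
  linarith

end Mink

/-! ### Word length -/

section wordLength

variable {S : Set PSL2C}

lemma wordLength_prod_le {l : List PSL2C} (h : ∀ x ∈ l, x ∈ S) :
    wordLength S l.prod ≤ l.length :=
  Nat.sInf_le ⟨l, rfl, h, rfl⟩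

lemma exists_word (hS : ∀ s ∈ S, s⁻¹ ∈ S) {g : PSL2C} (hg : g ∈ Subgroup.closure S) :
    ∃ l : List PSL2C, l.length = wordLength S g ∧ (∀ x ∈ l, x ∈ S) ∧ l.prod = g := by
  refine Nat.sInf_mem (s := {n | ∃ l : List PSL2C, l.length = n ∧ (∀ x ∈ l, x ∈ S) ∧ l.prod = g}) ?_
  rw [← Subgroup.mem_toSubmonoid, Subgroup.closure_toSubmonoid] at hg
  obtain ⟨l, hl, hprod⟩ := Submonoid.exists_list_of_mem_closure hg
  exact ⟨_, l, rfl, fun x hx => (hl x hx).elim id fun h => inv_inv x ▸ hS _ h, hprod⟩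

lemma wordLength_mul_le (hS : ∀ s ∈ S, s⁻¹ ∈ S) {g h : PSL2C} (hg : g ∈ Subgroup.closure S)
    (hh : h ∈ Subgroup.closure S) :
    wordLength S (g * h) ≤ wordLength S g + wordLength S h := by
  obtain ⟨l, hl, hlS, rfl⟩ := exists_word hS hg
  obtain ⟨l', hl', hlS', rfl⟩ := exists_word hS hh
  rw [← hl, ← hl', ← List.prod_append, ← List.length_append]
  exact wordLength_prod_le fun x hx => (List.mem_append.1 hx).elim (hlS x) (hlS' x)

lemma wordLength_inv_le (hS : ∀ s ∈ S, s⁻¹ ∈ S) {g : PSL2C} (hg : g ∈ Subgroup.closure S) :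
    wordLength S g⁻¹ ≤ wordLength S g := by
  obtain ⟨l, hl, hlS, rfl⟩ := exists_word hS hg
  rw [← hl, List.prod_inv_reverse]
  refine (wordLength_prod_le fun x hx => ?_).trans_eq (by simp)
  rw [List.mem_reverse, List.mem_map] at hx
  obtain ⟨y, hy, rfl⟩ := hx
  exact hS y (hlS y hy)

lemma wordLength_inv (hS : ∀ s ∈ S, s⁻¹ ∈ S) {g : PSL2C} (hg : g ∈ Subgroup.closure S) :
    wordLength S g⁻¹ = wordLength S g :=
  (wordLength_inv_le hS hg).antisymm
    (by simpa using wordLength_inv_le hS ((Subgroup.closure S).inv_mem hg))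

lemma wordLength_path_le {w : ℕ → PSL2C} {i k : ℕ}
    (hw : ∀ j < i + k, (w j)⁻¹ * w (j + 1) ∈ S) : wordLength S ((w i)⁻¹ * w (i + k)) ≤ k := by
  suffices h : ∃ l : List PSL2C, l.length = k ∧ (∀ x ∈ l, x ∈ S) ∧
      l.prod = (w i)⁻¹ * w (i + k) from Nat.sInf_le h
  induction k with
  | zero => exact ⟨[], rfl, by simp, by simp⟩
  | succ k ih =>
    obtain ⟨l, hl, hlS, hprod⟩ := ih fun j hj => hw j (by lia)
    refine ⟨l ++ [(w (i + k))⁻¹ * w (i + k + 1)], by simp [hl], fun x hx => ?_, ?_⟩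
    · rcases List.mem_append.1 hx with hx | hx
      · exact hlS x hx
      · rw [List.mem_singleton.1 hx]
        exact hw _ (by lia)
    · rw [List.prod_append, hprod, List.prod_singleton, mul_assoc, mul_inv_cancel_left, add_assoc]

/-- Subsegments of a word geodesic are geodesic. -/
lemma IsWordGeodesic.sub_le (hS : ∀ s ∈ S, s⁻¹ ∈ S) {m : ℕ} {w : ℕ → PSL2C}
    (hw : IsWordGeodesic S m w) (hmem : ∀ i ≤ m, w i ∈ Subgroup.closure S) {i j : ℕ} (hij : i ≤ j)
    (hjm : j ≤ m) : j - i ≤ wordLength S ((w i)⁻¹ * w j) := by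
  obtain ⟨hstep, hlen⟩ := hw
  have hc : ∀ a ≤ m, ∀ b ≤ m, (w a)⁻¹ * w b ∈ Subgroup.closure S := fun a ha b hb =>
    mul_mem (inv_mem (hmem a ha)) (hmem b hb)
  have h1 := wordLength_path_le (w := w) (i := 0) (k := i) fun a ha => hstep a (by lia)
  have h2 := wordLength_path_le (w := w) (i := j) (k := m - j) fun a ha => hstep a (by lia)
  rw [Nat.add_sub_cancel' hjm] at h2
  rw [zero_add] at h1
  have him := hij.trans hjm
  have h3 := wordLength_mul_le hS (hc 0 (Nat.zero_le m) i him) (hc i him m le_rfl)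
  have h4 := wordLength_mul_le hS (hc i him j hjm) (hc j hjm m le_rfl)
  rw [mul_assoc, mul_inv_cancel_left] at h3 h4
  rw [wordDist] at hlen
  lia

end wordLength

/-- **Corollary 3.8 of the paper.**  Let `Γ` be a geometrically finite Kleinian group and
`ρ : Γ → G` a weakly type preserving isomorphism onto a non-elementary Kleinian group
for which a Cannon–Thurston map exists.  Then there is `f₁ : ℕ → ℕ` such that for every
`L`, every word-geodesic segment of the Cayley graph of `Γ` lying outside
`B_Γ(1; f₁ L)` has its `ℍ³`-geodesic image `[j(λ)]` outside `B(O; L)`. -/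
theorem CT_map_implies_inverted_UEPP
    (Γ : Subgroup PSL2C) (O : H3)
    (hΓKleinian : IsKleinian Γ)
    (hΓGF : IsGeometricallyFinite Γ)
    -- `O` is not fixed by any nontrivial element of the groups involved:
    (hOΓ : ∀ g ∈ Γ, g ≠ 1 → act3 g O ≠ O)
    -- a finite symmetric generating set for `Γ`:
    (S : Finset PSL2C)
    (hSsub : (S : Set PSL2C) ⊆ (Γ : Set PSL2C))
    (hSsymm : ∀ s ∈ S, s⁻¹ ∈ S)
    (hSgen : Subgroup.closure (S : Set PSL2C) = Γ)
    (ρ : ↥Γ →* PSL2C)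
    (hρinj : Function.Injective ρ)
    (hGKleinian : IsKleinian ρ.range)
    (hwtp : WeaklyTypePreserving Γ ρ)
    (hGnonelem : IsNonElementary ρ.range O)
    -- a Cannon–Thurston map exists:
    (ct : OnePoint ℂ → OnePoint ℂ)
    (hct : IsCTMap Γ ρ O ct) :
    ∃ f₁ : ℕ → ℕ, ∀ L : ℕ, ∀ m : ℕ, ∀ w : ℕ → PSL2C,
      (∀ i ≤ m, w i ∈ Γ) →
      IsWordGeodesic (S : Set PSL2C) m w →
      -- `λ` lies outside `B_Γ(1; f₁ L)`:
      (∀ i ≤ m, f₁ L ≤ wordDist (S : Set PSL2C) 1 (w i)) →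
      -- then `[j(λ)]` lies outside `B(O; L)`:
      ∀ γ γ' : ↥Γ, (γ : PSL2C) = w 0 → (γ' : PSL2C) = w m →
        ∀ p ∈ geoSeg (act3 (ρ γ) O) (act3 (ρ γ') O), (L : ℝ) ≤ d3 O p := by
  have hS : ∀ s ∈ (S : Set PSL2C), s⁻¹ ∈ (S : Set PSL2C) := fun s hs => hSsymm s hs
  have hcl : ∀ g ∈ Γ, g ∈ Subgroup.closure (S : Set PSL2C) := fun g hg => hSgen.symm ▸ hg
  have hfin : {g : Γ | (g : PSL2C) ∈ S}.Finite :=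
    S.finite_toSet.preimage Subtype.val_injective.injOn
  have hR := fun L : ℕ => Mink.exists_radius hΓKleinian.1 hΓGF hfin
    (len := fun g : Γ => wordLength S g)
    (fun g h => wordLength_mul_le hS (hcl g g.2) (hcl h h.2))
    (fun g => wordLength_inv hS (hcl g g.2)) hρinj hGKleinian.1 hGnonelem hct L
  choose f₁ hf₁ using hR
  refine ⟨f₁, fun L m w hw hgeo hout γ γ' hγ hγ' p hp => ?_⟩
  classical
  set v : ℕ → Γ := fun i => if h : w i ∈ Γ then ⟨w i, h⟩ else 1 with hv
  have hvw : ∀ i ≤ m, (v i : PSL2C) = w i := fun i hi => by simp [hv, hw i hi]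
  refine hf₁ L m v (fun i hi => ?_) (fun i hi j hj hij => ?_) (fun i hi => ?_) p ?_
  · simpa [hvw i hi.le, hvw (i + 1) hi] using hgeo.1 i hi
  · simpa [hvw i hi, hvw j hj] using hgeo.sub_le hS (fun k hk => hcl _ (hw k hk)) hij hj
  · simpa [hvw i hi, wordDist] using hout i hi
  · have h0 : v 0 = γ := Subtype.ext ((hvw 0 (Nat.zero_le m)).trans hγ.symm)
    have hm : v m = γ' := Subtype.ext ((hvw m le_rfl).trans hγ'.symm)
    rwa [h0, hm]
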